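/- arXiv:1803.01506 — 3 statements merged into one kernel-verified Lean document; each statement's English description precedes it below -/
import Mathlib

section
/- Let K ⊂ ℝⁿ be a convex body with 0 in its interior and suppose every hyperplane through the origin divides K into two parts of equal n-dimensional volume, i.e. vol_n(K ∩ ξ⁺) = vol_n(K ∩ ξ⁻) for every ξ ∈ Sⁿ⁻¹ where ξ± = {x : ±⟨x,ξ⟩ ≥ 0}. Then K is origin-symmetric: K = −K. (Falconer's characterization.) -/
open scoped RealInnerProductSpace
open MeasureTheory

section

variable {E : Type*} [NormedAddCommGroup E] [InnerProductSpace ℝ E] [MeasurableSpace E]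
  [BorelSpace E]

/-- Two finite measures on a finite-dimensional space which agree on all closed half-spaces are
equal. -/
theorem measure_ext_of_halfSpaces [FiniteDimensional ℝ E] {μ ν : Measure E} [IsFiniteMeasure μ]
    [IsFiniteMeasure ν] (h : ∀ (ξ : E) (s : ℝ), μ {x | s ≤ ⟪x, ξ⟫} = ν {x | s ≤ ⟪x, ξ⟫}) :
    μ = ν := by
  have : CompleteSpace E := FiniteDimensional.complete ℝ E
  have : SecondCountableTopology E := by
    have := FiniteDimensional.proper_real E
    infer_instance
  refine Measure.ext_of_charFun (funext fun ξ ↦ ?_)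
  have hm : Measurable fun x : E ↦ ⟪x, ξ⟫ := by fun_prop
  have hmap : μ.map (fun x ↦ ⟪x, ξ⟫) = ν.map (fun x ↦ ⟪x, ξ⟫) := by
    refine Measure.ext_of_Ici _ _ fun s ↦ ?_
    rw [Measure.map_apply hm measurableSet_Ici, Measure.map_apply hm measurableSet_Ici]
    exact h ξ s
  have key (ρ : Measure E) :
      charFun ρ ξ = ∫ t, Complex.exp ((t : ℂ) * Complex.I) ∂ρ.map (fun x ↦ ⟪x, ξ⟫) := by
    rw [integral_map hm.aemeasurable (by fun_prop), charFun_apply]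
  rw [key, key, hmap]

/-- Central hyperplanes are null sets. -/
theorem ae_inner_ne_zero [FiniteDimensional ℝ E] (μ : Measure E) [μ.IsAddHaarMeasure] {ξ : E}
    (hξ : ξ ≠ 0) : ∀ᵐ x ∂μ, ⟪x, ξ⟫ ≠ 0 := by
  have h := Measure.addHaar_submodule μ (innerₗ E ξ).ker fun htop ↦ hξ <| by
    have : ξ ∈ (innerₗ E ξ).ker := htop ▸ Submodule.mem_top
    simpa using this
  rw [ae_iff]
  convert h using 2
  ext x
  simp [real_inner_comm]

/-- If every central hyperplane is null for a finite measure and bisects it, then opposite wedges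
have the same measure. -/
theorem measure_wedge_eq {m : Measure E} [IsFiniteMeasure m]
    (hnull : ∀ ξ : E, ξ ≠ 0 → ∀ᵐ x ∂m, ⟪x, ξ⟫ ≠ 0)
    (hm : ∀ ξ : E, m {x | 0 ≤ ⟪x, ξ⟫} = m {x | ⟪x, ξ⟫ ≤ 0}) {e : E} (he : e ≠ 0) (η : E) :
    m {x | 0 < ⟪x, e⟫ ∧ 0 ≤ ⟪x, η⟫} = m {x | ⟪x, e⟫ < 0 ∧ ⟪x, η⟫ ≤ 0} := by
  have hmeas (ξ : E) : Measurable fun x : E ↦ ⟪x, ξ⟫ :=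
    (continuous_id.inner continuous_const).measurable
  have hA (ξ : E) : MeasurableSet {x : E | 0 ≤ ⟪x, ξ⟫} := measurableSet_le measurable_const (hmeas ξ)
  have hN (ξ : E) : MeasurableSet {x : E | ⟪x, ξ⟫ ≤ 0} := measurableSet_le (hmeas ξ) measurable_const
  rcases eq_or_ne η 0 with rfl | hη
  · have h1 : m {x | 0 < ⟪x, e⟫} = m {x | 0 ≤ ⟪x, e⟫} := measure_congr <| by
      filter_upwards [hnull e he] with x hx
      exact propext ⟨le_of_lt, fun h ↦ lt_of_le_of_ne h hx.symm⟩
    have h2 : m {x | ⟪x, e⟫ < 0} = m {x | ⟪x, e⟫ ≤ 0} := measure_congr <| by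
      filter_upwards [hnull e he] with x hx
      exact propext ⟨le_of_lt, fun h ↦ lt_of_le_of_ne h hx⟩
    simpa [h1, h2] using hm e
  have half (ξ : E) (hξ : ξ ≠ 0) : 2 * m.real {x | 0 ≤ ⟪x, ξ⟫} = m.real Set.univ := by
    have h1 : m.real {x | 0 ≤ ⟪x, ξ⟫}ᶜ = m.real {x | ⟪x, ξ⟫ ≤ 0} := measureReal_congr <| by
      filter_upwards [hnull ξ hξ] with x hx
      exact propext ⟨fun h ↦ (not_le.1 (show ¬ 0 ≤ ⟪x, ξ⟫ from h)).le,
        fun h ↦ not_le.2 (lt_of_le_of_ne h hx)⟩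
    have h2 := measureReal_add_measureReal_compl (μ := m) (hA ξ)
    have h3 : m.real {x | 0 ≤ ⟪x, ξ⟫} = m.real {x | ⟪x, ξ⟫ ≤ 0} := congrArg ENNReal.toReal (hm ξ)
    linarith
  have h1 := measureReal_inter_add_sdiff (μ := m) (s := {x : E | 0 ≤ ⟪x, η⟫}) (hN e)
  have h2 := measureReal_inter_add_sdiff (μ := m) (s := {x : E | ⟪x, e⟫ ≤ 0}) (hA η)
  have h3 : m.real {x | 0 ≤ ⟪x, e⟫} = m.real {x | ⟪x, e⟫ ≤ 0} := congrArg ENNReal.toReal (hm e)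
  have h4 : m.real ({x | 0 ≤ ⟪x, η⟫} \ {x | ⟪x, e⟫ ≤ 0}) =
      m.real {x | 0 < ⟪x, e⟫ ∧ 0 ≤ ⟪x, η⟫} := by
    congr 1
    ext x
    simp [and_comm]
  have h5 : m.real ({x | ⟪x, e⟫ ≤ 0} \ {x | 0 ≤ ⟪x, η⟫}) =
      m.real {x | ⟪x, e⟫ < 0 ∧ ⟪x, η⟫ ≤ 0} := measureReal_congr <| by
    filter_upwards [hnull e he, hnull η hη] with x hx hx'
    refine propext ⟨fun h ↦ ⟨lt_of_le_of_ne h.1 hx, (not_le.1 h.2).le⟩,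
      fun h ↦ ⟨h.1.le, not_le.2 (lt_of_le_of_ne h.2 hx')⟩⟩
  rw [Set.inter_comm] at h2
  have := half e he
  have := half η hη
  refine (measureReal_eq_measureReal_iff).1 ?_
  linarith

/-- If every central hyperplane bisects `K`, then `K` and `-K` have the same volume in every
cone contained in an open half-space; the cone is described by its central projection. -/
theorem measure_inter_cone_eq [FiniteDimensional ℝ E] (μ : Measure E) [μ.IsAddHaarMeasure]
    {K : Set E} (hK : IsCompact K)
    (hbisect : ∀ ξ : E, μ (K ∩ {x | 0 ≤ ⟪x, ξ⟫}) = μ (K ∩ {x | ⟪x, ξ⟫ ≤ 0}))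
    {e : E} (he : e ≠ 0) {S : Set E} (hS : MeasurableSet S) :
    μ (K ∩ {x | 0 < ⟪x, e⟫ ∧ ⟪x, e⟫⁻¹ • x ∈ S}) =
      μ (-K ∩ {x | 0 < ⟪x, e⟫ ∧ ⟪x, e⟫⁻¹ • x ∈ S}) := by
  have : SecondCountableTopology E := by
    have := FiniteDimensional.proper_real E
    infer_instance
  have hKm : MeasurableSet K := hK.measurableSet
  have hmeas (ξ : E) : Measurable fun x : E ↦ ⟪x, ξ⟫ := by fun_prop
  have hP : MeasurableSet {x : E | 0 < ⟪x, e⟫} := measurableSet_lt measurable_const (hmeas e)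
  have hφ : Measurable fun x : E ↦ ⟪x, e⟫⁻¹ • x := by fun_prop
  have : IsFiniteMeasure (μ.restrict K) := ⟨by simpa using hK.measure_lt_top⟩
  have : IsFiniteMeasure (μ.restrict (-K)) := ⟨by simpa using hK.measure_lt_top⟩
  have happ (L T : Set E) (hT : MeasurableSet T) :
      (((μ.restrict L).restrict {x | 0 < ⟪x, e⟫}).map fun x ↦ ⟪x, e⟫⁻¹ • x) T =
        μ (L ∩ {x | 0 < ⟪x, e⟫ ∧ ⟪x, e⟫⁻¹ • x ∈ T}) := by
    rw [Measure.map_apply hφ hT, Measure.restrict_apply (hφ hT),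
      Measure.restrict_apply ((hφ hT).inter hP)]
    congr 1
    ext x
    simp only [Set.mem_inter_iff, Set.mem_preimage, Set.mem_ofPred_eq]
    tauto
  rw [← happ _ _ hS, ← happ _ _ hS]
  congr 1
  refine measure_ext_of_halfSpaces fun ξ s ↦ ?_
  rw [happ _ _ (measurableSet_le measurable_const (hmeas ξ)),
    happ _ _ (measurableSet_le measurable_const (hmeas ξ))]
  have hset : {x : E | 0 < ⟪x, e⟫ ∧ ⟪x, e⟫⁻¹ • x ∈ {u : E | s ≤ ⟪u, ξ⟫}} =
      {x | 0 < ⟪x, e⟫ ∧ 0 ≤ ⟪x, ξ - s • e⟫} := by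
    ext x
    refine and_congr_right fun hx ↦ ?_
    rw [Set.mem_ofPred_eq, real_inner_smul_left, inner_sub_right, real_inner_smul_right,
      ← div_eq_inv_mul, le_div_iff₀ hx, sub_nonneg]
  have hwedge := measure_wedge_eq (m := μ.restrict K)
    (fun ξ hξ ↦ ae_restrict_of_ae (ae_inner_ne_zero μ hξ))
    (fun ξ ↦ by
      rw [Measure.restrict_apply (measurableSet_le measurable_const (hmeas ξ)),
        Measure.restrict_apply (measurableSet_le (hmeas ξ) measurable_const),
        Set.inter_comm, hbisect, Set.inter_comm]) he (ξ - s • e)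
  rw [Measure.restrict_apply' hKm, Measure.restrict_apply' hKm] at hwedge
  rw [hset, Set.inter_comm, hwedge, ← Measure.measure_neg μ]
  congr 1
  ext x
  simp [and_comm]

/-- A convex body with `0` in its interior which is bisected by every central hyperplane is
contained in its reflection. -/
theorem subset_neg_of_bisect [FiniteDimensional ℝ E] (μ : Measure E) [μ.IsAddHaarMeasure]
    {K : Set E} (hK : IsCompact K) (hconv : Convex ℝ K) (h0 : (0 : E) ∈ interior K)
    (hbisect : ∀ ξ : E, μ (K ∩ {x | 0 ≤ ⟪x, ξ⟫}) = μ (K ∩ {x | ⟪x, ξ⟫ ≤ 0})) :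
    K ⊆ -K := by
  intro x hx
  by_contra hx'
  have hcl : IsClosed (-K) := hK.isClosed.neg
  have hxcl : x ∈ closure (interior K) := by
    rw [hconv.closure_interior_eq_closure_of_nonempty_interior ⟨0, h0⟩]
    exact subset_closure hx
  obtain ⟨y, hy', hy⟩ := mem_closure_iff.1 hxcl _ hcl.isOpen_compl hx'
  have hK0 : (0 : E) ∈ K := interior_subset h0
  have hy0 : y ≠ 0 := by
    rintro rfl
    exact hy' (by simpa using hK0)
  set c : ℝ := ⟪y, y⟫
  have hc : 0 < c := real_inner_self_pos.2 hy0
  set S : Set E := (fun u ↦ c • u) ⁻¹' (interior K ∩ (-K)ᶜ)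
  have hSo : IsOpen S := (isOpen_interior.inter hcl.isOpen_compl).preimage (by fun_prop)
  set C : Set E := {z | 0 < ⟪z, y⟫ ∧ ⟪z, y⟫⁻¹ • z ∈ S}
  have heq : μ (K ∩ C) = μ (-K ∩ C) :=
    measure_inter_cone_eq μ hK hbisect hy0 hSo.measurableSet
  have hinner : Continuous fun z : E ↦ ⟪z, y⟫ := by fun_prop
  have hCo : IsOpen C := by
    have hcont : ContinuousOn (fun z : E ↦ ⟪z, y⟫⁻¹ • z) {z | 0 < ⟪z, y⟫} :=
      (hinner.continuousOn.inv₀ fun z hz ↦ ne_of_gt hz).smul continuousOn_id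
    exact hcont.isOpen_inter_preimage (isOpen_lt continuous_const hinner) hSo
  have hsub : -K ∩ C ⊆ (K ∩ C) ∩ {z | ⟪z, y⟫ < c} := by
    rintro z ⟨hzK, hzC⟩
    obtain ⟨ht, hwK, hwK'⟩ := hzC
    have hlt : ⟪z, y⟫ < c := by
      by_contra! hle
      refine hwK' ?_
      beta_reduce
      rw [smul_smul, ← div_eq_mul_inv]
      exact hconv.neg.smul_mem_of_zero_mem (by simpa using hK0) hzK
        ⟨by positivity, (div_le_one ht).2 hle⟩
    refine ⟨⟨?_, ht, hwK, hwK'⟩, hlt⟩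
    have := hconv.smul_mem_of_zero_mem hK0 (interior_subset hwK) (t := ⟪z, y⟫ / c)
      ⟨by positivity, (div_le_one hc).2 hlt.le⟩
    rwa [smul_smul, smul_smul, div_mul_cancel₀ _ hc.ne', mul_inv_cancel₀ ht.ne', one_smul] at this
  set U : Set E := interior K ∩ C ∩ {z | c < ⟪z, y⟫}
  have hUo : IsOpen U := (isOpen_interior.inter hCo).inter (isOpen_lt continuous_const hinner)
  have hUne : U.Nonempty := by
    have htend : Filter.Tendsto (fun t : ℝ ↦ t • y) (nhdsWithin 1 (Set.Ioi 1)) (nhds y) := by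
      have : Continuous fun t : ℝ ↦ t • y := by fun_prop
      simpa using (this.tendsto 1).mono_left nhdsWithin_le_nhds
    obtain ⟨t, htK, ht⟩ := ((htend.eventually (isOpen_interior.mem_nhds hy)).and
      self_mem_nhdsWithin).exists
    have ht1 : 1 < t := ht
    have ht0 : 0 < t := one_pos.trans ht1
    have hty : ⟪t • y, y⟫ = t * c := real_inner_smul_left _ _ _
    refine ⟨t • y, ⟨htK, ?_, ?_⟩, ?_⟩
    · rw [hty]
      positivity
    · have : c • (t * c)⁻¹ • t • y = y := by
        rw [smul_smul, smul_smul]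
        convert one_smul ℝ y using 2
        field_simp
      rw [hty, Set.mem_preimage, this]
      exact ⟨hy, hy'⟩
    · rw [Set.mem_ofPred_eq, hty]
      exact lt_mul_of_one_lt_left hc ht1
  have hdisj : Disjoint (-K ∩ C) U :=
    Set.disjoint_left.2 fun z hz hzU ↦ lt_asymm (show ⟪z, y⟫ < c from (hsub hz).2) hzU.2
  have hle : μ (-K ∩ C) + μ U ≤ μ (-K ∩ C) := by
    rw [← measure_union hdisj hUo.measurableSet, ← heq]
    exact measure_mono (Set.union_subset (fun z hz ↦ (hsub hz).1)
      fun z hz ↦ ⟨interior_subset hz.1.1, hz.1.2⟩)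
  have hfin : μ (-K ∩ C) ≠ ⊤ :=
    ((measure_mono Set.inter_subset_left).trans_lt hK.neg.measure_lt_top).ne
  refine (hUo.measure_pos μ hUne).ne' ?_
  simpa using ENNReal.le_sub_of_add_le_left hfin hle

end

/-- Falconer: a convex body with `0` in its interior, each of whose
central hyperplanes bisects its volume, is origin-symmetric. -/
theorem stmt16 {n : ℕ} (K : Set (EuclideanSpace ℝ (Fin n)))
    (hKcomp : IsCompact K) (hKconv : Convex ℝ K)
    (h0 : (0 : EuclideanSpace ℝ (Fin n)) ∈ interior K)
    (hbisect : ∀ ξ ∈ Metric.sphere (0 : EuclideanSpace ℝ (Fin n)) 1,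
      volume (K ∩ {x | 0 ≤ ⟪x, ξ⟫}) = volume (K ∩ {x | ⟪x, ξ⟫ ≤ 0})) :
    K = -K := by
  have hbisect' (ξ : EuclideanSpace ℝ (Fin n)) :
      volume (K ∩ {x | 0 ≤ ⟪x, ξ⟫}) = volume (K ∩ {x | ⟪x, ξ⟫ ≤ 0}) := by
    rcases eq_or_ne ξ 0 with rfl | hξ
    · simp
    · have hpos : 0 < ‖ξ‖⁻¹ := inv_pos.2 (norm_pos_iff.2 hξ)
      have h := hbisect (‖ξ‖⁻¹ • ξ) (by simp [norm_smul, hξ])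
      have hnonpos (a : ℝ) : ‖ξ‖⁻¹ * a ≤ 0 ↔ a ≤ 0 := by
        rw [← not_lt, mul_pos_iff_of_pos_left hpos, not_lt]
      simpa only [real_inner_smul_right, mul_nonneg_iff_of_pos_left hpos, hnonpos] using h
  have hsub := subset_neg_of_bisect volume hKcomp hKconv h0 hbisect'
  exact hsub.antisymm (by simpa using Set.neg_subset_neg.2 hsub)
end

section
/- Let P ⊂ ℝⁿ (n ≥ 3) be a convex polytope containing the origin in its interior such that for every unit vector ξ ∈ Sⁿ⁻¹, the (n−2)-dimensional volume of the relative boundary of the central section P ∩ ξ⊥ equals the maximum over t ∈ ℝ of the (n−2)-dimensional volume of the relative boundary of P ∩ {tξ + ξ⊥}. Then P is origin-symmetric: P = −P. -/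
open scoped RealInnerProductSpace
open MeasureTheory

/-- Truncated power. -/
noncomputable def truncPow (d : ℕ) (x : ℝ) : ℝ := if 0 < x then x ^ d else 0

lemma truncPow_of_pos {x : ℝ} (d : ℕ) (hx : 0 < x) : truncPow d x = x ^ d := if_pos hx

lemma truncPow_of_nonpos {x : ℝ} (d : ℕ) (hx : x ≤ 0) : truncPow d x = 0 := if_neg hx.not_gt

lemma truncPow_succ (d : ℕ) (x : ℝ) : truncPow (d + 1) x = max x 0 ^ (d + 1) := by
  rcases lt_or_ge 0 x with h | h
  · rw [truncPow_of_pos _ h, max_eq_left h.le]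
  · rw [truncPow_of_nonpos _ h, max_eq_right h, zero_pow (Nat.succ_ne_zero _)]

lemma monotone_truncPow (d : ℕ) : Monotone (truncPow d) := by
  intro x y hxy
  rcases lt_or_ge 0 x with h | h
  · rw [truncPow_of_pos _ h, truncPow_of_pos _ (h.trans_le hxy)]
    gcongr
  · rw [truncPow_of_nonpos _ h]
    unfold truncPow
    split_ifs <;> positivity

lemma continuous_truncPow_succ (d : ℕ) : Continuous (truncPow (d + 1)) := by
  have : truncPow (d + 1) = fun x => max x 0 ^ (d + 1) := funext (truncPow_succ d)
  rw [this]
  fun_prop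

lemma hasDerivAt_truncPow_succ (d : ℕ) {x : ℝ} (hx : x ≠ 0) :
    HasDerivAt (truncPow (d + 1)) ((d + 1) * truncPow d x) x := by
  rcases hx.lt_or_gt with h | h
  · rw [truncPow_of_nonpos _ h.le, mul_zero]
    refine (hasDerivAt_const x (0 : ℝ)).congr_of_eventuallyEq ?_
    filter_upwards [eventually_lt_nhds h] with y hy using truncPow_of_nonpos _ hy.le
  · rw [truncPow_of_pos _ h]
    have := hasDerivAt_pow (d + 1) x
    push_cast at this
    refine this.congr_of_eventuallyEq ?_
    filter_upwards [eventually_gt_nhds h] with y hy using truncPow_of_pos _ hy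

lemma integral_truncPow (d : ℕ) (a b : ℝ) :
    ∫ x in a..b, truncPow d x = (truncPow (d + 1) b - truncPow (d + 1) a) / (d + 1) := by
  have h := MeasureTheory.integral_eq_of_hasDerivAt_off_countable (a := a) (b := b)
    (truncPow (d + 1)) (fun x => (d + 1) * truncPow d x) (s := {0}) (Set.countable_singleton 0)
    (continuous_truncPow_succ d).continuousOn
    (fun x hx => hasDerivAt_truncPow_succ d hx.2)
    ((monotone_truncPow d).intervalIntegrable.const_mul _)
  rw [intervalIntegral.integral_const_mul] at h
  have : (d + 1 : ℝ) ≠ 0 := by positivity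
  rw [← h]; field_simp

lemma intervalIntegrable_truncPow_comp (d : ℕ) (α β a b : ℝ) :
    IntervalIntegrable (fun y => truncPow d (β * y + α)) volume a b := by
  rcases le_total 0 β with h | h
  · exact Monotone.intervalIntegrable fun x y hxy => monotone_truncPow d (by nlinarith)
  · exact Antitone.intervalIntegrable fun x y hxy => monotone_truncPow d (by nlinarith)

lemma integral_truncPow_comp (d : ℕ) (α : ℝ) {β : ℝ} (hβ : β ≠ 0) :
    ∫ y in (0 : ℝ)..1, truncPow d (β * y + α) =
      (truncPow (d + 1) (β + α) - truncPow (d + 1) α) / ((d + 1) * β) := by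
  rw [intervalIntegral.integral_comp_mul_add (truncPow d) hβ, integral_truncPow]
  simp only [smul_eq_mul, mul_zero, zero_add, mul_one]
  have : (d + 1 : ℝ) ≠ 0 := by positivity
  field_simp

lemma sum_inv_prod_sub_eq_zero {d : ℕ} {a : Fin (d + 2) → ℝ} (ha : Function.Injective a) :
    ∑ i, (∏ j ∈ Finset.univ.erase i, (a i - a j))⁻¹ = 0 := by
  have h := Lagrange.coeff_eq_sum (s := Finset.univ) (v := a) ha.injOn (P := 1)
    (by rw [Polynomial.degree_one]; simp; positivity)
  simp only [Finset.card_univ, Fintype.card_fin, Polynomial.eval_one, one_div] at h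
  rw [← h, Polynomial.coeff_one]
  simp

/-- The corner simplex in `ℝᵈ`. -/
def cornerSimplex (d : ℕ) : Set (Fin d → ℝ) := {y | (∀ i, 0 ≤ y i) ∧ ∑ i, y i ≤ 1}

/-- Affine function on the corner simplex with prescribed vertex values; the last value is taken
at the origin. -/
noncomputable def baryVal {d : ℕ} (a : Fin (d + 1) → ℝ) (y : Fin d → ℝ) : ℝ :=
  ∑ i, y i * a i.castSucc + (1 - ∑ i, y i) * a (Fin.last d)

lemma continuous_baryVal {d : ℕ} (a : Fin (d + 1) → ℝ) : Continuous (baryVal a) := by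
  unfold baryVal; fun_prop

lemma isClosed_cornerSimplex (d : ℕ) : IsClosed (cornerSimplex d) := by
  refine IsClosed.inter (s₁ := {y : Fin d → ℝ | ∀ i, 0 ≤ y i})
    (s₂ := {y : Fin d → ℝ | ∑ i, y i ≤ 1}) ?_ ?_
  · simp only [Set.ofPred_forall]
    exact isClosed_iInter fun i => isClosed_le continuous_const (continuous_apply i)
  · exact isClosed_le (by fun_prop) continuous_const

lemma measurableSet_cornerSimplex_slice {d : ℕ} (a : Fin (d + 1) → ℝ) (s : ℝ) :
    MeasurableSet {y ∈ cornerSimplex d | s < baryVal a y} :=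
  (isClosed_cornerSimplex d).measurableSet.inter
    (isOpen_lt continuous_const (continuous_baryVal a)).measurableSet

/-- The volume of the part of a simplex above a level, as a function of vertex heights. -/
noncomputable def simplexVol {d : ℕ} (a : Fin (d + 1) → ℝ) (s : ℝ) : ℝ :=
  (d.factorial : ℝ)⁻¹ * ∑ i, truncPow d (a i - s) / ∏ j ∈ Finset.univ.erase i, (a i - a j)

lemma prod_univ_erase_zero {d : ℕ} (f : Fin (d + 1) → ℝ) :
    ∏ j ∈ Finset.univ.erase (0 : Fin (d + 1)), f j = ∏ j : Fin d, f j.succ := by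
  rw [Fin.univ_succ, Finset.erase_cons, Finset.prod_map]; rfl

lemma prod_univ_erase_succ {d : ℕ} (f : Fin (d + 1) → ℝ) (i : Fin d) :
    ∏ j ∈ Finset.univ.erase i.succ, f j = f 0 * ∏ j ∈ Finset.univ.erase i, f j.succ := by
  have : Finset.univ.erase i.succ =
      Finset.cons 0 ((Finset.univ.erase i).map (Fin.succEmb d)) (by simp) := by
    ext j
    refine Fin.cases ?_ (fun j => ?_) j <;> simp [(Fin.succ_ne_zero _).symm]
  rw [this, Finset.prod_cons, Finset.prod_map]; rfl

lemma simplexVol_succ {d : ℕ} {a : Fin (d + 2) → ℝ} (ha : Function.Injective a) (s : ℝ) :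
    ∫ y in (0 : ℝ)..1, (d.factorial : ℝ)⁻¹ * ∑ i : Fin (d + 1),
      truncPow d ((a 0 - a i.succ) * y + (a i.succ - s)) /
        ∏ j ∈ Finset.univ.erase i, (a i.succ - a j.succ) = simplexVol a s := by
  have h0 : ∀ i : Fin (d + 1), a 0 - a i.succ ≠ 0 := fun i =>
    sub_ne_zero.2 (ha.ne (Fin.succ_ne_zero i).symm)
  rw [intervalIntegral.integral_const_mul, intervalIntegral.integral_finsetSum
    (fun i _ => (intervalIntegrable_truncPow_comp d _ _ _ _).div_const _)]
  simp_rw [intervalIntegral.integral_div, integral_truncPow_comp d _ (h0 _)]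
  have hz := sum_inv_prod_sub_eq_zero ha
  rw [Fin.sum_univ_succ, prod_univ_erase_zero] at hz
  simp_rw [prod_univ_erase_succ (fun j => a (Fin.succ _) - a j)] at hz
  unfold simplexVol
  rw [Fin.sum_univ_succ (n := d + 1), prod_univ_erase_zero]
  simp_rw [prod_univ_erase_succ (fun j => a (Fin.succ _) - a j)]
  rw [div_eq_mul_inv (truncPow _ _) (∏ j : Fin (d + 1), _), eq_neg_of_add_eq_zero_left hz,
    mul_neg, Nat.factorial_succ]
  simp only [Finset.mul_sum, ← Finset.sum_neg_distrib, ← Finset.sum_add_distrib]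
  refine Finset.sum_congr rfl fun i _ => ?_
  have h1 : ∏ j ∈ Finset.univ.erase i, (a i.succ - a j.succ) ≠ 0 :=
    Finset.prod_ne_zero_iff.2 fun j hj => sub_ne_zero.2
      (ha.ne ((Fin.succ_injective _).ne (Finset.ne_of_mem_erase hj).symm))
  have h2 := h0 i
  have h3 : a i.succ - a 0 ≠ 0 := by rw [← neg_sub]; exact neg_ne_zero.2 h2
  have h4 : (d.factorial : ℝ) ≠ 0 := by positivity
  have h5 : (d + 1 : ℝ) ≠ 0 := by positivity
  push_cast
  rw [show a 0 - a i.succ + (a i.succ - s) = a 0 - s by ring, ← neg_sub (a i.succ) (a 0)]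
  field_simp
  ring

lemma cornerSimplex_slice_cons {d : ℕ} (a : Fin (d + 2) → ℝ) (s : ℝ) {t : ℝ} (ht0 : 0 ≤ t)
    (ht1 : t < 1) :
    {y : Fin d → ℝ | (Fin.cons t y : Fin (d + 1) → ℝ) ∈
        {y ∈ cornerSimplex (d + 1) | s < baryVal a y}} =
      (fun y => (1 - t)⁻¹ • y) ⁻¹' {y ∈ cornerSimplex d |
        s < baryVal (fun i => (a 0 - a i.succ) * t + a i.succ) y} := by
  have hp : 0 < 1 - t := by linarith
  ext y
  simp only [Set.mem_ofPred_eq, Set.mem_preimage, cornerSimplex, baryVal, Fin.forall_fin_succ,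
    Fin.sum_univ_succ, Fin.cons_zero, Fin.cons_succ, Pi.smul_apply, smul_eq_mul,
    ← Finset.mul_sum, ht0, true_and, Fin.castSucc_zero, ← Fin.succ_last, ← Fin.succ_castSucc]
  refine and_congr (and_congr (forall_congr' fun i => ?_) ?_) ?_
  · rw [mul_nonneg_iff_of_pos_left (inv_pos.2 hp)]
  · rw [inv_mul_le_iff₀ hp]
    constructor <;> intro h <;> linarith
  · have : ∑ i, (1 - t)⁻¹ * y i * ((a 0 - a i.castSucc.succ) * t + a i.castSucc.succ) =
        (1 - t)⁻¹ * t * a 0 * ∑ i, y i + ∑ i, y i * a i.castSucc.succ := by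
      rw [Finset.mul_sum, ← Finset.sum_add_distrib]
      refine Finset.sum_congr rfl fun i _ => ?_
      field_simp
      ring
    rw [this]
    refine iff_of_eq (congrArg _ ?_)
    field_simp
    ring

theorem volume_cornerSimplex_slice : ∀ {d : ℕ} {a : Fin (d + 1) → ℝ},
    Function.Injective a → ∀ s : ℝ, 0 ≤ simplexVol a s ∧
      volume {y ∈ cornerSimplex d | s < baryVal a y} = ENNReal.ofReal (simplexVol a s) := by
  intro d
  induction d with
  | zero =>
    intro a _ s
    have hv : simplexVol a s = if s < a 0 then 1 else 0 := by
      simp [simplexVol, truncPow]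
    rw [hv]
    have hset : {y ∈ cornerSimplex 0 | s < baryVal a y} = if s < a 0 then Set.univ else ∅ := by
      ext y
      split_ifs with h <;> simp [cornerSimplex, baryVal, h]
    rw [hset]
    split_ifs <;> simp [volume_pi]
  | succ d ih =>
    intro a ha s
    set g : ℝ → ℝ := fun t => (d.factorial : ℝ)⁻¹ * ∑ i : Fin (d + 1),
      truncPow d ((a 0 - a i.succ) * t + (a i.succ - s)) /
        ∏ j ∈ Finset.univ.erase i, (a i.succ - a j.succ) with hg
    have hgint : IntervalIntegrable g volume 0 1 := by
      refine IntervalIntegrable.const_mul ?_ _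
      have := IntervalIntegrable.sum (μ := volume) (a := 0) (b := 1) Finset.univ
        (f := fun (i : Fin (d + 1)) t => truncPow d ((a 0 - a i.succ) * t + (a i.succ - s)) /
        ∏ j ∈ Finset.univ.erase i, (a i.succ - a j.succ))
        (fun i _ => (intervalIntegrable_truncPow_comp d _ _ _ _).div_const _)
      simpa only [Finset.sum_fn] using this
    have key : ∀ t : ℝ, 0 ≤ t → t < 1 → 0 ≤ g t ∧
        volume {y : Fin d → ℝ | (Fin.cons t y : Fin (d + 1) → ℝ) ∈
          {y ∈ cornerSimplex (d + 1) | s < baryVal a y}} = ENNReal.ofReal (g t) := by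
      intro t ht0 ht1
      have hp : 0 < 1 - t := by linarith
      set b : Fin (d + 1) → ℝ := fun i => (a 0 - a i.succ) * t + a i.succ with hb
      have hbsub : ∀ i j, b i - b j = (1 - t) * (a i.succ - a j.succ) := fun i j => by
        simp only [hb]; ring
      have hbinj : Function.Injective b := by
        intro i j hij
        have := hbsub i j
        rw [hij, sub_self, eq_comm, mul_eq_zero, or_iff_right hp.ne', sub_eq_zero] at this
        exact Fin.succ_injective _ (ha this)
      have hgt : g t = (1 - t) ^ d * simplexVol b s := by
        simp only [hg, simplexVol]
        rw [mul_left_comm]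
        congr 1
        rw [Finset.mul_sum]
        refine Finset.sum_congr rfl fun i _ => ?_
        simp_rw [hbsub, Finset.prod_mul_distrib, Finset.prod_const]
        rw [Finset.card_erase_of_mem (Finset.mem_univ _), Finset.card_univ, Fintype.card_fin,
          Nat.add_sub_cancel]
        field_simp
        simp only [hb, add_sub_assoc]
      obtain ⟨h1, h2⟩ := ih hbinj s
      refine ⟨hgt ▸ by positivity, ?_⟩
      rw [cornerSimplex_slice_cons a s ht0 ht1, Measure.addHaar_preimage_smul _
        (inv_ne_zero hp.ne'), h2, hgt, ENNReal.ofReal_mul (by positivity)]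
      congr 2
      simp [abs_of_pos hp]
    have hvol : volume {y ∈ cornerSimplex (d + 1) | s < baryVal a y} =
        ∫⁻ t in Set.Ioc 0 1, ENNReal.ofReal (g t) := by
      have hmp := (volume_preserving_piFinSuccAbove (fun _ : Fin (d + 1) => ℝ) 0).symm
      have hms := measurableSet_cornerSimplex_slice a s
      rw [← hmp.measure_preimage hms.nullMeasurableSet, Measure.volume_eq_prod,
        Measure.prod_apply (hmp.measurable hms), ← lintegral_indicator measurableSet_Ioc]
      refine lintegral_congr_ae ?_
      filter_upwards [compl_mem_ae_iff.2 (measure_singleton (0 : ℝ)),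
        compl_mem_ae_iff.2 (measure_singleton (1 : ℝ))] with t ht0 ht1
      have heq : (Prod.mk t ⁻¹' ((MeasurableEquiv.piFinSuccAbove (fun _ : Fin (d + 1) => ℝ) 0).symm
          ⁻¹' {y ∈ cornerSimplex (d + 1) | s < baryVal a y})) =
          {y : Fin d → ℝ | (Fin.cons t y : Fin (d + 1) → ℝ) ∈
          {y ∈ cornerSimplex (d + 1) | s < baryVal a y}} := by
        ext y
        rw [Set.mem_preimage, Set.mem_preimage,
          show (MeasurableEquiv.piFinSuccAbove (fun _ : Fin (d + 1) => ℝ) 0).symm (t, y) =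
            (Fin.cons t y : Fin (d + 1) → ℝ) from Fin.insertNth_zero' t y]
        rfl
      rw [heq]
      by_cases h : t ∈ Set.Ioc (0 : ℝ) 1
      · rw [Set.indicator_of_mem h]
        exact (key t h.1.le (lt_of_le_of_ne h.2 ht1)).2
      · rw [Set.indicator_of_notMem h]
        convert measure_empty (μ := volume)
        ext y
        simp only [Set.mem_ofPred_eq, Set.mem_empty_iff_false, iff_false]
        rintro ⟨⟨h1, h2⟩, -⟩
        have h3 := h1 0
        rw [Fin.sum_univ_succ] at h2
        have h4 : 0 ≤ ∑ i : Fin d, (Fin.cons t y : Fin (d + 1) → ℝ) i.succ :=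
          Finset.sum_nonneg fun i _ => h1 i.succ
        simp only [Fin.cons_zero] at h3 h2
        exact h ⟨lt_of_le_of_ne h3 (Ne.symm ht0), by linarith⟩
    have hpos : 0 ≤ᵐ[volume.restrict (Set.Ioc 0 1)] g := by
      rw [Filter.EventuallyLE, ae_restrict_iff' measurableSet_Ioc]
      filter_upwards [compl_mem_ae_iff.2 (measure_singleton (1 : ℝ))] with t ht1 ht
      exact (key t ht.1.le (lt_of_le_of_ne ht.2 ht1)).1
    have hI := simplexVol_succ ha s
    rw [intervalIntegral.integral_of_le zero_le_one] at hI
    rw [hvol, ← ofReal_integral_eq_lintegral_ofReal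
      ((intervalIntegrable_iff_integrableOn_Ioc_of_le zero_le_one).1 hgint) hpos, ← hI]
    exact ⟨integral_nonneg_of_ae hpos, rfl⟩

section Triangulation

lemma sum_sub_smul_pivot {ι M : Type*} [DecidableEq ι] [AddCommGroup M] [Module ℝ M] {S : Finset ι}
    {f g : ι → ℝ} {θ : ℝ} {u : ι} (hu : u ∈ S) (hθ : θ * g u = f u) (k : ι → M) :
    ∑ w ∈ S.erase u, (f w - θ * g w) • k w =
      ∑ w ∈ S, f w • k w - θ • ∑ w ∈ S, g w • k w := by
  rw [Finset.smul_sum, ← Finset.sum_sub_distrib, ← Finset.add_sum_erase S _ hu]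
  simp_rw [sub_smul, mul_smul]
  rw [← hθ, mul_smul, sub_self, zero_add]

variable {E : Type*} [AddCommGroup E] [Module ℝ E]

lemma exists_min_ratio {ι : Type*} {s : Finset ι} {a b : ι → ℝ} (ha : ∀ i ∈ s, 0 ≤ a i)
    (hb : ∃ i ∈ s, 0 < b i) :
    ∃ i ∈ s, 0 < b i ∧ ∀ j ∈ s, a i / b i * b j ≤ a j := by
  classical
  obtain ⟨i, hi, hmin⟩ := Finset.exists_min_image (s.filter fun i => 0 < b i)
    (fun i => a i / b i) (by obtain ⟨i, hi, h⟩ := hb; exact ⟨i, by simp [hi, h]⟩)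
  rw [Finset.mem_filter] at hi
  refine ⟨i, hi.1, hi.2, fun j hj => ?_⟩
  rcases lt_or_ge 0 (b j) with h | h
  · have := hmin j (by simp [hj, h])
    rwa [le_div_iff₀ h] at this
  · exact (mul_nonpos_of_nonneg_of_nonpos (div_nonneg (ha i hi.1) hi.2.le) h).trans (ha j hj)

lemma exists_linearIndepOn_conic [DecidableEq E] {V : Finset E} {x : E}
    (hx : ∃ w : E → ℝ, (∀ v ∈ V, 0 ≤ w v) ∧ ∑ v ∈ V, w v • v = x) :
    ∃ t ⊆ V, LinearIndepOn ℝ id (t : Set E) ∧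
      ∃ w : E → ℝ, (∀ v ∈ t, 0 ≤ w v) ∧ ∑ v ∈ t, w v • v = x := by
  classical
  obtain ⟨t, ht, hmin⟩ := Finset.exists_min_image
    (V.powerset.filter fun t => ∃ w : E → ℝ, (∀ v ∈ t, 0 ≤ w v) ∧ ∑ v ∈ t, w v • v = x)
    Finset.card ⟨V, by simpa using hx⟩
  rw [Finset.mem_filter, Finset.mem_powerset] at ht
  obtain ⟨htV, w, hw, hwx⟩ := ht
  refine ⟨t, htV, ?_, w, hw, hwx⟩
  by_contra hdep
  rw [linearIndepOn_finset_iff] at hdep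
  push Not at hdep
  obtain ⟨g, hg, hne⟩ := hdep
  simp only [id] at hg
  obtain ⟨b, hb, hpos⟩ : ∃ b : E → ℝ, ∑ v ∈ t, b v • v = 0 ∧ ∃ v ∈ t, 0 < b v := by
    obtain ⟨v, hv, hgv⟩ := hne
    rcases hgv.lt_or_gt with h | h
    · exact ⟨-g, by simp [hg], v, hv, by simpa using h⟩
    · exact ⟨g, hg, v, hv, h⟩
  obtain ⟨u, hu, hbu, hr⟩ := exists_min_ratio hw hpos
  set θ := w u / b u
  have hcard := hmin (t.erase u) (by
    rw [Finset.mem_filter, Finset.mem_powerset]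
    refine ⟨(Finset.erase_subset _ _).trans htV, fun v => w v - θ * b v,
      fun v hv => sub_nonneg.2 (hr v (Finset.mem_of_mem_erase hv)), ?_⟩
    have h1 : ∑ v ∈ t, (w v - θ * b v) • v = x := by
      simp_rw [sub_smul, Finset.sum_sub_distrib, mul_smul, ← Finset.smul_sum, hb, hwx]
      simp
    rw [← Finset.add_sum_erase _ _ hu] at h1
    have h2 : w u - θ * b u = 0 := by
      simp only [θ]; field_simp; ring
    rw [h2, zero_smul, zero_add] at h1
    exact h1)
  exact absurd (Finset.card_lt_card (Finset.erase_ssubset hu)) hcard.not_gt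

/-- A finite set of vectors forming a basis. -/
def IsBasisSet (S : Finset E) : Prop :=
  LinearIndepOn ℝ id (S : Set E) ∧ Submodule.span ℝ (S : Set E) = ⊤

lemma IsBasisSet.card_eq {S : Finset E} (hS : IsBasisSet S) : S.card = Module.finrank ℝ E := by
  have b : Module.Basis S ℝ E := Module.Basis.mk (v := fun u : S => (u : E)) hS.1 (by
    rw [← hS.2]; simp)
  rw [Module.finrank_eq_card_basis b, Fintype.card_coe]

lemma IsBasisSet.exists_coord {S : Finset E} (hS : IsBasisSet S) :
    ∃ κ : E → (E →ₗ[ℝ] ℝ), (∀ x, ∑ u ∈ S, κ u x • u = x) ∧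
      ∀ a : E → ℝ, ∀ w ∈ S, κ w (∑ u ∈ S, a u • u) = a w := by
  classical
  let b : Module.Basis S ℝ E := Module.Basis.mk (v := fun u : S => (u : E)) hS.1 (by
    rw [← hS.2]; simp)
  have hb : ∀ u : S, b u = u := fun u => Module.Basis.mk_apply _ _ u
  refine ⟨fun u => if h : u ∈ S then b.coord ⟨u, h⟩ else 0, fun x => ?_, fun a w hw => ?_⟩
  · rw [← Finset.sum_coe_sort]
    conv_rhs => rw [← b.sum_repr x]
    refine Finset.sum_congr rfl fun u _ => ?_
    simp [hb]
  · have : ∑ u ∈ S, a u • u = ∑ u : S, a u • b u := by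
      simp_rw [hb]; exact (Finset.sum_coe_sort S fun u => a u • u).symm
    rw [this]
    simp only [dif_pos hw]
    simp [Finsupp.single_apply]

/-- Coordinate functionals of a basis set. -/
noncomputable def coordFn (S : Finset E) : E → (E →ₗ[ℝ] ℝ) :=
  open Classical in if h : IsBasisSet S then h.exists_coord.choose else 0

lemma IsBasisSet.sum_coordFn {S : Finset E} (hS : IsBasisSet S) (x : E) :
    ∑ u ∈ S, coordFn S u x • u = x := by
  rw [coordFn, dif_pos hS]
  exact hS.exists_coord.choose_spec.1 x

lemma IsBasisSet.coordFn_sum {S : Finset E} (hS : IsBasisSet S) (a : E → ℝ) {w : E} (hw : w ∈ S) :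
    coordFn S w (∑ u ∈ S, a u • u) = a w := by
  rw [coordFn, dif_pos hS]
  exact hS.exists_coord.choose_spec.2 a w hw

/-- The linear functional with prescribed values `c` on the basis set `S`. -/
noncomputable def extFn (S : Finset E) (c : E → ℝ) : E →ₗ[ℝ] ℝ := ∑ u ∈ S, c u • coordFn S u

lemma extFn_apply (S : Finset E) (c : E → ℝ) (x : E) :
    extFn S c x = ∑ u ∈ S, c u * coordFn S u x := by
  simp [extFn]

lemma IsBasisSet.extFn_of_mem {S : Finset E} (hS : IsBasisSet S) (c : E → ℝ) {w : E}
    (hw : w ∈ S) : extFn S c w = c w := by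
  classical
  have : w = ∑ u ∈ S, (if u = w then (1 : ℝ) else 0) • u := by simp [hw]
  rw [extFn_apply, this]
  rw [Finset.sum_congr rfl fun u hu => by rw [hS.coordFn_sum _ hu]]
  simp [hw]

lemma extFn_add_smul (S : Finset E) (c c' : E → ℝ) (t : ℝ) (x : E) :
    extFn S (c + t • c') x = extFn S c x + t * extFn S c' x := by
  simp only [extFn_apply, Pi.add_apply, Pi.smul_apply, smul_eq_mul, add_mul,
    Finset.sum_add_distrib, Finset.mul_sum, mul_assoc]

open Filter Topology in
lemma exists_generic_weights (V : Finset E) :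
    ∃ c : E → ℝ, (∀ v ∈ V, 0 < c v) ∧ ∀ S ⊆ V, IsBasisSet S → ∀ v ∈ V,
      (v ∉ S → extFn S c v ≠ c v) ∧ (1 < extFn S 1 v → c v < extFn S c v) := by
  classical
  let f : Finset E × E → ((E → ℝ) →ₗ[ℝ] ℝ) := fun q =>
    LinearMap.proj q.2 - ∑ u ∈ q.1, coordFn q.1 u q.2 • LinearMap.proj u
  have hf : ∀ q c, f q c = c q.2 - extFn q.1 c q.2 := fun q c => by
    simp [f, extFn_apply, mul_comm]
  let I : Finset (Finset E × E) :=
    (V.powerset ×ˢ V).filter fun q => q.2 ∉ q.1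
  obtain ⟨ω, hω⟩ := Submodule.exists_forall_notMem_of_forall_ne_top (ι := I)
    (fun q => LinearMap.ker (f q.1)) (fun q h => by
      have h1 : (Pi.single q.1.2 1 : E → ℝ) ∈ LinearMap.ker (f q.1) := h ▸ Submodule.mem_top
      have hq := q.2
      simp only [I, Finset.mem_filter] at hq
      rw [LinearMap.mem_ker, hf, extFn_apply, Finset.sum_eq_zero] at h1
      · simp at h1
      · intro u hu
        rw [Pi.single_eq_of_ne, zero_mul]
        rintro rfl
        exact hq.2 hu)
  have hω' : ∀ S ⊆ V, ∀ v ∈ V, v ∉ S → ω v - extFn S ω v ≠ 0 := fun S hS v hv hvS => by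
    have := hω ⟨(S, v), by simp [I, hS, hv, hvS]⟩
    rwa [LinearMap.mem_ker, hf] at this
  have ev1 : ∀ v ∈ V, ∀ᶠ t : ℝ in 𝓝[>] 0, 0 < (1 + t • ω) v := fun v _ => by
    have : ContinuousAt (fun t : ℝ => (1 + t • ω) v) 0 := by
      simp only [Pi.add_apply, Pi.smul_apply]; fun_prop
    exact (this.eventually (lt_mem_nhds (by simp))).filter_mono nhdsWithin_le_nhds
  have ev2 : ∀ S ∈ V.powerset, ∀ v ∈ V, ∀ᶠ t : ℝ in 𝓝[>] 0,
      (v ∉ S → extFn S (1 + t • ω) v ≠ (1 + t • ω) v) ∧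
        (1 < extFn S 1 v → (1 + t • ω) v < extFn S (1 + t • ω) v) := fun S hS v hv => by
    rw [Finset.mem_powerset] at hS
    have hc : ContinuousAt (fun t : ℝ => extFn S 1 v - 1 + t * (extFn S ω v - ω v)) 0 := by
      fun_prop
    have heq : ∀ t : ℝ, extFn S (1 + t • ω) v - (1 + t • ω) v =
        extFn S 1 v - 1 + t * (extFn S ω v - ω v) := fun t => by
      rw [extFn_add_smul]
      simp only [Pi.add_apply, Pi.smul_apply, smul_eq_mul, Pi.one_apply]; ring
    refine Filter.Eventually.and ?_ ?_
    · by_cases hvS : v ∈ S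
      · simp [hvS]
      by_cases h1 : extFn S 1 v - 1 = 0
      · filter_upwards [self_mem_nhdsWithin] with t ht _
        rw [← sub_ne_zero, heq, h1, zero_add]
        refine mul_ne_zero (ne_of_gt ht) ?_
        rw [← neg_sub]
        exact neg_ne_zero.2 (hω' S hS v hv hvS)
      · have := (hc.eventually (isOpen_ne.mem_nhds (x := _) (by simpa using h1)
          : ∀ᶠ y in 𝓝 _, y ≠ (0 : ℝ))).filter_mono (nhdsWithin_le_nhds (s := Set.Ioi 0))
        filter_upwards [this] with t ht _
        rw [← sub_ne_zero, heq]; exact ht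
    · by_cases h1 : 1 < extFn S 1 v
      · have := (hc.eventually (lt_mem_nhds (a := 0) (by simpa using h1))).filter_mono
          (nhdsWithin_le_nhds (s := Set.Ioi 0))
        filter_upwards [this] with t ht _
        rw [← sub_pos, heq]; exact ht
      · simp [h1]
  have ev1' := (Filter.eventually_all_finset V).2 ev1
  have ev2' := (Filter.eventually_all_finset V.powerset).2 fun S hS =>
    (Filter.eventually_all_finset V).2 (ev2 S hS)
  obtain ⟨t, h1, h2⟩ := (ev1'.and ev2').exists
  exact ⟨1 + t • ω, h1, fun S hS _ v hv => h2 S (Finset.mem_powerset.2 hS) v hv⟩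

/-- Avoiding every proper subspace spanned by points of `V`. -/
def OffSpans (V : Finset E) (x : E) : Prop :=
  ∀ t ⊆ V, Submodule.span ℝ (t : Set E) ≠ ⊤ → x ∉ Submodule.span ℝ (t : Set E)

lemma OffSpans.coordFn_ne_zero {V S : Finset E} {x : E} (hx : OffSpans V x) (hSV : S ⊆ V)
    (hS : IsBasisSet S) {u : E} (hu : u ∈ S) : coordFn S u x ≠ 0 := by
  classical
  intro h0
  refine hx (S.erase u) ((Finset.erase_subset _ _).trans hSV) (fun htop => ?_) ?_
  · have h1 := hS.1.notMem_span hu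
    rw [Set.image_id, ← Finset.coe_erase, htop] at h1
    exact h1 Submodule.mem_top
  · have := hS.sum_coordFn x
    rw [← Finset.add_sum_erase _ _ hu, h0, zero_smul, zero_add] at this
    rw [← this]
    exact Submodule.sum_mem _ fun v hv => Submodule.smul_mem _ _ (Submodule.subset_span hv)


open Classical in
/-- The simplicial cones (over `V`) on the lower hull of the lifted points `(v, c v)`. -/
noncomputable def triang (V : Finset E) (c : E → ℝ) : Finset (Finset E) :=
  V.powerset.filter fun S => IsBasisSet S ∧ ∀ v ∈ V, extFn S c v ≤ c v

lemma mem_triang {V : Finset E} {c : E → ℝ} {S : Finset E} :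
    S ∈ triang V c ↔ S ⊆ V ∧ IsBasisSet S ∧ ∀ v ∈ V, extFn S c v ≤ c v := by
  simp [triang]

lemma isBasisSet_of_span [FiniteDimensional ℝ E] {S : Finset E}
    (hspan : Submodule.span ℝ (S : Set E) = ⊤) (hcard : S.card ≤ Module.finrank ℝ E) :
    IsBasisSet S := by
  refine ⟨?_, hspan⟩
  have h1 : Set.range (fun u : S => (u : E)) = (S : Set E) := by simp
  refine linearIndependent_of_top_le_span_of_card_eq_finrank (b := fun u : S => (u : E))
    (by rw [h1, hspan]) (le_antisymm (by simpa using hcard) ?_)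
  rw [← finrank_top ℝ E, ← hspan, Fintype.card_coe]
  exact finrank_span_finset_le_card S

lemma exists_mem_triang_of_offSpans [FiniteDimensional ℝ E] {V : Finset E} {c : E → ℝ}
    (hc : ∀ v ∈ V, 0 < c v) {x : E} (hx : OffSpans V x)
    (hV : ∃ w : E → ℝ, (∀ v ∈ V, 0 ≤ w v) ∧ ∑ v ∈ V, w v • v = x) :
    ∃ S ∈ triang V c, ∀ u ∈ S, 0 ≤ coordFn S u x := by
  classical
  let F := V.powerset.filter fun S => IsBasisSet S ∧ ∀ u ∈ S, 0 ≤ coordFn S u x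
  have hF : ∀ S, S ∈ F ↔ S ⊆ V ∧ IsBasisSet S ∧ ∀ u ∈ S, 0 ≤ coordFn S u x := by simp [F]
  have hne : F.Nonempty := by
    obtain ⟨t, htV, hli, w, hw, hwx⟩ := exists_linearIndepOn_conic hV
    have hspan : Submodule.span ℝ (t : Set E) = ⊤ := by
      by_contra h
      refine hx t htV h ?_
      rw [← hwx]
      exact Submodule.sum_mem _ fun v hv => Submodule.smul_mem _ _ (Submodule.subset_span hv)
    refine ⟨t, (hF t).2 ⟨htV, ⟨hli, hspan⟩, fun u hu => ?_⟩⟩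
    rw [← hwx, IsBasisSet.coordFn_sum ⟨hli, hspan⟩ _ hu]
    exact hw u hu
  obtain ⟨S, hSF, hmin⟩ := Finset.exists_min_image F (fun S => extFn S c x) hne
  obtain ⟨hSV, hS, hpos⟩ := (hF S).1 hSF
  refine ⟨S, mem_triang.2 ⟨hSV, hS, ?_⟩, hpos⟩
  by_contra! hcon
  obtain ⟨v, hv, hlt⟩ := hcon
  have hvS : v ∉ S := fun h => hlt.ne' (hS.extFn_of_mem c h)
  have hex : ∃ u ∈ S, 0 < coordFn S u v := by
    by_contra! h
    have : extFn S c v ≤ 0 := by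
      rw [extFn_apply]
      exact Finset.sum_nonpos fun u hu => mul_nonpos_of_nonneg_of_nonpos (hc u (hSV hu)).le (h u hu)
    linarith [hc v hv]
  obtain ⟨u, hu, hbu, hr⟩ := exists_min_ratio hpos hex
  set θ := coordFn S u x / coordFn S u v with hθ
  have hθ0 : 0 < θ := div_pos ((hpos u hu).lt_of_ne' (hx.coordFn_ne_zero hSV hS hu)) hbu
  set S' := insert v (S.erase u) with hS'
  have hvn : v ∉ S.erase u := fun h => hvS (Finset.mem_of_mem_erase h)
  have hS'b : IsBasisSet S' := by
    refine isBasisSet_of_span ?_ ?_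
    · rw [eq_top_iff, ← hS.2, Submodule.span_le]
      have hsub : ∀ w ∈ S.erase u, w ∈ Submodule.span ℝ (S' : Set E) := fun w hw =>
        Submodule.subset_span (by simp only [hS', Finset.coe_insert]; exact Or.inr hw)
      intro w hw
      by_cases hwu : w = u
      · subst hwu
        have h1 := hS.sum_coordFn v
        rw [← Finset.add_sum_erase _ _ hu] at h1
        have h2 : coordFn S w v • w ∈ Submodule.span ℝ (S' : Set E) := by
          rw [eq_sub_of_add_eq h1]
          exact Submodule.sub_mem _ (Submodule.subset_span (by simp [hS']))
            (Submodule.sum_mem _ fun z hz => Submodule.smul_mem _ _ (hsub z hz))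
        exact (Submodule.smul_mem_iff _ hbu.ne').1 h2
      · exact hsub w (Finset.mem_erase.2 ⟨hwu, hw⟩)
    · rw [Finset.card_insert_of_notMem hvn, Finset.card_erase_add_one hu, hS.card_eq]
  let a : E → ℝ := fun w => if w = v then θ else coordFn S w x - θ * coordFn S w v
  have hae : ∀ w ∈ S.erase u, a w = coordFn S w x - θ * coordFn S w v := fun w hw =>
    if_neg fun (h : w = v) => hvn (h ▸ hw)
  have hav : a v = θ := if_pos rfl
  have hax : ∑ w ∈ S', a w • w = x := by
    rw [Finset.sum_insert hvn, hav, Finset.sum_congr rfl fun w hw => by rw [hae w hw],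
      sum_sub_smul_pivot (f := fun w => coordFn S w x) (g := fun w => coordFn S w v) hu
        (div_mul_cancel₀ _ hbu.ne') (fun w => w), hS.sum_coordFn,
      hS.sum_coordFn]
    abel
  have hcoord : ∀ w ∈ S', coordFn S' w x = a w := fun w hw => by
    conv_lhs => rw [← hax]
    exact hS'b.coordFn_sum a hw
  have hmem : S' ∈ F := (hF S').2 ⟨Finset.insert_subset hv ((Finset.erase_subset _ _).trans hSV),
    hS'b, fun w hw => by
      rw [hcoord w hw]
      rcases Finset.mem_insert.1 hw with rfl | h
      · exact hav ▸ hθ0.le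
      · rw [hae w h]; exact sub_nonneg.2 (hr w (Finset.mem_of_mem_erase h))⟩
  have hlt2 : extFn S' c x < extFn S c x := by
    have h1 : extFn S' c x = ∑ w ∈ S', a w • c w := by
      rw [extFn_apply]
      exact Finset.sum_congr rfl fun w hw => by rw [hcoord w hw, smul_eq_mul, mul_comm]
    have h2 : ∀ z, ∑ w ∈ S, coordFn S w z • c w = extFn S c z := fun z => by
      rw [extFn_apply]; exact Finset.sum_congr rfl fun w _ => by rw [smul_eq_mul, mul_comm]
    rw [h1, Finset.sum_insert hvn, hav, Finset.sum_congr rfl fun w hw => by rw [hae w hw],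
      sum_sub_smul_pivot (f := fun w => coordFn S w x) (g := fun w => coordFn S w v) hu
        (div_mul_cancel₀ _ hbu.ne') c, h2, h2, smul_eq_mul, smul_eq_mul]
    nlinarith
  exact (hmin S' hmem).not_gt hlt2

lemma eq_of_mem_cone_inter {V : Finset E} {c : E → ℝ}
    (hgen : ∀ S ⊆ V, IsBasisSet S → ∀ v ∈ V, v ∉ S → extFn S c v ≠ c v)
    {S S' : Finset E} (hS : S ∈ triang V c) (hS' : S' ∈ triang V c) {x : E} (hx : OffSpans V x)
    (hxS : ∀ u ∈ S, 0 ≤ coordFn S u x) (hxS' : ∀ u ∈ S', 0 ≤ coordFn S' u x) : S = S' := by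
  obtain ⟨hSV, hSb, hle⟩ := mem_triang.1 hS
  obtain ⟨hSV', hSb', hle'⟩ := mem_triang.1 hS'
  have key : ∀ {A B : Finset E}, A ⊆ V → IsBasisSet A → B ⊆ V → IsBasisSet B →
      (∀ v ∈ V, extFn A c v ≤ c v) → (∀ u ∈ B, 0 ≤ coordFn B u x) →
      extFn A c x = ∑ u ∈ B, coordFn B u x * extFn A c u ∧
      ∀ u ∈ B, coordFn B u x * extFn A c u ≤ coordFn B u x * c u := by
    intro A B hA hAb hB hBb h1 h2
    refine ⟨?_, fun u hu => mul_le_mul_of_nonneg_left (h1 u (hB hu)) (h2 u hu)⟩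
    conv_lhs => rw [← hBb.sum_coordFn x]
    simp
  have hval : ∀ B : Finset E, extFn B c x = ∑ u ∈ B, coordFn B u x * c u := fun B => by
    rw [extFn_apply]; simp_rw [mul_comm]
  obtain ⟨h1, h2⟩ := key hSV hSb hSV' hSb' hle hxS'
  obtain ⟨h3, h4⟩ := key hSV' hSb' hSV hSb hle' hxS
  have h5 : extFn S c x ≤ extFn S' c x := by
    rw [h1, hval S']; exact Finset.sum_le_sum h2
  have h6 : extFn S' c x ≤ extFn S c x := by
    rw [h3, hval S]; exact Finset.sum_le_sum h4
  have h7 := h5.antisymm h6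
  rw [h1, hval S', Finset.sum_eq_sum_iff_of_le h2] at h7
  have hsub : S' ⊆ S := fun v hv => by
    by_contra hvS
    refine hgen S hSV hSb v (hSV' hv) hvS ?_
    exact mul_left_cancel₀ (hx.coordFn_ne_zero hSV' hSb' hv) (h7 v hv)
  exact (Finset.eq_of_subset_of_card_le hsub (by rw [hSb.card_eq, hSb'.card_eq])).symm

end Triangulation

section BoundaryTriangulation

variable {E : Type*} [NormedAddCommGroup E] [InnerProductSpace ℝ E]

lemma Set.Finite.eventually_nhdsGT_notMem {s : Set ℝ} (hs : s.Finite) (a : ℝ) :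
    ∀ᶠ t in nhdsWithin a (Set.Ioi a), t ∉ s := by
  have h1 : IsOpen (s \ {a})ᶜ := (hs.subset Set.sdiff_subset).isClosed.isOpen_compl
  filter_upwards [self_mem_nhdsWithin, nhdsWithin_le_nhds (h1.mem_nhds (by simp : a ∈ (s \ {a})ᶜ))]
    with t ht h2 h3
  exact h2 ⟨h3, ne_of_gt ht⟩

lemma eventually_add_smul_notMem {p : Submodule ℝ E} {y : E} (hy : y ∉ p) (x : E) :
    ∀ᶠ t in nhdsWithin (0 : ℝ) (Set.Ioi 0), x + t • y ∉ p := by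
  refine Set.Finite.eventually_nhdsGT_notMem (s := {t : ℝ | x + t • y ∈ p})
    (Set.Subsingleton.finite fun t ht t' ht' => ?_) 0
  by_contra hne
  have h1 : (t - t') • y ∈ p := by
    have := p.sub_mem ht ht'
    rwa [add_sub_add_left_eq_sub, ← sub_smul] at this
  exact hy ((p.smul_mem_iff (sub_ne_zero.2 hne)).1 h1)

lemma exists_offSpans (V : Finset E) : ∃ y, OffSpans V y := by
  classical
  obtain ⟨y, hy⟩ := Submodule.exists_forall_notMem_of_forall_ne_top
    (ι := ↥(V.powerset.filter fun t : Finset E => Submodule.span ℝ (t : Set E) ≠ ⊤))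
    (fun t => Submodule.span ℝ (t.1 : Set E)) (fun t => (Finset.mem_filter.1 t.2).2)
  exact ⟨y, fun t ht h => hy ⟨t, Finset.mem_filter.2 ⟨Finset.mem_powerset.2 ht, h⟩⟩⟩

lemma eventually_offSpans {V : Finset E} {y : E} (hy : OffSpans V y) (x : E) :
    ∀ᶠ t in nhdsWithin (0 : ℝ) (Set.Ioi 0), OffSpans V (x + t • y) := by
  have := (Filter.eventually_all_finset V.powerset).2 fun t (ht : t ∈ V.powerset) =>
    (show ∀ᶠ s in nhdsWithin (0 : ℝ) (Set.Ioi 0), Submodule.span ℝ (t : Set E) ≠ ⊤ →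
      x + s • y ∉ Submodule.span ℝ (t : Set E) by
      by_cases h : Submodule.span ℝ (t : Set E) = ⊤
      · simp [h]
      · filter_upwards [eventually_add_smul_notMem (hy t (Finset.mem_powerset.1 ht) h) x] with s hs _
        exact hs)
  filter_upwards [this] with s hs t ht
  exact hs t (Finset.mem_powerset.2 ht)

lemma exists_conic_of_mem_interior {V : Finset E}
    (h0 : (0 : E) ∈ interior (convexHull ℝ (V : Set E))) (x : E) :
    ∃ w : E → ℝ, (∀ v ∈ V, 0 ≤ w v) ∧ ∑ v ∈ V, w v • v = x := by
  have hc : ContinuousAt (fun t : ℝ => t • x) 0 := by fun_prop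
  have h1 : ∀ᶠ y in nhds ((0 : ℝ) • x), y ∈ convexHull ℝ (V : Set E) := by
    rw [zero_smul]; exact mem_interior_iff_mem_nhds.1 h0
  have := (hc.eventually h1).filter_mono (nhdsWithin_le_nhds (s := Set.Ioi 0))
  obtain ⟨t, ht, ht0⟩ := (this.and self_mem_nhdsWithin).exists
  obtain ⟨w, hw, -, hwx⟩ := Finset.mem_convexHull'.1 ht
  have ht0' : (0 : ℝ) < t := ht0
  refine ⟨fun v => t⁻¹ * w v, fun v hv => mul_nonneg (inv_pos.2 ht0').le (hw v hv), ?_⟩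
  simp_rw [mul_smul, ← Finset.smul_sum, hwx, smul_smul]
  rw [inv_mul_cancel₀ ht0'.ne', one_smul]

theorem exists_boundary_triangulation [FiniteDimensional ℝ E] {V : Finset E}
    (h0 : (0 : E) ∈ interior (convexHull ℝ (V : Set E))) :
    ∃ (T : Finset (Finset E)) (ν : Finset E → E),
      (∀ S ∈ T, S ⊆ V ∧ IsBasisSet S ∧ (∀ v ∈ S, ⟪v, ν S⟫ = 1) ∧ ∀ v ∈ V, ⟪v, ν S⟫ ≤ 1) ∧
      (∀ x : E, ∃ S ∈ T, ∃ a : E → ℝ, (∀ u ∈ S, 0 ≤ a u) ∧ ∑ u ∈ S, a u • u = x) ∧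
      ∀ S ∈ T, ∀ S' ∈ T, S ≠ S' → ∀ x ∈ convexHull ℝ (S : Set E) ∩ convexHull ℝ (S' : Set E),
        ¬ OffSpans V x := by
  classical
  obtain ⟨c, hc, hgen⟩ := exists_generic_weights V
  let ν : Finset E → E := fun S =>
    (InnerProductSpace.toDual ℝ E).symm (LinearMap.toContinuousLinearMap (extFn S 1))
  have hν : ∀ S v, ⟪v, ν S⟫ = extFn S 1 v := fun S v => by
    rw [real_inner_comm]; simp [ν]
  have hcoord : ∀ S : Finset E, IsBasisSet S → ∀ x ∈ convexHull ℝ (S : Set E),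
      ∀ u ∈ S, 0 ≤ coordFn S u x := fun S hS x hx u hu => by
    obtain ⟨w, hw, -, hwx⟩ := Finset.mem_convexHull'.1 hx
    rw [← hwx, hS.coordFn_sum _ hu]
    exact hw u hu
  refine ⟨triang V c, ν, fun S hS => ?_, fun x => ?_, fun S hS S' hS' hne x hx hoff => ?_⟩
  · obtain ⟨hSV, hSb, hle⟩ := mem_triang.1 hS
    refine ⟨hSV, hSb, fun v hv => by rw [hν, hSb.extFn_of_mem _ hv]; rfl, fun v hv => ?_⟩
    rw [hν]
    by_contra! h
    exact ((hgen S hSV hSb v hv).2 h).not_ge (hle v hv)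
  · obtain ⟨y, hy⟩ := exists_offSpans V
    suffices h : ∃ S ∈ triang V c, ∀ u ∈ S, 0 ≤ coordFn S u x by
      obtain ⟨S, hS, h⟩ := h
      exact ⟨S, hS, fun u => coordFn S u x, h, (mem_triang.1 hS).2.1.sum_coordFn x⟩
    by_contra! hcon
    have h1 := (Filter.eventually_all_finset (triang V c)).2 fun S (hS : S ∈ triang V c) =>
      (show ∀ᶠ t in nhdsWithin (0 : ℝ) (Set.Ioi 0), ∃ u ∈ S, coordFn S u (x + t • y) < 0 by
        obtain ⟨u, hu, hlt⟩ := hcon S hS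
        have hcont : ContinuousAt (fun t : ℝ => coordFn S u x + t * coordFn S u y) 0 := by fun_prop
        have := (hcont.eventually (eventually_lt_nhds (b := 0) (by simpa using hlt))).filter_mono
          (nhdsWithin_le_nhds (s := Set.Ioi 0))
        filter_upwards [this] with t ht
        exact ⟨u, hu, by simpa using ht⟩)
    obtain ⟨t, h2, h3⟩ := (h1.and (eventually_offSpans hy x)).exists
    obtain ⟨S, hS, h4⟩ := exists_mem_triang_of_offSpans hc h3 (exists_conic_of_mem_interior h0 _)
    obtain ⟨u, hu, h5⟩ := h2 S hS
    exact h5.not_ge (h4 u hu)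
  · exact hne (eq_of_mem_cone_inter (fun S hS hSb v hv => (hgen S hS hSb v hv).1) hS hS' hoff
      (hcoord S (mem_triang.1 hS).2.1 x hx.1) (hcoord S' (mem_triang.1 hS').2.1 x hx.2))

lemma smul_mem_interior_of_mem {P : Set E} (hP : Convex ℝ P) (h0 : (0 : E) ∈ interior P) {x : E}
    (hx : x ∈ P) {t : ℝ} (ht0 : 0 ≤ t) (ht1 : t < 1) : t • x ∈ interior P := by
  have := hP.combo_interior_self_mem_interior h0 hx (a := 1 - t) (b := t) (by linarith) ht0 (by ring)
  simpa using this

lemma mem_convexHull_of_mem_frontier {P : Set E} (hP : Convex ℝ P) (h0 : (0 : E) ∈ interior P)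
    {S : Finset E} (hSP : (S : Set E) ⊆ P) {ν : E} (hν : ∀ v ∈ S, ⟪v, ν⟫ = 1)
    (hle : ∀ x ∈ P, ⟪x, ν⟫ ≤ 1) {a : E → ℝ} (ha : ∀ u ∈ S, 0 ≤ a u)
    (hx : ∑ u ∈ S, a u • u ∈ P) (hx' : ∑ u ∈ S, a u • u ∉ interior P) :
    ∑ u ∈ S, a u = 1 ∧ ∑ u ∈ S, a u • u ∈ convexHull ℝ (S : Set E) := by
  have h1 : ⟪∑ u ∈ S, a u • u, ν⟫ = ∑ u ∈ S, a u := by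
    rw [sum_inner]
    exact Finset.sum_congr rfl fun u hu => by rw [real_inner_smul_left, hν u hu, mul_one]
  have h2 : ∑ u ∈ S, a u ≤ 1 := h1 ▸ hle _ hx
  have h3 : 0 ≤ ∑ u ∈ S, a u := Finset.sum_nonneg ha
  have h4 : ∑ u ∈ S, a u = 1 := by
    by_contra hne
    have hlt := lt_of_le_of_ne h2 hne
    rcases h3.eq_or_lt with h | h
    · have h5 := (Finset.sum_eq_zero_iff_of_nonneg ha).1 h.symm
      rw [Finset.sum_eq_zero fun u hu => by rw [h5 u hu, zero_smul]] at hx'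
      exact hx' h0
    · have h6 := smul_mem_interior_of_mem hP h0
        (hP.centerMass_mem ha h (fun u hu => hSP hu)) h.le hlt
      rw [Finset.centerMass, smul_smul, mul_inv_cancel₀ h.ne', one_smul] at h6
      exact hx' h6
  exact ⟨h4, Finset.mem_convexHull'.2 ⟨a, ha, h4, rfl⟩⟩

end BoundaryTriangulation

section SqrtIndependence

lemma analyticAt_real_sqrt {x : ℝ} (hx : 0 < x) : AnalyticAt ℝ Real.sqrt x :=
  (Real.contDiffAt_sqrt (n := ⊤) hx.ne').analyticAt

variable {E : Type*} [NormedAddCommGroup E] [InnerProductSpace ℝ E]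

lemma sq_norm_sub_sq_inner_nonneg {ν : E} (hν : ‖ν‖ = 1) (x : E) : 0 ≤ ‖x‖ ^ 2 - ⟪ν, x⟫ ^ 2 := by
  have := abs_real_inner_le_norm ν x
  rw [hν, one_mul, ← abs_norm x] at this
  linarith [sq_le_sq.2 this]

lemma sq_norm_sub_sq_inner_pos {ν : E} (hν : ‖ν‖ = 1) {x : E} (hx : x ∉ Submodule.span ℝ {ν}) :
    0 < ‖x‖ ^ 2 - ⟪ν, x⟫ ^ 2 := by
  refine lt_of_le_of_ne (sq_norm_sub_sq_inner_nonneg hν x) fun h => hx ?_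
  have h1 : ‖x - ⟪ν, x⟫ • ν‖ ^ 2 = 0 := by
    rw [norm_sub_sq_real, norm_smul, hν, real_inner_smul_right, real_inner_comm ν x,
      mul_one, Real.norm_eq_abs, sq_abs]
    linarith
  rw [sq_eq_zero_iff, norm_eq_zero, sub_eq_zero] at h1
  rw [h1]
  exact Submodule.smul_mem _ _ (Submodule.mem_span_singleton_self ν)

lemma analyticAt_sqrt_line {ν : E} (hν : ‖ν‖ = 1) (x y : E) {t : ℝ}
    (ht : x + t • y ∉ Submodule.span ℝ {ν}) :
    AnalyticAt ℝ (fun s : ℝ => √(‖x + s • y‖ ^ 2 - ⟪ν, x + s • y⟫ ^ 2)) t := by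
  have h1 : (fun s : ℝ => ‖x + s • y‖ ^ 2 - ⟪ν, x + s • y⟫ ^ 2) = fun s : ℝ =>
      ‖x‖ ^ 2 + 2 * (s * ⟪x, y⟫) + s ^ 2 * ‖y‖ ^ 2 - (⟪ν, x⟫ + s * ⟪ν, y⟫) ^ 2 := by
    funext s
    rw [norm_add_sq_real, inner_add_right, real_inner_smul_right, real_inner_smul_right, norm_smul,
      mul_pow, Real.norm_eq_abs, sq_abs]
  have h2 : AnalyticAt ℝ (fun s : ℝ => ‖x + s • y‖ ^ 2 - ⟪ν, x + s • y⟫ ^ 2) t := by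
    rw [h1]; fun_prop
  exact AnalyticAt.fun_comp (g := Real.sqrt)
    (f := fun s : ℝ => ‖x + s • y‖ ^ 2 - ⟪ν, x + s • y⟫ ^ 2)
    (analyticAt_real_sqrt (sq_norm_sub_sq_inner_pos hν ht)) h2

lemma sum_mul_sqrt_eq_zero_of_isOpen [FiniteDimensional ℝ E] (hE : 3 ≤ Module.finrank ℝ E)
    {ι : Type*} {s : Finset ι} {ν : ι → E} (hν : ∀ i ∈ s, ‖ν i‖ = 1) {p : ι → E → ℝ}
    (hp : ∀ i ∈ s, AnalyticOnNhd ℝ (p i) Set.univ) {U : Set E} (hU : IsOpen U) (hne : U.Nonempty)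
    (hF : ∀ ξ ∈ U, ∑ i ∈ s, p i ξ * √(‖ξ‖ ^ 2 - ⟪ν i, ξ⟫ ^ 2) = 0) {ξ : E}
    (hξ : ∀ i ∈ s, ξ ∉ Submodule.span ℝ {ν i}) :
    ∑ i ∈ s, p i ξ * √(‖ξ‖ ^ 2 - ⟪ν i, ξ⟫ ^ 2) = 0 := by
  classical
  obtain ⟨y, hy⟩ := Submodule.exists_forall_notMem_of_forall_ne_top (ι := s)
    (fun i => Submodule.span ℝ {ξ, ν i}) (fun i h => by
      have h1 := finrank_span_finset_le_card (R := ℝ) ({ξ, ν i} : Finset E)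
      rw [Finset.coe_pair, Set.finrank, h, finrank_top] at h1
      have := h1.trans Finset.card_le_two
      omega)
  obtain ⟨u, hu⟩ := hne
  have hev : ∀ᶠ t in nhdsWithin (0 : ℝ) (Set.Ioi 0), u + t • y ∈ U := by
    have hc : ContinuousAt (fun t : ℝ => u + t • y) 0 := by fun_prop
    exact (hc.eventually (hU.mem_nhds (by simpa using hu))).filter_mono nhdsWithin_le_nhds
  have hev2 : ∀ᶠ t in nhdsWithin (0 : ℝ) (Set.Ioi 0), ∀ i ∈ s,
      u + t • y ∉ Submodule.span ℝ {ξ, ν i} :=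
    (Filter.eventually_all_finset s).2 fun i hi => eventually_add_smul_notMem (hy ⟨i, hi⟩) u
  obtain ⟨t, ht, ht2⟩ := (hev.and hev2).exists
  set o := u + t • y
  let f : ℝ → ℝ := fun t => ∑ i ∈ s, p i (o + t • (ξ - o)) *
    √(‖o + t • (ξ - o)‖ ^ 2 - ⟪ν i, o + t • (ξ - o)⟫ ^ 2)
  have hf : AnalyticOnNhd ℝ f Set.univ := fun t _ => by
    refine Finset.analyticAt_fun_sum _ fun i hi => AnalyticAt.mul ?_ ?_
    · exact (hp i hi _ trivial).fun_comp (by fun_prop)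
    · refine analyticAt_sqrt_line (hν i hi) _ _ fun hmem => ?_
      by_cases h1 : t = 1
      · subst h1; simp at hmem; exact hξ i hi hmem
      · refine ht2 i hi ?_
        have h2 : (1 - t) • o ∈ Submodule.span ℝ {ξ, ν i} := by
          have : (1 - t) • o = (o + t • (ξ - o)) - t • ξ := by module
          rw [this]
          exact Submodule.sub_mem _ (Submodule.span_mono (by simp) hmem)
            (Submodule.smul_mem _ _ (Submodule.subset_span (by simp)))
        exact (Submodule.smul_mem_iff _ (sub_ne_zero.2 (Ne.symm h1))).1 h2
  have hz : f =ᶠ[nhds 0] fun _ => 0 := by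
    have hc : ContinuousAt (fun t : ℝ => o + t • (ξ - o)) 0 := by fun_prop
    filter_upwards [hc.eventually (hU.mem_nhds (by simpa using ht))] with t ht using hF _ ht
  have := congrFun (hf.eq_of_eventuallyEq analyticOnNhd_const hz) 1
  simpa [f] using this

/-- Coefficients of square roots `√(‖ξ‖² - ⟪ν, ξ⟫²)` for pairwise non-parallel `ν` are linearly
independent over analytic functions. -/
theorem sum_coeff_parallel_eq_zero [FiniteDimensional ℝ E] (hE : 3 ≤ Module.finrank ℝ E)
    {ι : Type*} {s : Finset ι} {ν : ι → E} (hν : ∀ i ∈ s, ‖ν i‖ = 1) {p : ι → E → ℝ}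
    (hp : ∀ i ∈ s, AnalyticOnNhd ℝ (p i) Set.univ) {U : Set E} (hU : IsOpen U) (hne : U.Nonempty)
    (hF : ∀ ξ ∈ U, ∑ i ∈ s, p i ξ * √(‖ξ‖ ^ 2 - ⟪ν i, ξ⟫ ^ 2) = 0) {ν₀ : E} (hν₀ : ‖ν₀‖ = 1)
    {t : Finset ι} (ht : ∀ i, i ∈ t ↔ i ∈ s ∧ ν i ∈ Submodule.span ℝ {ν₀})
    {k : ℝ} (hk : k ≠ 0) {b : E} (hb : b ≠ 0) (hνb : ⟪ν₀, b⟫ = 0) :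
    ∑ i ∈ t, p i (k • ν₀ + b) = 0 := by
  classical
  have hts : t ⊆ s := fun i hi => ((ht i).1 hi).1
  let P : ℝ → ℝ := fun r => ∑ i ∈ t, p i (k • ν₀ + r • b)
  let G : ℝ → ℝ := fun r => ∑ i ∈ s \ t, p i (k • ν₀ + r • b) *
    √(‖k • ν₀ + r • b‖ ^ 2 - ⟪ν i, k • ν₀ + r • b⟫ ^ 2)
  have hpa : ∀ i ∈ s, ∀ r : ℝ, AnalyticAt ℝ (fun r : ℝ => p i (k • ν₀ + r • b)) r :=
    fun i hi r => (hp i hi _ trivial).fun_comp (by fun_prop)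
  have hPa : AnalyticOnNhd ℝ P Set.univ := fun r _ =>
    Finset.analyticAt_fun_sum _ fun i hi => hpa i (hts hi) r
  have hnpar : ∀ i ∈ s \ t, k • ν₀ ∉ Submodule.span ℝ {ν i} := fun i hi hmem => by
    rw [Finset.mem_sdiff, ht] at hi
    obtain ⟨c, hc⟩ := Submodule.mem_span_singleton.1 hmem
    have hc0 : c ≠ 0 := by
      rintro rfl
      rw [zero_smul, eq_comm, smul_eq_zero] at hc
      rcases hc with h | h
      · exact hk h
      · simp [h] at hν₀
    refine hi.2 ⟨hi.1, Submodule.mem_span_singleton.2 ⟨c⁻¹ * k, ?_⟩⟩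
    rw [mul_smul, ← hc, smul_smul, inv_mul_cancel₀ hc0, one_smul]
  have hGa : AnalyticAt ℝ G 0 := by
    refine Finset.analyticAt_fun_sum _ fun i hi => AnalyticAt.mul ?_ ?_
    · exact hpa i (Finset.sdiff_subset hi) 0
    · refine analyticAt_sqrt_line (hν i (Finset.sdiff_subset hi)) _ _ ?_
      simpa using hnpar i hi
  have hq : ∀ i ∈ t, ∀ r : ℝ,
      ‖k • ν₀ + r • b‖ ^ 2 - ⟪ν i, k • ν₀ + r • b⟫ ^ 2 = r ^ 2 * ‖b‖ ^ 2 := fun i hi r => by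
    obtain ⟨c, hc⟩ := Submodule.mem_span_singleton.1 ((ht i).1 hi).2
    have hc1 : c ^ 2 = 1 := by
      have := hν i (hts hi)
      rw [← hc, norm_smul, hν₀, mul_one, Real.norm_eq_abs] at this
      rw [← sq_abs, this, one_pow]
    rw [← hc, norm_add_sq_real, inner_add_right, real_inner_smul_left, real_inner_smul_left,
      real_inner_smul_right, real_inner_smul_left, real_inner_smul_right, real_inner_smul_right,
      hνb, norm_smul, norm_smul, real_inner_self_eq_norm_sq, hν₀, Real.norm_eq_abs,
      Real.norm_eq_abs, mul_pow, mul_pow, sq_abs, sq_abs]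
    linear_combination (-k ^ 2) * hc1
  have hoff : ∀ᶠ r : ℝ in nhdsWithin 0 {0}ᶜ, ∀ i ∈ s, k • ν₀ + r • b ∉ Submodule.span ℝ {ν i} := by
    rw [Filter.eventually_all_finset]
    intro i hi
    by_cases hit : i ∈ t
    · filter_upwards [self_mem_nhdsWithin] with r hr hmem
      obtain ⟨c, hc⟩ := Submodule.mem_span_singleton.1 hmem
      have h1 := hq i hit r
      rw [← hc, norm_smul, hν i hi, real_inner_smul_right, real_inner_self_eq_norm_sq, hν i hi,
        Real.norm_eq_abs] at h1
      simp at h1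
      rcases h1 with h | h
      · exact hr h
      · exact hb h
    · have hc : ContinuousAt (fun r : ℝ => k • ν₀ + r • b) 0 := by fun_prop
      have ho : IsOpen ((Submodule.span ℝ {ν i} : Submodule ℝ E) : Set E)ᶜ :=
        (Submodule.closed_of_finiteDimensional _).isOpen_compl
      exact (hc.eventually (ho.mem_nhds (by
        simpa using hnpar i (Finset.mem_sdiff.2 ⟨hi, hit⟩)))).filter_mono nhdsWithin_le_nhds
  have hzero : ∀ᶠ r : ℝ in nhdsWithin 0 {0}ᶜ, G r + |r| * ‖b‖ * P r = 0 := by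
    filter_upwards [hoff] with r hr
    have h1 := sum_mul_sqrt_eq_zero_of_isOpen hE hν hp hU hne hF hr
    rw [← Finset.sum_sdiff hts] at h1
    rw [← h1]
    congr 1
    rw [Finset.mul_sum]
    refine Finset.sum_congr rfl fun i hi => ?_
    rw [hq i hi, ← mul_pow, Real.sqrt_sq_eq_abs, abs_mul, abs_norm]
    ring
  have hsgn : ∀ σ : ℝ, ∀ D : Set ℝ, (nhdsWithin (0 : ℝ) D).NeBot → D ⊆ {0}ᶜ →
      (∀ r ∈ D, |r| = σ * r) → ∀ᶠ r in nhds 0, G r + σ * r * ‖b‖ * P r = 0 := by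
    intro σ D hD hD0 hσ
    have ha : AnalyticAt ℝ (fun r => G r + σ * r * ‖b‖ * P r) 0 :=
      hGa.add ((by fun_prop : AnalyticAt ℝ (fun r : ℝ => σ * r * ‖b‖) 0).mul (hPa 0 trivial))
    refine ha.frequently_zero_iff_eventually_zero.1 ?_
    have h1 : ∀ᶠ r in nhdsWithin (0 : ℝ) D, G r + σ * r * ‖b‖ * P r = 0 := by
      filter_upwards [hzero.filter_mono (nhdsWithin_mono 0 hD0), self_mem_nhdsWithin] with r hr hrD
      rw [← hσ r hrD]; exact hr
    exact (h1.frequently).filter_mono (nhdsWithin_mono 0 hD0)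
  have hp1 := hsgn 1 (Set.Ioi 0) inferInstance (fun r hr => ne_of_gt hr)
    fun r hr => by rw [one_mul, abs_of_pos hr]
  have hm1 := hsgn (-1) (Set.Iio 0) inferInstance (fun r hr => ne_of_lt hr)
    fun r hr => by rw [neg_one_mul, abs_of_neg hr]
  have hPz : ∀ᶠ r in nhds 0, P r = 0 := by
    refine (hPa 0 trivial).frequently_zero_iff_eventually_zero.1 (Filter.Eventually.frequently ?_)
    filter_upwards [hp1.filter_mono nhdsWithin_le_nhds, hm1.filter_mono nhdsWithin_le_nhds,
      self_mem_nhdsWithin] with r h1 h2 hr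
    have h3 : r * ‖b‖ * P r = 0 := by linarith
    exact (mul_eq_zero.1 h3).resolve_left (mul_ne_zero hr (norm_ne_zero_iff.2 hb))
  have := congrFun (hPa.eq_of_eventuallyEq analyticOnNhd_const hPz) 1
  simpa [P] using this

end SqrtIndependence

section ParallelFacets

variable {E : Type*} [NormedAddCommGroup E] [InnerProductSpace ℝ E]

open Classical in
/-- Contribution of the vertex `v` of the simplex `S` to a section function. -/
noncomputable def vertexTerm (k : ℕ) (S : Finset E) (v ξ : E) : ℝ :=
  ⟪v, ξ⟫ ^ k / ∏ u ∈ S.erase v, ⟪v - u, ξ⟫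

/-- The direction `ξ` separates the points of `V`. -/
def Separates (V : Finset E) (ξ : E) : Prop := ∀ v ∈ V, ∀ u ∈ V, v ≠ u → ⟪v - u, ξ⟫ ≠ 0

lemma orthogonal_ne_top {x : E} (hx : x ≠ 0) : (ℝ ∙ x)ᗮ ≠ ⊤ := fun h => by
  have h1 : x ∈ (ℝ ∙ x)ᗮ := h ▸ Submodule.mem_top
  rw [Submodule.mem_orthogonal_singleton_iff_inner_right] at h1
  exact hx (inner_self_eq_zero.1 h1)

/-- A direction in general position with respect to finitely many vectors. -/
lemma exists_forall_inner_ne_zero (F : Finset E) :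
    ∃ y : E, ∀ x ∈ F, x ≠ 0 → ⟪x, y⟫ ≠ 0 := by
  classical
  obtain ⟨y, hy⟩ := Submodule.exists_forall_notMem_of_forall_ne_top
    (ι := ↥(F.filter fun x : E => x ≠ 0))
    (fun x => (ℝ ∙ (x : E))ᗮ) (fun x => orthogonal_ne_top (Finset.mem_filter.1 x.2).2)
  refine ⟨y, fun x hx hx0 => ?_⟩
  have := hy ⟨x, Finset.mem_filter.2 ⟨hx, hx0⟩⟩
  rwa [Submodule.mem_orthogonal_singleton_iff_inner_right] at this

lemma eventually_inner_add_smul_ne_zero {F : Finset E} {y : E}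
    (hy : ∀ x ∈ F, x ≠ 0 → ⟪x, y⟫ ≠ 0) (z : E) :
    ∀ᶠ t in nhdsWithin (0 : ℝ) (Set.Ioi 0), ∀ x ∈ F, x ≠ 0 → ⟪x, z + t • y⟫ ≠ 0 := by
  rw [Filter.eventually_all_finset]
  intro x hx
  by_cases hx0 : x = 0
  · simp [hx0]
  have h1 : y ∉ (ℝ ∙ x)ᗮ := fun h =>
    hy x hx hx0 (Submodule.mem_orthogonal_singleton_iff_inner_right.1 h)
  filter_upwards [eventually_add_smul_notMem h1 z] with t ht _ h
  exact ht (Submodule.mem_orthogonal_singleton_iff_inner_right.2 h)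

open Classical in
/-- An open set contains directions in general position. -/
lemma exists_mem_isOpen_inner_ne_zero (F : Finset E) {U : Set E} (hU : IsOpen U) {z : E}
    (hz : z ∈ U) : ∃ ξ ∈ U, ∀ x ∈ F, x ≠ 0 → ⟪x, ξ⟫ ≠ 0 := by
  obtain ⟨y, hy⟩ := exists_forall_inner_ne_zero F
  have hc : ContinuousAt (fun t : ℝ => z + t • y) 0 := by fun_prop
  have h1 := (hc.eventually (hU.mem_nhds (by simpa using hz))).filter_mono
    (nhdsWithin_le_nhds (s := Set.Ioi 0))
  obtain ⟨t, h2, h3⟩ := (h1.and (eventually_inner_add_smul_ne_zero hy z)).exists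
  exact ⟨_, h2, h3⟩

lemma Separates.prod_ne_zero {V : Finset E} {ξ : E} (h : Separates V ξ) :
    ∏ q ∈ V.offDiag, ⟪q.1 - q.2, ξ⟫ ≠ 0 :=
  Finset.prod_ne_zero_iff.2 fun q hq => by
    rw [Finset.mem_offDiag] at hq
    exact h _ hq.1 _ hq.2.1 hq.2.2

open Classical in
lemma analyticOnNhd_prod_inner (F : Finset (E × E)) :
    AnalyticOnNhd ℝ (fun ξ : E => ∏ q ∈ F, ⟪q.1 - q.2, ξ⟫) Set.univ := fun ξ _ =>
  Finset.analyticAt_fun_prod _ fun q _ => (innerSL ℝ (q.1 - q.2)).analyticAt ξ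

open Classical in
lemma prod_offDiag_mul_vertexTerm {V S : Finset E} (hSV : S ⊆ V) (k : ℕ) {v : E} (hv : v ∈ S)
    {ξ : E} (hξ : Separates V ξ) :
    (∏ q ∈ V.offDiag, ⟪q.1 - q.2, ξ⟫) * vertexTerm k S v ξ =
      ⟪v, ξ⟫ ^ k * ∏ q ∈ V.offDiag \ (S.erase v).image (Prod.mk v), ⟪q.1 - q.2, ξ⟫ := by
  have hsub : (S.erase v).image (Prod.mk v) ⊆ V.offDiag := by
    intro q hq
    obtain ⟨u, hu, rfl⟩ := Finset.mem_image.1 hq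
    rw [Finset.mem_erase] at hu
    exact Finset.mem_offDiag.2 ⟨hSV hv, hSV hu.2, hu.1.symm⟩
  have h1 : ∏ q ∈ (S.erase v).image (Prod.mk v), ⟪q.1 - q.2, ξ⟫ =
      ∏ u ∈ S.erase v, ⟪v - u, ξ⟫ :=
    Finset.prod_image fun a _ b _ h => (Prod.mk.inj h).2
  have h2 : ∏ u ∈ S.erase v, ⟪v - u, ξ⟫ ≠ 0 := Finset.prod_ne_zero_iff.2 fun u hu =>
    hξ v (hSV hv) u (hSV (Finset.mem_of_mem_erase hu)) (Finset.ne_of_mem_erase hu).symm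
  rw [← Finset.prod_sdiff hsub, h1, vertexTerm]
  field_simp

open Classical in
lemma sum_parallel_vertexTerm_eq_zero [FiniteDimensional ℝ E] (hE : 3 ≤ Module.finrank ℝ E)
    {V : Finset E} {T : Finset (Finset E)} {N : Finset E → E} {κ : Finset E → ℝ} {k : ℕ}
    (hTV : ∀ S ∈ T, S ⊆ V) (hN : ∀ S ∈ T, ‖N S‖ = 1)
    (hD : ∀ ξ, Separates V ξ → (∀ v ∈ V, ⟪v, ξ⟫ ≠ 0) →
      ∑ S ∈ T, κ S * √(‖ξ‖ ^ 2 - ⟪N S, ξ⟫ ^ 2) *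
        ∑ v ∈ S with 0 < ⟪v, ξ⟫, vertexTerm k S v ξ = 0)
    {ν₀ : E} (hν₀ : ‖ν₀‖ = 1) {ξ₁ : E} (hξ₁ : ∀ v ∈ V, ⟪v, ξ₁⟫ ≠ 0)
    {ξ : E} (hξ : Separates V ξ) (hξν : ⟪ν₀, ξ⟫ ≠ 0) (hξs : ξ ∉ Submodule.span ℝ {ν₀}) :
    ∑ S ∈ T with N S ∈ Submodule.span ℝ {ν₀},
      κ S * ∑ v ∈ S with 0 < ⟪v, ξ₁⟫, vertexTerm k S v ξ = 0 := by
  set Q : E → ℝ := fun ξ => ∏ q ∈ V.offDiag, ⟪q.1 - q.2, ξ⟫ with hQ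
  let p : Finset E → E → ℝ := fun S ξ => κ S * ∑ v ∈ S with 0 < ⟪v, ξ₁⟫,
    ⟪v, ξ⟫ ^ k * ∏ q ∈ V.offDiag \ (S.erase v).image (Prod.mk v), ⟪q.1 - q.2, ξ⟫
  have hpQ : ∀ S ∈ T, ∀ ξ, Separates V ξ →
      p S ξ = Q ξ * (κ S * ∑ v ∈ S with 0 < ⟪v, ξ₁⟫, vertexTerm k S v ξ) := fun S hS ξ hξ => by
    rw [mul_left_comm, Finset.mul_sum]
    exact congrArg _ (Finset.sum_congr rfl fun v hv =>
      (prod_offDiag_mul_vertexTerm (hTV S hS) k (Finset.mem_filter.1 hv).1 hξ).symm)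
  let U : Set E := (⋂ v ∈ V, {ξ | 0 < ⟪v, ξ₁⟫ * ⟪v, ξ⟫}) ∩ {ξ | Q ξ ≠ 0}
  have hU1 : IsOpen (⋂ v ∈ V, {ξ : E | 0 < ⟪v, ξ₁⟫ * ⟪v, ξ⟫}) :=
    isOpen_biInter_finset fun v _ => isOpen_lt (by fun_prop) (by fun_prop)
  have hU : IsOpen U := hU1.inter (isOpen_ne_fun (by fun_prop) (by fun_prop))
  have hUne : U.Nonempty := by
    obtain ⟨η, hη, h⟩ := exists_mem_isOpen_inner_ne_zero
      (V.offDiag.image fun q => q.1 - q.2) hU1 (z := ξ₁)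
      (Set.mem_iInter₂.2 fun v hv => mul_self_pos.2 (hξ₁ v hv))
    refine ⟨η, hη, Separates.prod_ne_zero fun v hv u hu huv => ?_⟩
    exact h _ (Finset.mem_image.2 ⟨(v, u), Finset.mem_offDiag.2 ⟨hv, hu, huv⟩, rfl⟩)
      (sub_ne_zero.2 huv)
  have hF : ∀ ξ ∈ U, ∑ S ∈ T, p S ξ * √(‖ξ‖ ^ 2 - ⟪N S, ξ⟫ ^ 2) = 0 := by
    intro ξ ⟨h1, h2⟩
    have hsep : Separates V ξ := fun v hv u hu huv => Finset.prod_ne_zero_iff.1 h2 (v, u)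
      (Finset.mem_offDiag.2 ⟨hv, hu, huv⟩)
    have h3 : ∀ v ∈ V, 0 < ⟪v, ξ₁⟫ * ⟪v, ξ⟫ := fun v hv => Set.mem_iInter₂.1 h1 v hv
    have h4 := hD ξ hsep fun v hv => (mul_ne_zero_iff.1 (h3 v hv).ne').2
    rw [← mul_zero (Q ξ), ← h4, Finset.mul_sum]
    refine Finset.sum_congr rfl fun S hS => ?_
    have h5 : S.filter (fun v => 0 < ⟪v, ξ₁⟫) = S.filter (fun v => 0 < ⟪v, ξ⟫) :=
      Finset.filter_congr fun v hv => by
        exact pos_iff_pos_of_mul_pos (h3 v (hTV S hS hv))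
    rw [hpQ S hS ξ hsep, h5]
    ring
  have hpan : ∀ S ∈ T, AnalyticOnNhd ℝ (p S) Set.univ := fun S _ ξ _ =>
    analyticAt_const.mul (Finset.analyticAt_fun_sum _ fun v _ =>
      (((innerSL ℝ v).analyticAt ξ).pow k).mul (analyticOnNhd_prod_inner _ ξ trivial))
  have hb0 : ξ - ⟪ν₀, ξ⟫ • ν₀ ≠ 0 := fun h => hξs (by
    rw [sub_eq_zero.1 h]; exact Submodule.smul_mem _ _ (Submodule.mem_span_singleton_self _))
  have hmain := sum_coeff_parallel_eq_zero hE hN hpan hU hUne hF hν₀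
    (t := T.filter fun S => N S ∈ Submodule.span ℝ {ν₀}) (fun S => Finset.mem_filter) hξν hb0 (by
      rw [inner_sub_right, real_inner_smul_right, real_inner_self_eq_norm_sq, hν₀]; ring)
  rw [add_sub_cancel, Finset.sum_congr rfl fun S hS => hpQ S (Finset.mem_filter.1 hS).1 ξ hξ,
    ← Finset.mul_sum] at hmain
  exact (mul_eq_zero.1 hmain).resolve_left hξ.prod_ne_zero

open Classical in
theorem exists_opposite_vertex [FiniteDimensional ℝ E] (hE : 3 ≤ Module.finrank ℝ E)
    {V : Finset E} {T : Finset (Finset E)} {N : Finset E → E} {κ : Finset E → ℝ} {k : ℕ}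
    (hTV : ∀ S ∈ T, S ⊆ V) (hN : ∀ S ∈ T, ‖N S‖ = 1) (hκ : ∀ S ∈ T, 0 < κ S)
    (hD : ∀ ξ, Separates V ξ → (∀ v ∈ V, ⟪v, ξ⟫ ≠ 0) →
      ∑ S ∈ T, κ S * √(‖ξ‖ ^ 2 - ⟪N S, ξ⟫ ^ 2) *
        ∑ v ∈ S with 0 < ⟪v, ξ⟫, vertexTerm k S v ξ = 0)
    (hV0 : (0 : E) ∉ V) {S₀ : Finset E} (hS₀ : S₀ ∈ T) {v₀ : E} (hv₀ : v₀ ∈ S₀)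
    (hray : ∀ c : ℝ, 0 < c → c • v₀ ∈ V → c = 1)
    (hexp : ∃ η : E, ∀ u ∈ V, u ≠ v₀ → ⟪u, η⟫ < ⟪v₀, η⟫) :
    ∃ c : ℝ, 0 < c ∧ -c • v₀ ∈ V ∧ ∃ S ∈ T, -c • v₀ ∈ S ∧ N S ∈ Submodule.span ℝ {N S₀} := by
  by_contra! hcon
  have hv₀V : v₀ ∈ V := hTV S₀ hS₀ hv₀
  have hv₀0 : v₀ ≠ 0 := fun h => hV0 (h ▸ hv₀V)
  have hne : ∀ v ∈ V, v ≠ 0 := fun v hv h => hV0 (h ▸ hv)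
  have hN₀ := hN S₀ hS₀
  -- a direction orthogonal to `v₀` and to no other line through a vertex
  obtain ⟨ξ₀, hξ₀, hξ₀V⟩ : ∃ ξ₀ : E, ⟪v₀, ξ₀⟫ = 0 ∧
      ∀ v ∈ V, v ∉ Submodule.span ℝ {v₀} → ⟪v, ξ₀⟫ ≠ 0 := by
    obtain ⟨y, hy⟩ := exists_forall_inner_ne_zero
      (V.image fun v => v - (⟪v₀, v⟫ / ⟪v₀, v₀⟫) • v₀)
    have hvv : ⟪v₀, v₀⟫ ≠ 0 := inner_self_eq_zero.not.2 hv₀0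
    refine ⟨y - (⟪v₀, y⟫ / ⟪v₀, v₀⟫) • v₀, ?_, fun v hv hvs => ?_⟩
    · rw [inner_sub_right, real_inner_smul_right]; field_simp; ring
    · have h1 := hy _ (Finset.mem_image_of_mem _ hv) (fun h => hvs (by
        rw [sub_eq_zero.1 h]
        exact Submodule.smul_mem _ _ (Submodule.mem_span_singleton_self _)))
      rw [inner_sub_left, real_inner_smul_left] at h1
      rw [inner_sub_right, real_inner_smul_right, real_inner_comm v₀ v]
      convert h1 using 2
      ring
  -- small perturbations along `± v₀`
  have hpert : ∀ σ : ℝ, ∀ᶠ t in nhdsWithin (0 : ℝ) (Set.Ioi 0),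
      ∀ v ∈ V, v ∉ Submodule.span ℝ {v₀} → 0 < ⟪v, ξ₀⟫ * ⟪v, ξ₀ + (σ * t) • v₀⟫ := fun σ => by
    rw [Filter.eventually_all_finset]
    intro v hv
    by_cases hvs : v ∈ Submodule.span ℝ {v₀}
    · simp [hvs]
    have hc : ContinuousAt (fun t : ℝ => ⟪v, ξ₀⟫ * ⟪v, ξ₀ + (σ * t) • v₀⟫) 0 := by fun_prop
    have := (hc.eventually (lt_mem_nhds (a := 0) (by
      simpa using mul_self_pos.2 (hξ₀V v hv hvs)))).filter_mono (nhdsWithin_le_nhds (s := Set.Ioi 0))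
    filter_upwards [this] with t ht _ using ht
  obtain ⟨ε, ⟨h1, h2⟩, hε⟩ := (((hpert 1).and (hpert (-1))).and self_mem_nhdsWithin).exists
  replace hε : 0 < ε := hε
  have hvv : 0 < ⟪v₀, v₀⟫ := real_inner_self_pos.2 hv₀0
  have hline : ∀ σ c : ℝ, ⟪c • v₀, ξ₀ + (σ * ε) • v₀⟫ = σ * ε * ⟪v₀, v₀⟫ * c := fun σ c => by
    rw [real_inner_smul_left, inner_add_right, real_inner_smul_right, hξ₀]; ring
  have hnz : ∀ σ : ℝ, σ ≠ 0 → (∀ v ∈ V, v ∉ Submodule.span ℝ {v₀} →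
      0 < ⟪v, ξ₀⟫ * ⟪v, ξ₀ + (σ * ε) • v₀⟫) → ∀ v ∈ V, ⟪v, ξ₀ + (σ * ε) • v₀⟫ ≠ 0 := by
    intro σ hσ h v hv
    by_cases hvs : v ∈ Submodule.span ℝ {v₀}
    · obtain ⟨c, rfl⟩ := Submodule.mem_span_singleton.1 hvs
      rw [hline]
      have : c ≠ 0 := fun h => hne _ hv (by rw [h, zero_smul])
      positivity
    · exact (mul_ne_zero_iff.1 (h v hv hvs).ne').2
  -- a direction in general position exposing `v₀`
  obtain ⟨ξ, hξsep, hξv₀, hξν, hξs, hξexp⟩ : ∃ ξ, Separates V ξ ∧ ⟪v₀, ξ⟫ ≠ 0 ∧ ⟪N S₀, ξ⟫ ≠ 0 ∧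
      ξ ∉ Submodule.span ℝ {N S₀} ∧ ∀ u ∈ V, u ≠ v₀ → ⟪u, ξ⟫ < ⟪v₀, ξ⟫ := by
    obtain ⟨η, hη⟩ := hexp
    obtain ⟨z, hz, hz0⟩ : ∃ z ∈ (ℝ ∙ N S₀)ᗮ, z ≠ 0 := by
      refine Submodule.exists_mem_ne_zero_of_ne_bot fun h => ?_
      have h1 := Submodule.finrank_add_finrank_orthogonal (ℝ ∙ N S₀)
      rw [h, finrank_bot, finrank_span_singleton (norm_ne_zero_iff.1 (by rw [hN₀]; simp))] at h1
      omega
    have hopen : IsOpen (⋂ u ∈ V.erase v₀, {ξ : E | ⟪u, ξ⟫ < ⟪v₀, ξ⟫}) :=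
      isOpen_biInter_finset fun v _ => isOpen_lt (by fun_prop) (by fun_prop)
    obtain ⟨ξ, hξ, h⟩ := exists_mem_isOpen_inner_ne_zero
      ((V.offDiag.image fun q => q.1 - q.2) ∪ {v₀, N S₀, z}) hopen (z := η)
      (Set.mem_iInter₂.2 fun u hu => hη u (Finset.mem_of_mem_erase hu) (Finset.ne_of_mem_erase hu))
    refine ⟨ξ, fun v hv u hu huv => ?_, h _ (by simp) hv₀0, h _ (by simp)
      (norm_ne_zero_iff.1 (by rw [hN₀]; simp)), fun hs => ?_, fun u hu huv => ?_⟩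
    · exact h _ (Finset.mem_union_left _ (Finset.mem_image.2
        ⟨(v, u), Finset.mem_offDiag.2 ⟨hv, hu, huv⟩, rfl⟩)) (sub_ne_zero.2 huv)
    · exact h z (by simp) hz0 (by rw [real_inner_comm]; exact hz ξ hs)
    · exact Set.mem_iInter₂.1 hξ u (Finset.mem_erase.2 ⟨huv, hu⟩)
  have e1 := sum_parallel_vertexTerm_eq_zero hE hTV hN hD hN₀ (hnz 1 one_ne_zero h1) hξsep hξν hξs
  have e2 := sum_parallel_vertexTerm_eq_zero hE hTV hN hD hN₀
    (hnz (-1) (by norm_num) h2) hξsep hξν hξs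
  have e3 := congrArg₂ (· - ·) e1 e2
  simp only [← Finset.sum_sub_distrib, ← mul_sub, sub_zero] at e3
  have hdiff : ∀ S ∈ T.filter (fun S => N S ∈ Submodule.span ℝ {N S₀}),
      (∑ v ∈ S with 0 < ⟪v, ξ₀ + (1 * ε) • v₀⟫, vertexTerm k S v ξ) -
        ∑ v ∈ S with 0 < ⟪v, ξ₀ + (-1 * ε) • v₀⟫, vertexTerm k S v ξ =
      if v₀ ∈ S then vertexTerm k S v₀ ξ else 0 := by
    intro S hS
    rw [Finset.mem_filter] at hS
    rw [Finset.sum_filter, Finset.sum_filter, ← Finset.sum_sub_distrib]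
    rw [← Finset.sum_ite_eq' S v₀ fun v => vertexTerm k S v ξ]
    refine Finset.sum_congr rfl fun v hv => ?_
    have hvV := hTV S hS.1 hv
    by_cases hvs : v ∈ Submodule.span ℝ {v₀}
    · obtain ⟨c, rfl⟩ := Submodule.mem_span_singleton.1 hvs
      have hc0 : c ≠ 0 := fun h => hne _ hvV (by rw [h, zero_smul])
      rcases hc0.lt_or_gt with hc | hc
      · exact absurd hS.2 (hcon (-c) (by linarith) (by simpa using hvV) S hS.1 (by simpa using hv))
      · obtain rfl := hray c hc hvV
        have h3 : 0 < ε * ⟪v₀, v₀⟫ := by positivity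
        rw [hline, hline, if_pos (by linarith), if_neg (by linarith), if_pos (one_smul _ _)]
        simp
    · have h3 := h1 v hvV hvs
      have h4 := h2 v hvV hvs
      have h5 : v ≠ v₀ := fun h => hvs (h ▸ Submodule.mem_span_singleton_self _)
      have h6 : 0 < ⟪v, ξ₀ + (1 * ε) • v₀⟫ ↔ 0 < ⟪v, ξ₀ + (-1 * ε) • v₀⟫ := by
        rw [← pos_iff_pos_of_mul_pos h3, ← pos_iff_pos_of_mul_pos h4]
      simp only [h6, sub_self, if_neg h5]
  rw [Finset.sum_congr rfl fun S hS => by rw [hdiff S hS]] at e3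
  have hterm : ∀ S ∈ T, vertexTerm k S v₀ ξ =
      ⟪v₀, ξ⟫ ^ k * (∏ u ∈ S.erase v₀, ⟪v₀ - u, ξ⟫)⁻¹ := fun S _ => div_eq_mul_inv _ _
  have hppos : ∀ S ∈ T, 0 < (∏ u ∈ S.erase v₀, ⟪v₀ - u, ξ⟫)⁻¹ := fun S hS =>
    inv_pos.2 (Finset.prod_pos fun u hu => by
      rw [inner_sub_left, sub_pos]
      exact hξexp u (hTV S hS (Finset.mem_of_mem_erase hu)) (Finset.ne_of_mem_erase hu))
  have e4 : ⟪v₀, ξ⟫ ^ k * ∑ S ∈ T with N S ∈ Submodule.span ℝ {N S₀},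
      (if v₀ ∈ S then κ S * (∏ u ∈ S.erase v₀, ⟪v₀ - u, ξ⟫)⁻¹ else 0) = 0 := by
    refine Eq.trans ?_ e3
    rw [Finset.mul_sum]
    refine Finset.sum_congr rfl fun S hS => ?_
    split_ifs
    · rw [hterm S (Finset.mem_filter.1 hS).1]; ring
    · simp
  have e5 := (mul_eq_zero.1 e4).resolve_left (pow_ne_zero _ hξv₀)
  rw [Finset.sum_eq_zero_iff_of_nonneg] at e5
  · have := e5 S₀ (Finset.mem_filter.2 ⟨hS₀, Submodule.mem_span_singleton_self _⟩)
    rw [if_pos hv₀] at this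
    exact (mul_pos (hκ _ hS₀) (hppos _ hS₀)).ne' this
  · intro S hS
    rw [Finset.mem_filter] at hS
    split_ifs
    · exact (mul_pos (hκ _ hS.1) (hppos _ hS.1)).le
    · exact le_rfl

end ParallelFacets

section Coarea

variable {W : Type*} [NormedAddCommGroup W] [InnerProductSpace ℝ W] [FiniteDimensional ℝ W]
  [MeasurableSpace W] [BorelSpace W]

lemma lintegral_euclideanHausdorffMeasure_slice {m : ℕ} (hW : Module.finrank ℝ W = m + 1)
    {η : W} (hη : η ≠ 0) {A : Set W} (hA : MeasurableSet A) :
    ∫⁻ t : ℝ, μHE[m] (A ∩ {w | ⟪w, η⟫ = t}) = ‖η‖ₑ * μHE[m + 1] A := by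
  have hn : ‖η‖ ≠ 0 := norm_ne_zero_iff.2 hη
  have hv : (‖η‖ ^ 2)⁻¹ • η ≠ 0 := smul_ne_zero (by positivity) hη
  have h := EuclideanGeometry.euclideanHausdorffMeasure_eq_lintegral (0 : W) hv hA
  rw [hW, Nat.add_sub_cancel] at h
  have hs : ∀ x : ℝ, (AffineSubspace.mk' (x • ((‖η‖ ^ 2)⁻¹ • η) +ᵥ (0 : W))
      (ℝ ∙ ((‖η‖ ^ 2)⁻¹ • η))ᗮ : Set W) = {w | ⟪w, η⟫ = x} := by
    intro x
    ext w
    simp only [SetLike.mem_coe, AffineSubspace.mem_mk', Submodule.mem_orthogonal_singleton_iff_inner_right,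
      vadd_eq_add, add_zero, vsub_eq_sub, Set.mem_ofPred_eq, inner_sub_right, inner_smul_left,
      inner_smul_right, real_inner_self_eq_norm_sq, RCLike.conj_to_real, real_inner_comm η w]
    field_simp
    constructor <;> intro h <;> linarith
  simp_rw [hs] at h
  rw [h, ← mul_assoc, ← enorm_norm ((‖η‖ ^ 2)⁻¹ • η), ← enorm_norm η, norm_smul, norm_inv, norm_pow, norm_norm,
    ← enorm_mul, show ‖η‖ * ((‖η‖ ^ 2)⁻¹ * ‖η‖) = 1 by field_simp]
  simp

variable {E : Type*} [NormedAddCommGroup E] [InnerProductSpace ℝ E] [FiniteDimensional ℝ E]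
  [MeasurableSpace E] [BorelSpace E]

lemma lintegral_euclideanHausdorffMeasure_slice_hyperplane {m : ℕ}
    (hE : Module.finrank ℝ E = m + 2) {ν ξ : E} (hν : ‖ν‖ = 1) (hξ : 0 < ‖ξ‖ ^ 2 - ⟪ν, ξ⟫ ^ 2)
    {c : ℝ} {A : Set E} (hA : MeasurableSet A) (hAc : ∀ x ∈ A, ⟪x, ν⟫ = c) :
    ∫⁻ t : ℝ, μHE[m] (A ∩ {x | ⟪x, ξ⟫ = t}) =
      ENNReal.ofReal √(‖ξ‖ ^ 2 - ⟪ν, ξ⟫ ^ 2) * μHE[m + 1] A := by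
  have hν0 : ν ≠ 0 := by rintro rfl; simp at hν
  have hW : Module.finrank ℝ ((ℝ ∙ ν)ᗮ : Submodule ℝ E) = m + 1 := by
    have := Submodule.finrank_add_finrank_orthogonal (ℝ ∙ ν)
    rw [finrank_span_singleton hν0, hE] at this
    omega
  have hηm : ξ - ⟪ν, ξ⟫ • ν ∈ (ℝ ∙ ν)ᗮ := by
    rw [Submodule.mem_orthogonal_singleton_iff_inner_right, inner_sub_right, inner_smul_right,
      real_inner_self_eq_norm_sq, hν]
    ring
  set η : ((ℝ ∙ ν)ᗮ : Submodule ℝ E) := ⟨_, hηm⟩ with hη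
  have hηn : ‖η‖ ^ 2 = ‖ξ‖ ^ 2 - ⟪ν, ξ⟫ ^ 2 := by
    change ‖ξ - ⟪ν, ξ⟫ • ν‖ ^ 2 = _
    rw [norm_sub_sq_real, inner_smul_right, norm_smul, hν, real_inner_comm, Real.norm_eq_abs,
      mul_one, sq_abs]
    ring
  have hη0 : η ≠ 0 := by
    intro h
    rw [h, norm_zero] at hηn
    linarith
  have hf : Isometry fun w : ((ℝ ∙ ν)ᗮ : Submodule ℝ E) => c • ν + (w : E) :=
    (IsometryEquiv.addLeft (c • ν)).isometry.comp isometry_subtype_coe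
  set f : ((ℝ ∙ ν)ᗮ : Submodule ℝ E) → E := fun w => c • ν + (w : E) with hfdef
  have himg : ∀ B : Set E, B ⊆ A → f '' (f ⁻¹' B) = B := by
    intro B hB
    rw [Set.image_preimage_eq_iff]
    intro x hx
    refine ⟨⟨x - c • ν, ?_⟩, by simp [hfdef]⟩
    rw [Submodule.mem_orthogonal_singleton_iff_inner_left, inner_sub_left, inner_smul_left,
      real_inner_self_eq_norm_sq, hν, hAc x (hB hx)]
    simp
  have hμ : ∀ (d : ℕ) (B : Set E), B ⊆ A → μHE[d] B = μHE[d] (f ⁻¹' B) := by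
    intro d B hB
    rw [← hf.euclideanHausdorffMeasure_image, himg B hB]
  rw [hμ _ A subset_rfl, ← hηn, Real.sqrt_sq (norm_nonneg _), ofReal_norm,
    ← lintegral_euclideanHausdorffMeasure_slice hW hη0 (hf.continuous.measurable hA),
    ← lintegral_add_right_eq_self _ (c * ⟪ν, ξ⟫)]
  refine lintegral_congr fun t => ?_
  rw [hμ _ _ Set.inter_subset_left]
  congr 1
  ext w
  have hw : ⟪ν, (w : E)⟫ = 0 := Submodule.mem_orthogonal_singleton_iff_inner_right.1 w.2
  have h1 : ⟪w, η⟫ = ⟪(w : E), ξ⟫ := by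
    change ⟪(w : E), ξ - ⟪ν, ξ⟫ • ν⟫ = _
    rw [inner_sub_right, inner_smul_right, real_inner_comm ν (w : E), hw]
    ring
  simp only [Set.preimage_inter, Set.mem_inter_iff, Set.mem_preimage, Set.mem_ofPred_eq, h1, hfdef,
    inner_add_left, inner_smul_left, RCLike.conj_to_real]
  refine and_congr_right fun _ => ?_
  constructor <;> intro h <;> linarith

end Coarea

section SimplexMeasure

variable {E : Type*} [NormedAddCommGroup E] [InnerProductSpace ℝ E]
  [MeasurableSpace E] [BorelSpace E]

lemma exists_euclideanHausdorffMeasure_simplex_slice {d : ℕ} {v : Fin (d + 1) → E}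
    (hv : LinearIndependent ℝ v) :
    ∃ κ : ℝ, 0 < κ ∧ ∀ ξ : E, (Function.Injective fun i => ⟪v i, ξ⟫) → ∀ s : ℝ,
      μHE[d] {x ∈ convexHull ℝ (Set.range v) | s < ⟪x, ξ⟫} =
        ENNReal.ofReal (κ * simplexVol (fun i => ⟪v i, ξ⟫) s) := by
  set f : EuclideanSpace ℝ (Fin d) →ₗ[ℝ] E :=
    (Fintype.linearCombination ℝ fun i : Fin d => v i.castSucc - v (Fin.last d)) ∘ₗ
      (WithLp.linearEquiv 2 ℝ (Fin d → ℝ)).toLinearMap with hf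
  have hfy : ∀ y : Fin d → ℝ, f (WithLp.toLp 2 y) + v (Fin.last d) =
      ∑ i, y i • v i.castSucc + (1 - ∑ i, y i) • v (Fin.last d) := by
    intro y
    simp only [hf, LinearMap.comp_apply, Fintype.linearCombination_apply, smul_sub,
      Finset.sum_sub_distrib, ← Finset.sum_smul, sub_smul, one_smul]
    simp
    abel
  have hker : f.ker = ⊥ := by
    rw [LinearMap.ker_eq_bot']
    intro y hy
    have h := hfy y.ofLp
    rw [WithLp.toLp_ofLp, hy, zero_add] at h
    have h2 : ∑ i : Fin (d + 1), (Fin.snoc (α := fun _ => ℝ) y.ofLp (-∑ i, y i) i : ℝ) • v i = 0 := by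
      rw [Fin.sum_univ_castSucc]
      simp only [Fin.snoc_castSucc, Fin.snoc_last]
      rw [sub_smul, one_smul] at h
      rw [neg_smul]
      have := sub_eq_zero.2 h.symm
      rw [← this]
      abel
    have h3 := Fintype.linearIndependent_iff.1 hv _ h2
    ext i
    simpa using h3 i.castSucc
  have hdet : 0 < f.normDet := lt_of_le_of_ne f.normDet_nonneg
    fun h => (LinearMap.normDet_eq_zero_iff_ker_ne_bot.1 h.symm) hker
  refine ⟨f.normDet, hdet, fun ξ hξ s => ?_⟩
  have hin : ∀ y : Fin d → ℝ, ⟪f (WithLp.toLp 2 y) + v (Fin.last d), ξ⟫ =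
      baryVal (fun i => ⟪v i, ξ⟫) y := by
    intro y
    rw [hfy, inner_add_left, sum_inner]
    simp only [inner_smul_left, RCLike.conj_to_real, baryVal]
  have hset : {x ∈ convexHull ℝ (Set.range v) | s < ⟪x, ξ⟫} =
      (fun x => x + v (Fin.last d)) '' (f '' ((WithLp.ofLp : EuclideanSpace ℝ (Fin d) → _) ⁻¹'
        {y ∈ cornerSimplex d | s < baryVal (fun i => ⟪v i, ξ⟫) y})) := by
    ext x
    constructor
    · rintro ⟨hx, hs⟩
      rw [convexHull_range_eq_exists_affineCombination] at hx
      obtain ⟨t, w, hw0, hw1, rfl⟩ := hx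
      rw [t.affineCombination_eq_linear_combination _ _ hw1] at hs ⊢
      set w' : Fin (d + 1) → ℝ := fun i => if i ∈ t then w i else 0 with hw'
      have hw'0 : ∀ i, 0 ≤ w' i := fun i => by
        simp only [hw']
        split_ifs with h
        exacts [hw0 i h, le_rfl]
      have hw'1 : ∑ i : Fin d, w' i.castSucc + w' (Fin.last d) = 1 := by
        rw [← Fin.sum_univ_castSucc, ← hw1]
        simp [hw']
      have hx : ∑ i ∈ t, w i • v i =
          f (WithLp.toLp 2 fun i => w' i.castSucc) + v (Fin.last d) := by
        rw [hfy, ← eq_sub_iff_add_eq'.2 hw'1, ← Fin.sum_univ_castSucc (fun i => w' i • v i)]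
        simp [hw', ite_smul]
      rw [hx] at hs ⊢
      refine ⟨_, ⟨WithLp.toLp 2 fun i => w' i.castSucc, ⟨⟨fun i => hw'0 _, ?_⟩, ?_⟩, rfl⟩, rfl⟩
      · linarith [hw'0 (Fin.last d)]
      · rwa [← hin]
    · rintro ⟨_, ⟨y, ⟨hy, hs⟩, rfl⟩, rfl⟩
      have hs' := hs
      rw [← hin, WithLp.toLp_ofLp] at hs'
      refine ⟨?_, hs'⟩
      have := hfy y.ofLp
      rw [WithLp.toLp_ofLp] at this
      dsimp only
      rw [this, ← Fin.snoc_last (α := fun _ => ℝ) (1 - ∑ i, y.ofLp i) y.ofLp]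
      have hsum : ∑ i : Fin (d + 1),
          (Fin.snoc (α := fun _ => ℝ) y.ofLp (1 - ∑ i, y.ofLp i) i : ℝ) = 1 := by
        simp [Fin.sum_univ_castSucc]
      have hmem := (convex_convexHull ℝ (Set.range v)).sum_mem (t := Finset.univ)
        (w := Fin.snoc (α := fun _ => ℝ) y.ofLp (1 - ∑ i, y.ofLp i)) (z := v)
        (fun i _ => ?_) hsum (fun i _ => subset_convexHull ℝ _ ⟨i, rfl⟩)
      · simpa [Fin.sum_univ_castSucc] using hmem
      · induction i using Fin.lastCases with
        | last => simpa using hy.2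
        | cast i => simpa using hy.1 i
  have hiso : Isometry fun x : E => x + v (Fin.last d) :=
    (IsometryEquiv.addRight (v (Fin.last d))).isometry
  rw [hset, hiso.euclideanHausdorffMeasure_image]
  have h := f.euclideanHausdorffMeasure_image_eq_normDet_mul_volume ((WithLp.ofLp : EuclideanSpace ℝ (Fin d) → _) ⁻¹'
        {y ∈ cornerSimplex d | s < baryVal (fun i => ⟪v i, ξ⟫) y})
  rw [finrank_euclideanSpace_fin] at h
  rw [h, (PiLp.volume_preserving_ofLp (Fin d)).measure_preimage
    (measurableSet_cornerSimplex_slice _ _).nullMeasurableSet, (volume_cornerSimplex_slice hξ s).2,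
    ENNReal.ofReal_mul hdet.le]

end SimplexMeasure

section SliceMaximum

open Filter Topology

lemma sum_lintegral_le_lintegral_sum {α ι : Type*} [MeasurableSpace α] (μ : Measure α)
    (T : Finset ι) (g : ι → α → ENNReal) :
    ∑ i ∈ T, ∫⁻ x, g i x ∂μ ≤ ∫⁻ x, ∑ i ∈ T, g i x ∂μ := by
  classical
  induction T using Finset.induction_on with
  | empty => simp
  | insert a s ha ih =>
    simp_rw [Finset.sum_insert ha]
    exact (add_le_add le_rfl ih).trans (le_lintegral_add _ _)

variable {ι : Type*} {T : Finset ι} {g g' : ι → ℝ → ENNReal} {M : ι → ℝ → ℝ}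

lemma sum_setLIntegral_Ioc_eq
    (hM : ∀ i ∈ T, ∀ s, 0 ≤ M i s ∧ ∫⁻ t in Set.Ioi s, g i t = ENNReal.ofReal (M i s))
    {a b : ℝ} (hab : a ≤ b) :
    ∑ i ∈ T, ∫⁻ t in Set.Ioc a b, g i t =
      ENNReal.ofReal (∑ i ∈ T, M i a - ∑ i ∈ T, M i b) ∧ ∑ i ∈ T, M i b ≤ ∑ i ∈ T, M i a := by
  have key : ∀ i ∈ T, ∫⁻ t in Set.Ioc a b, g i t = ENNReal.ofReal (M i a - M i b) ∧
      M i b ≤ M i a := by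
    intro i hi
    have h := lintegral_union (μ := volume) (f := g i) measurableSet_Ioi (Set.Ioc_disjoint_Ioi_same (a := a) (b := b))
    rw [Set.Ioc_union_Ioi_eq_Ioi hab, (hM i hi a).2, (hM i hi b).2] at h
    refine ⟨?_, ?_⟩
    · rw [ENNReal.ofReal_sub _ (hM i hi b).1, h, ENNReal.add_sub_cancel_right ENNReal.ofReal_ne_top]
    · rw [← ENNReal.ofReal_le_ofReal_iff (hM i hi a).1, h]
      exact le_add_self
  refine ⟨?_, Finset.sum_le_sum fun i hi => (key i hi).2⟩
  rw [Finset.sum_congr rfl fun i hi => (key i hi).1, ← Finset.sum_sub_distrib,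
    ENNReal.ofReal_sum_of_nonneg fun i hi => sub_nonneg.2 (key i hi).2]

theorem deriv_sliceDensity_eq_zero {K : ENNReal} {L : ℝ → ℝ} {L' ε : ℝ} (hε : 0 < ε)
    (hM : ∀ i ∈ T, ∀ s, 0 ≤ M i s ∧ ∫⁻ t in Set.Ioi s, g i t = ENNReal.ofReal (M i s))
    (hM' : ∀ i ∈ T, ∀ s, 0 ≤ M i s ∧ ∫⁻ t in Set.Ioi s, g' i t = ENNReal.ofReal (M i s))
    (hK : ∀ t : ℝ, |t| < ε → ∑ i ∈ T, g' i t ≤ K) (hK0 : K ≤ ∑ i ∈ T, g i 0)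
    (hlow : ∀ i ∈ T, ∀ q : NNReal, q < 1 → ∀ᶠ t in 𝓝[>] (0 : ℝ), q * g i 0 ≤ g i t)
    (hML : ∀ t, |t| < ε → HasDerivAt (fun s => ∑ i ∈ T, M i s) (-L t) t)
    (hL : HasDerivAt L L' 0) : L' = 0 := by
  set N : ℝ → ℝ := fun s => ∑ i ∈ T, M i s with hN
  have hlow' : ∀ q : NNReal, q < 1 → ∀ᶠ s in 𝓝[>] (0 : ℝ),
      q * K * ENNReal.ofReal s ≤ ENNReal.ofReal (N 0 - N s) := by
    intro q hq
    have h1 : ∀ᶠ t in 𝓝[>] (0 : ℝ), ∀ i ∈ T, q * g i 0 ≤ g i t :=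
      (Filter.eventually_all_finset T).2 fun i hi => hlow i hi q hq
    obtain ⟨δ, hδ, h2⟩ := mem_nhdsGT_iff_exists_Ioc_subset.1 h1
    filter_upwards [Ioc_mem_nhdsGT hδ] with s hs
    rw [← (sum_setLIntegral_Ioc_eq hM hs.1.le).1]
    calc q * K * ENNReal.ofReal s ≤ q * (∑ i ∈ T, g i 0) * ENNReal.ofReal s := by gcongr
      _ = ∑ i ∈ T, ∫⁻ t in Set.Ioc 0 s, q * g i 0 := by
        simp_rw [setLIntegral_const, Real.volume_Ioc, sub_zero, ← Finset.sum_mul, Finset.mul_sum]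
      _ ≤ _ := by
        refine Finset.sum_le_sum fun i hi => setLIntegral_mono' measurableSet_Ioc fun t ht => ?_
        exact h2 ⟨ht.1, ht.2.trans hs.2⟩ i hi
  have hKtop : K ≠ ⊤ := by
    rintro rfl
    obtain ⟨s, hs, hs0⟩ := ((hlow' (1 / 2) (by norm_num)).and self_mem_nhdsWithin).exists
    rw [ENNReal.mul_top (by norm_num), ENNReal.top_mul (by simpa using hs0)] at hs
    exact ENNReal.ofReal_ne_top (top_le_iff.1 hs)
  have hup : ∀ a b : ℝ, a ≤ b → -ε < a → b < ε → N a - N b ≤ K.toReal * (b - a) := by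
    intro a b hab ha hb
    have h1 : ENNReal.ofReal (N a - N b) ≤ ENNReal.ofReal (K.toReal * (b - a)) := by
      rw [← (sum_setLIntegral_Ioc_eq hM' hab).1, ENNReal.ofReal_mul ENNReal.toReal_nonneg,
        ENNReal.ofReal_toReal hKtop, ← Real.volume_Ioc, ← setLIntegral_const]
      refine (sum_lintegral_le_lintegral_sum _ _ _).trans ?_
      refine setLIntegral_mono' measurableSet_Ioc fun t hab' => ?_
      exact hK t (abs_lt.2 ⟨by linarith [hab'.1], by linarith [hab'.2]⟩)
    exact (ENNReal.ofReal_le_ofReal_iff (mul_nonneg ENNReal.toReal_nonneg (by linarith))).1 h1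
  have hLle : ∀ t, |t| < ε → L t ≤ K.toReal := by
    intro t ht
    have hd := (hML t ht).neg
    rw [neg_neg] at hd
    have ht' := abs_lt.1 ht
    refine le_of_tendsto (hd.tendsto_slope.mono_left (nhdsGT_le_nhdsNE t)) ?_
    filter_upwards [Ioo_mem_nhdsGT ht'.2] with s hs
    have := hup t s hs.1.le ht'.1 hs.2
    rw [slope_def_field, div_le_iff₀ (by linarith [hs.1])]
    simp only [Pi.neg_apply]
    linarith
  have hL0 : K.toReal ≤ L 0 := by
    have hd := (hML 0 (by simpa using hε)).neg
    rw [neg_neg] at hd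
    have hd' := hd.tendsto_slope.mono_left (nhdsGT_le_nhdsNE 0)
    have hq : ∀ q : ℝ, 0 < q → q < 1 → q * K.toReal ≤ L 0 := by
      intro q hq0 hq1
      refine ge_of_tendsto hd' ?_
      filter_upwards [hlow' ⟨q, hq0.le⟩ hq1, Ioo_mem_nhdsGT hε] with s hs hs0
      have h1 : (q * K.toReal) * s ≤ max (N 0 - N s) 0 := by
        have := ENNReal.toReal_mono ENNReal.ofReal_ne_top hs
        rw [ENNReal.toReal_mul, ENNReal.toReal_mul, ENNReal.toReal_ofReal hs0.1.le,
          ENNReal.toReal_ofReal'] at this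
        exact this
      rw [slope_def_field, le_div_iff₀ (by linarith [hs0.1])]
      simp only [Pi.neg_apply]
      have h2 : N s ≤ N 0 := (sum_setLIntegral_Ioc_eq hM hs0.1.le).2
      rw [max_eq_left (by linarith)] at h1
      linarith
    have hc : Tendsto (fun q : ℝ => q * K.toReal) (𝓝[<] 1) (𝓝 (1 * K.toReal)) :=
      ((continuous_id.mul continuous_const).tendsto (1 : ℝ)).mono_left nhdsWithin_le_nhds
    rw [one_mul] at hc
    refine le_of_tendsto hc ?_
    filter_upwards [Ioo_mem_nhdsLT (zero_lt_one (α := ℝ))] with q hq'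
    exact hq q hq'.1 hq'.2
  have hmax : IsLocalMax L 0 := by
    filter_upwards [Metric.ball_mem_nhds (0 : ℝ) hε] with t ht
    exact (hLle t (by simpa using ht)).trans hL0
  exact hmax.hasDerivAt_eq_zero hL

end SliceMaximum

section SimplexSliceVol

variable {E : Type*} [NormedAddCommGroup E] [InnerProductSpace ℝ E]

open Classical in
/-- The Lasserre-type expression for the relative volume of the part of the simplex with vertex
set `S` above level `s` in direction `ξ`. -/
noncomputable def simplexSliceVol (d : ℕ) (S : Finset E) (ξ : E) (s : ℝ) : ℝ :=
  (d.factorial : ℝ)⁻¹ * ∑ v ∈ S, truncPow d (⟪v, ξ⟫ - s) / ∏ u ∈ S.erase v, ⟪v - u, ξ⟫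

lemma simplexSliceVol_zero (k : ℕ) (S : Finset E) (ξ : E) :
    simplexSliceVol k S ξ 0 =
      (k.factorial : ℝ)⁻¹ * ∑ v ∈ S with 0 < ⟪v, ξ⟫, vertexTerm k S v ξ := by
  unfold simplexSliceVol vertexTerm
  congr 1
  rw [Finset.sum_filter]
  refine Finset.sum_congr rfl fun v _ => ?_
  simp only [sub_zero, truncPow]
  split_ifs <;> simp

lemma hasDerivAt_simplexSliceVol {d : ℕ} {S : Finset E} {ξ : E} {t : ℝ}
    (ht : ∀ v ∈ S, ⟪v, ξ⟫ ≠ t) :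
    HasDerivAt (simplexSliceVol (d + 1) S ξ) (-simplexSliceVol d S ξ t) t := by
  classical
  have h : ∀ v ∈ S, HasDerivAt
      (fun s => truncPow (d + 1) (⟪v, ξ⟫ - s) / ∏ u ∈ S.erase v, ⟪v - u, ξ⟫)
      (-((d + 1 : ℝ) * (truncPow d (⟪v, ξ⟫ - t) / ∏ u ∈ S.erase v, ⟪v - u, ξ⟫))) t := by
    intro v hv
    have h1 := (hasDerivAt_truncPow_succ d (sub_ne_zero.2 (ht v hv))).comp t
      ((hasDerivAt_id t).const_sub ⟪v, ξ⟫)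
    refine (h1.div_const (∏ u ∈ S.erase v, ⟪v - u, ξ⟫)).congr_deriv ?_
    ring
  have h2 := (HasDerivAt.fun_sum h).const_mul ((d + 1).factorial : ℝ)⁻¹
  have h3 : simplexSliceVol (d + 1) S ξ = fun s => ((d + 1).factorial : ℝ)⁻¹ *
      ∑ v ∈ S, truncPow (d + 1) (⟪v, ξ⟫ - s) / ∏ u ∈ S.erase v, ⟪v - u, ξ⟫ := by
    funext s
    unfold simplexSliceVol
    congr!
  rw [h3]
  refine h2.congr_deriv ?_
  rw [Finset.sum_neg_distrib, ← Finset.mul_sum, Nat.factorial_succ]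
  unfold simplexSliceVol
  push_cast
  have : (d.factorial : ℝ) ≠ 0 := by positivity
  have : (d + 1 : ℝ) ≠ 0 := by positivity
  field_simp

variable [MeasurableSpace E] [BorelSpace E]

lemma exists_measure_convexHull_slice {d : ℕ} {S : Finset E} (hS : LinearIndepOn ℝ id (S : Set E))
    (hcard : S.card = d + 1) :
    ∃ κ : ℝ, 0 < κ ∧ ∀ ξ : E, (∀ v ∈ S, ∀ u ∈ S, v ≠ u → ⟪v - u, ξ⟫ ≠ 0) → ∀ s : ℝ,
      0 ≤ simplexSliceVol d S ξ s ∧ μHE[d] {x ∈ convexHull ℝ (S : Set E) | s < ⟪x, ξ⟫} =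
        ENNReal.ofReal (κ * simplexSliceVol d S ξ s) := by
  classical
  set e := S.equivFinOfCardEq hcard with he
  set v : Fin (d + 1) → E := fun i => (e.symm i : E) with hv
  have hvli : LinearIndependent ℝ v := hS.linearIndependent.comp e.symm e.symm.injective
  have hrange : Set.range v = S := by
    rw [hv, show (fun i => (e.symm i : E)) = Subtype.val ∘ e.symm from rfl, Set.range_comp,
      e.symm.range_eq_univ, Set.image_univ]
    simp
  obtain ⟨κ, hκ, h⟩ := exists_euclideanHausdorffMeasure_simplex_slice hvli
  refine ⟨κ, hκ, fun ξ hξ s => ?_⟩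
  have hinj : Function.Injective fun i => ⟪v i, ξ⟫ := by
    intro i j hij
    by_contra hne
    refine hξ (v i) (e.symm i).2 (v j) (e.symm j).2 (hvli.injective.ne hne) ?_
    rw [inner_sub_left, sub_eq_zero]
    exact hij
  have hvol : simplexVol (fun i => ⟪v i, ξ⟫) s = simplexSliceVol d S ξ s := by
    unfold simplexVol simplexSliceVol
    congr 1
    refine Finset.sum_bij (fun i _ => v i) (fun i _ => (e.symm i).2)
      (fun i _ j _ hij => hvli.injective hij)
      (fun u hu => ⟨e ⟨u, hu⟩, Finset.mem_univ _, by simp [hv]⟩) fun i _ => ?_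
    congr 1
    refine Finset.prod_bij (fun j _ => v j)
      (fun j hj => Finset.mem_erase.2 ⟨hvli.injective.ne (Finset.ne_of_mem_erase hj), (e.symm j).2⟩)
      (fun i _ j _ hij => hvli.injective hij)
      (fun u hu => ⟨e ⟨u, Finset.mem_of_mem_erase hu⟩, ?_, by simp [hv]⟩) fun j _ => ?_
    · refine Finset.mem_erase.2 ⟨?_, Finset.mem_univ _⟩
      intro hi
      refine Finset.ne_of_mem_erase hu ?_
      simp [hv, ← hi]
    · rw [inner_sub_left]
  rw [← hvol, ← hrange]
  exact ⟨(volume_cornerSimplex_slice hinj s).1, h ξ hinj s⟩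

lemma measurableSet_convexHull_finset (S : Finset E) :
    MeasurableSet (convexHull ℝ (S : Set E)) :=
  (S.finite_toSet.isCompact_convexHull ℝ).isClosed.measurableSet

theorem exists_lintegral_convexHull_slice [FiniteDimensional ℝ E] {m : ℕ}
    (hE : Module.finrank ℝ E = m + 2) {S : Finset E}
    (hS : IsBasisSet S) {ν : E} (hν : ‖ν‖ = 1) {c : ℝ} (hc : ∀ v ∈ S, ⟪v, ν⟫ = c) :
    ∃ κ : ℝ, 0 < κ ∧ ∀ ξ : E, (∀ v ∈ S, ∀ u ∈ S, v ≠ u → ⟪v - u, ξ⟫ ≠ 0) →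
      ∀ s : ℝ, 0 ≤ κ * √(‖ξ‖ ^ 2 - ⟪ν, ξ⟫ ^ 2) * simplexSliceVol (m + 1) S ξ s ∧
      ∀ D : Set E, MeasurableSet D → μHE[m + 1] D = 0 →
      ∫⁻ t in Set.Ioi s, μHE[m] (convexHull ℝ (S : Set E) \ D ∩ {x | ⟪x, ξ⟫ = t}) =
        ENNReal.ofReal (κ * √(‖ξ‖ ^ 2 - ⟪ν, ξ⟫ ^ 2) * simplexSliceVol (m + 1) S ξ s) := by
  obtain ⟨κ, hκ, h⟩ := exists_measure_convexHull_slice hS.1 (hS.card_eq.trans hE)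
  refine ⟨κ, hκ, fun ξ hξ => ?_⟩
  have hpos : 0 < ‖ξ‖ ^ 2 - ⟪ν, ξ⟫ ^ 2 := by
    refine sq_norm_sub_sq_inner_pos hν fun hmem => ?_
    obtain ⟨a, rfl⟩ := Submodule.mem_span_singleton.1 hmem
    obtain ⟨v, hv, u, hu, hne⟩ := Finset.one_lt_card.1 (by rw [hS.card_eq, hE]; omega : 1 < S.card)
    refine hξ v hv u hu hne ?_
    rw [inner_smul_right, inner_sub_left, hc v hv, hc u hu, sub_self, mul_zero]
  refine fun s => ⟨mul_nonneg (by positivity) (h ξ hξ s).1, fun D hD hD0 => ?_⟩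
  have hconv : ∀ x ∈ convexHull ℝ (S : Set E), ⟪x, ν⟫ = c := by
    intro x hx
    have : convexHull ℝ (S : Set E) ⊆ {x | ⟪x, ν⟫ = c} := by
      refine convexHull_min hc ?_
      simp_rw [real_inner_comm ν]
      exact convex_hyperplane (innerₗ E ν).isLinear c
    exact this hx
  have hmeas : MeasurableSet {x ∈ convexHull ℝ (S : Set E) | s < ⟪x, ξ⟫} :=
    (measurableSet_convexHull_finset S).inter
      (measurableSet_lt measurable_const
        (continuous_id.inner (𝕜 := ℝ) (continuous_const (y := ξ))).measurable)
  have h1 := lintegral_euclideanHausdorffMeasure_slice_hyperplane hE hν hpos (hmeas.diff hD)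
    fun x hx => hconv x hx.1.1
  rw [measure_sdiff_null hD0, (h ξ hξ s).2, ← ENNReal.ofReal_mul (Real.sqrt_nonneg _)] at h1
  rw [show κ * √(‖ξ‖ ^ 2 - ⟪ν, ξ⟫ ^ 2) * simplexSliceVol (m + 1) S ξ s =
    √(‖ξ‖ ^ 2 - ⟪ν, ξ⟫ ^ 2) * (κ * simplexSliceVol (m + 1) S ξ s) by ring, ← h1,
    ← lintegral_indicator measurableSet_Ioi]
  refine lintegral_congr fun t => ?_
  by_cases hts : s < t
  · rw [Set.indicator_of_mem (Set.mem_Ioi.2 hts)]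
    congr 1
    ext x
    simp only [Set.mem_inter_iff, Set.mem_ofPred_eq]
    constructor
    · rintro ⟨⟨h1, h2⟩, rfl⟩; exact ⟨⟨⟨h1, hts⟩, h2⟩, rfl⟩
    · rintro ⟨⟨⟨h1, -⟩, h2⟩, h3⟩; exact ⟨⟨h1, h2⟩, h3⟩
  · rw [Set.indicator_of_notMem (by simpa using hts)]
    symm
    convert measure_empty (μ := (μHE[m] : Measure E))
    ext x
    simp only [Set.mem_inter_iff, Set.mem_ofPred_eq, Set.mem_empty_iff_false, iff_false, not_and]
    rintro ⟨⟨-, h2⟩, -⟩ rfl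
    exact hts h2

end SimplexSliceVol

section NullSets

variable {E : Type*} [NormedAddCommGroup E] [InnerProductSpace ℝ E]
  [MeasurableSpace E] [BorelSpace E]

lemma euclideanHausdorffMeasure_of_vsub_mem [FiniteDimensional ℝ E] {d : ℕ} {p : Submodule ℝ E}
    (hp : Module.finrank ℝ p < d) {A : Set E} (hA : ∀ x ∈ A, ∀ y ∈ A, y - x ∈ p) :
    μHE[d] A = 0 := by
  rcases A.eq_empty_or_nonempty with rfl | ⟨x, hx⟩
  · exact measure_empty
  have hf : Isometry fun w : p => x + (w : E) :=
    (IsometryEquiv.addLeft x).isometry.comp isometry_subtype_coe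
  have hsub : A ⊆ (fun w : p => x + (w : E)) '' Set.univ := fun y hy =>
    ⟨⟨y - x, hA x hx y hy⟩, trivial, by simp⟩
  rw [Measure.euclideanHausdorffMeasure_def, Measure.smul_apply]
  have h1 : dimH A < (d : NNReal) := by
    refine (dimH_mono hsub).trans_lt ?_
    rw [hf.dimH_image, Real.dimH_univ_eq_finrank p]
    exact_mod_cast hp
  have h2 := hausdorffMeasure_of_dimH_lt h1
  rw [NNReal.coe_natCast] at h2
  rw [h2, smul_zero]

lemma euclideanHausdorffMeasure_submodule_inter_hyperplane [FiniteDimensional ℝ E] {m : ℕ}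
    (hE : Module.finrank ℝ E = m + 2) {p : Submodule ℝ E} (hp : p ≠ ⊤) (ν : E) {c : ℝ}
    (hc : c ≠ 0) : μHE[m + 1] ((p : Set E) ∩ {x | ⟪x, ν⟫ = c}) = 0 := by
  rcases ((p : Set E) ∩ {x | ⟪x, ν⟫ = c}).eq_empty_or_nonempty with h | ⟨x, hxp, hxc⟩
  · rw [h, measure_empty]
  have h1 : Module.finrank ℝ p < m + 2 := hE ▸ Submodule.finrank_lt hp
  have h2 : Module.finrank ℝ (p ⊓ (ℝ ∙ ν)ᗮ : Submodule ℝ E) < Module.finrank ℝ p := by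
    refine Submodule.finrank_lt_finrank_of_lt (lt_of_le_of_ne inf_le_left fun h => hc ?_)
    have hx : x ∈ p ⊓ (ℝ ∙ ν)ᗮ := h.symm ▸ hxp
    rw [← hxc]
    exact Submodule.mem_orthogonal_singleton_iff_inner_left.1 hx.2
  refine euclideanHausdorffMeasure_of_vsub_mem (p := p ⊓ (ℝ ∙ ν)ᗮ) (by omega) ?_
  rintro y ⟨hyp, hyc⟩ z ⟨hzp, hzc⟩
  refine ⟨p.sub_mem hzp hyp, Submodule.mem_orthogonal_singleton_iff_inner_left.2 ?_⟩
  rw [inner_sub_left, show ⟪z, ν⟫ = c from hzc, show ⟪y, ν⟫ = c from hyc, sub_self]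

open Filter Topology in
lemma eventually_mul_measure_slice_le {m : ℕ} {S : Finset E} {ξ : E} (hξ : ∀ v ∈ S, ⟪v, ξ⟫ ≠ 0)
    {q : NNReal} (hq : q < 1) :
    ∀ᶠ t in 𝓝[>] (0 : ℝ), q * μHE[m] (convexHull ℝ (S : Set E) ∩ {x | ⟪x, ξ⟫ = 0}) ≤
      μHE[m] (convexHull ℝ (S : Set E) ∩ {x | ⟪x, ξ⟫ = t}) := by
  rcases (convexHull ℝ (S : Set E) ∩ {x | ⟪x, ξ⟫ = 0}).eq_empty_or_nonempty with h | ⟨x, hx, hx0⟩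
  · simp [h]
  obtain ⟨p, hpS, hp⟩ : ∃ p ∈ S, 0 < ⟪p, ξ⟫ := by
    by_contra! hcon
    have hsub : convexHull ℝ (S : Set E) ⊆ {x | ⟪x, ξ⟫ < 0} := by
      refine convexHull_min (fun v hv => lt_of_le_of_ne (hcon v hv) (hξ v hv)) ?_
      simp_rw [real_inner_comm ξ]
      exact convex_halfSpace_lt (innerₗ E ξ).isLinear 0
    exact absurd hx0 (hsub hx).ne
  have hc : Tendsto (fun t : ℝ => (1 - t / ⟪p, ξ⟫) ^ m) (𝓝[>] 0) (𝓝 1) := by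
    have : Continuous fun t : ℝ => (1 - t / ⟪p, ξ⟫) ^ m := by fun_prop
    simpa using (this.tendsto 0).mono_left nhdsWithin_le_nhds
  filter_upwards [hc.eventually (lt_mem_nhds (a := (q : ℝ)) (by exact_mod_cast hq)),
    Ioo_mem_nhdsGT hp] with t ht htp
  have hpos : 0 < 1 - t / ⟪p, ξ⟫ := by
    rw [sub_pos, div_lt_one hp]; exact htp.2
  have himg : AffineMap.homothety p (1 - t / ⟪p, ξ⟫) ''
      (convexHull ℝ (S : Set E) ∩ {x | ⟪x, ξ⟫ = 0}) ⊆
      convexHull ℝ (S : Set E) ∩ {x | ⟪x, ξ⟫ = t} := by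
    rintro _ ⟨y, ⟨hy, hy0⟩, rfl⟩
    rw [AffineMap.homothety_apply]
    refine ⟨?_, ?_⟩
    · have := (convex_convexHull ℝ (S : Set E)) hy (subset_convexHull ℝ _ hpS) hpos.le
        (div_pos htp.1 hp).le (by ring)
      convert this using 1
      rw [vsub_eq_sub, vadd_eq_add]
      module
    · have hy0' : ⟪y, ξ⟫ = 0 := hy0
      simp only [Set.mem_ofPred_eq, vsub_eq_sub, vadd_eq_add, inner_add_left, inner_smul_left,
        inner_sub_left, hy0', RCLike.conj_to_real]
      field_simp
      ring
  refine le_trans ?_ (measure_mono himg)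
  rw [euclideanHausdorffMeasure_homothety_image _ _ hpos.ne', ENNReal.smul_def, smul_eq_mul]
  gcongr
  rw [← NNReal.coe_le_coe]
  push_cast
  rw [Real.norm_of_nonneg hpos.le]
  exact ht.le

end NullSets

section FacetRelation

open Filter Topology

variable {E : Type*} [NormedAddCommGroup E] [InnerProductSpace ℝ E]

lemma inner_lt_one_of_mem_interior {P : Set E} {ν : E}
    (hle : ∀ x ∈ P, ⟪x, ν⟫ ≤ 1) {x : E} (hx : x ∈ interior P) : ⟪x, ν⟫ < 1 := by
  by_contra! h
  have hc : Tendsto (fun t : ℝ => t • x) (𝓝[>] 1) (𝓝 x) := by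
    have : Continuous fun t : ℝ => t • x := by fun_prop
    simpa using (this.tendsto 1).mono_left nhdsWithin_le_nhds
  obtain ⟨t, ht, ht1⟩ :=
    ((hc.eventually (isOpen_interior.mem_nhds hx)).and self_mem_nhdsWithin).exists
  have h1 := hle _ (interior_subset ht)
  rw [inner_smul_left, RCLike.conj_to_real] at h1
  have h2 : (1 : ℝ) < t := ht1
  nlinarith

lemma inner_le_of_mem_convexHull {V : Set E} {ν : E} {c : ℝ} (h : ∀ v ∈ V, ⟪v, ν⟫ ≤ c) :
    ∀ x ∈ convexHull ℝ V, ⟪x, ν⟫ ≤ c := by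
  refine convexHull_min (t := {x | ⟪x, ν⟫ ≤ c}) h ?_
  simp_rw [real_inner_comm ν]
  exact convex_halfSpace_le (innerₗ E ν).isLinear c

lemma inner_eq_of_mem_convexHull {V : Set E} {ν : E} {c : ℝ} (h : ∀ v ∈ V, ⟪v, ν⟫ = c) :
    ∀ x ∈ convexHull ℝ V, ⟪x, ν⟫ = c := by
  refine convexHull_min (t := {x | ⟪x, ν⟫ = c}) h ?_
  simp_rw [real_inner_comm ν]
  exact convex_hyperplane (innerₗ E ν).isLinear c

theorem exists_facet_relation [FiniteDimensional ℝ E] [MeasurableSpace E] [BorelSpace E] {k : ℕ}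
    (hE : Module.finrank ℝ E = k + 3) {V : Finset E}
    (h0 : (0 : E) ∈ interior (convexHull ℝ (V : Set E)))
    {T : Finset (Finset E)} {ν : Finset E → E}
    (hT : ∀ S ∈ T, S ⊆ V ∧ IsBasisSet S ∧ (∀ v ∈ S, ⟪v, ν S⟫ = 1) ∧ ∀ v ∈ V, ⟪v, ν S⟫ ≤ 1)
    (hcover : ∀ x : E, ∃ S ∈ T, ∃ a : E → ℝ, (∀ u ∈ S, 0 ≤ a u) ∧ ∑ u ∈ S, a u • u = x)
    (hoverlap : ∀ S ∈ T, ∀ S' ∈ T, S ≠ S' →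
      ∀ x ∈ convexHull ℝ (S : Set E) ∩ convexHull ℝ (S' : Set E), ¬ OffSpans V x)
    (hmax : ∀ ξ : E, ξ ≠ 0 → ∃ ε > 0, ∀ t : ℝ, |t| < ε →
      μHE[k + 1] (frontier (convexHull ℝ (V : Set E)) ∩ {x | ⟪x, ξ⟫ = t}) ≤
        μHE[k + 1] (frontier (convexHull ℝ (V : Set E)) ∩ {x | ⟪x, ξ⟫ = 0})) :
    ∃ κ : Finset E → ℝ, (∀ S ∈ T, 0 < κ S) ∧
      ∀ ξ, Separates V ξ → (∀ v ∈ V, ⟪v, ξ⟫ ≠ 0) →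
        ∑ S ∈ T, κ S * √(‖ξ‖ ^ 2 - ⟪(‖ν S‖)⁻¹ • ν S, ξ⟫ ^ 2) *
          ∑ v ∈ S with 0 < ⟪v, ξ⟫, vertexTerm k S v ξ = 0 := by
  classical
  set P := convexHull ℝ (V : Set E) with hPdef
  have hPclosed : IsClosed P := (V.finite_toSet.isCompact_convexHull ℝ).isClosed
  have hν0 : ∀ S ∈ T, ν S ≠ 0 := by
    intro S hS h
    obtain ⟨-, hb, h1, -⟩ := hT S hS
    obtain ⟨v, hv⟩ := Finset.card_pos.1 (by rw [hb.card_eq, hE]; omega : 0 < S.card)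
    simpa [h] using h1 v hv
  have hN : ∀ S ∈ T, ‖(‖ν S‖)⁻¹ • ν S‖ = 1 := fun S hS => norm_smul_inv_norm (hν0 S hS)
  have hNc : ∀ S ∈ T, ∀ v ∈ S, ⟪v, (‖ν S‖)⁻¹ • ν S⟫ = (‖ν S‖)⁻¹ := by
    intro S hS v hv
    rw [inner_smul_right, (hT S hS).2.2.1 v hv, mul_one]
  have hchoice : ∀ S ∈ T, ∃ κ : ℝ, 0 < κ ∧ ∀ ξ : E,
      (∀ v ∈ S, ∀ u ∈ S, v ≠ u → ⟪v - u, ξ⟫ ≠ 0) → _ := fun S hS =>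
    exists_lintegral_convexHull_slice (m := k + 1) hE (hT S hS).2.1 (hN S hS) (hNc S hS)
  choose! κ hκ hslice using hchoice
  refine ⟨κ, hκ, fun ξ hsep hne => ?_⟩
  have hsepS : ∀ S ∈ T, ∀ v ∈ S, ∀ u ∈ S, v ≠ u → ⟪v - u, ξ⟫ ≠ 0 := fun S hS v hv u hu =>
    hsep v ((hT S hS).1 hv) u ((hT S hS).1 hu)
  -- the part of a facet simplex met by other facet simplices
  set D : Finset E → Set E := fun S => ⋃ S' ∈ T.erase S,
    convexHull ℝ (S : Set E) ∩ convexHull ℝ (S' : Set E) with hD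
  have hDmeas : ∀ S, MeasurableSet (D S) := fun S =>
    Finset.measurableSet_biUnion _ fun S' _ =>
      (measurableSet_convexHull_finset S).inter (measurableSet_convexHull_finset S')
  have hDnull : ∀ S ∈ T, μHE[k + 1 + 1] (D S) = 0 := by
    intro S hS
    have hsub : D S ⊆ ⋃ t ∈ V.powerset.filter fun t : Finset E => Submodule.span ℝ (t : Set E) ≠ ⊤,
        ((Submodule.span ℝ (t : Set E) : Set E) ∩ {x | ⟪x, ν S⟫ = 1}) := by
      intro x hx
      simp only [hD, Set.mem_iUnion] at hx
      obtain ⟨S', hS', hx⟩ := hx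
      rw [Finset.mem_erase] at hS'
      have h1 := hoverlap S hS S' hS'.2 hS'.1.symm x hx
      unfold OffSpans at h1
      push Not at h1
      obtain ⟨t, htV, ht, hxt⟩ := h1
      simp only [Set.mem_iUnion]
      exact ⟨t, Finset.mem_filter.2 ⟨Finset.mem_powerset.2 htV, ht⟩, hxt,
        inner_eq_of_mem_convexHull (hT S hS).2.2.1 x hx.1⟩
    refine measure_mono_null hsub ((measure_biUnion_null_iff (Finset.countable_toSet _)).2 ?_)
    intro t ht
    exact euclideanHausdorffMeasure_submodule_inter_hyperplane hE (Finset.mem_filter.1 ht).2 _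
      one_ne_zero
  have hfront : ∀ S ∈ T, convexHull ℝ (S : Set E) ⊆ frontier P := by
    intro S hS x hx
    rw [hPclosed.frontier_eq]
    refine ⟨convexHull_mono (Finset.coe_subset.2 (hT S hS).1) hx, fun hxi => ?_⟩
    exact (inner_lt_one_of_mem_interior (inner_le_of_mem_convexHull (hT S hS).2.2.2) hxi).ne
      (inner_eq_of_mem_convexHull (hT S hS).2.2.1 x hx)
  have hfrontcover : frontier P ⊆ ⋃ S ∈ T, convexHull ℝ (S : Set E) := by
    intro x hx
    rw [hPclosed.frontier_eq] at hx
    obtain ⟨S, hS, a, ha, rfl⟩ := hcover x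
    simp only [Set.mem_iUnion]
    exact ⟨S, hS, (mem_convexHull_of_mem_frontier (convex_convexHull ℝ _) h0
      ((Finset.coe_subset.2 (hT S hS).1).trans (subset_convexHull ℝ _)) (hT S hS).2.2.1
      (inner_le_of_mem_convexHull (hT S hS).2.2.2) ha hx.1 hx.2).2⟩
  have hξ0 : ξ ≠ 0 := by
    rintro rfl
    obtain ⟨S, hS, -⟩ := hcover 0
    obtain ⟨v, hv⟩ := Finset.card_pos.1
      (by rw [(hT S hS).2.1.card_eq, hE]; omega : 0 < S.card)
    exact hne v ((hT S hS).1 hv) (inner_zero_right _)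
  obtain ⟨ε₁, hε₁, hmaxξ⟩ := hmax ξ hξ0
  obtain ⟨ε₂, hε₂, hoff⟩ : ∃ ε > 0, ∀ t : ℝ, |t| < ε → ∀ v ∈ V, ⟪v, ξ⟫ ≠ t := by
    have : ∀ᶠ t in 𝓝 (0 : ℝ), ∀ v ∈ V, ⟪v, ξ⟫ ≠ t :=
      (Filter.eventually_all_finset V).2 fun v hv =>
        (eventually_ne_nhds (hne v hv).symm).mono fun t ht => ht.symm
    obtain ⟨ε, hε, h⟩ := Metric.eventually_nhds_iff.1 this
    exact ⟨ε, hε, fun t ht => h (by simpa using ht)⟩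
  have hslice_meas : ∀ t : ℝ, MeasurableSet {x : E | ⟪x, ξ⟫ = t} := fun t =>
    (isClosed_eq (continuous_id.inner (𝕜 := ℝ) (continuous_const (y := ξ)))
      continuous_const).measurableSet
  set σ : Finset E → ℝ := fun S => κ S * √(‖ξ‖ ^ 2 - ⟪(‖ν S‖)⁻¹ • ν S, ξ⟫ ^ 2) with hσ
  have hder : ∀ d, ∀ t : ℝ, |t| < ε₂ →
      HasDerivAt (fun s => ∑ S ∈ T, σ S * simplexSliceVol (d + 1) S ξ s)
        (-∑ S ∈ T, σ S * simplexSliceVol d S ξ t) t := by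
    intro d t ht
    rw [← Finset.sum_neg_distrib]
    refine HasDerivAt.fun_sum fun S hS => ?_
    rw [← mul_neg]
    exact (hasDerivAt_simplexSliceVol fun v hv => hoff t ht v ((hT S hS).1 hv)).const_mul _
  have key := deriv_sliceDensity_eq_zero (T := T)
    (g := fun S t => μHE[k + 1] (convexHull ℝ (S : Set E) ∩ {x | ⟪x, ξ⟫ = t}))
    (g' := fun S t => μHE[k + 1] (convexHull ℝ (S : Set E) \ D S ∩ {x | ⟪x, ξ⟫ = t}))
    (M := fun S s => σ S * simplexSliceVol (k + 1 + 1) S ξ s)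
    (K := μHE[k + 1] (frontier P ∩ {x | ⟪x, ξ⟫ = 0}))
    (L := fun t => ∑ S ∈ T, σ S * simplexSliceVol (k + 1) S ξ t)
    (L' := -∑ S ∈ T, σ S * simplexSliceVol k S ξ 0) (lt_min hε₁ hε₂) ?_ ?_ ?_ ?_ ?_ ?_ ?_
  · rw [neg_eq_zero] at key
    have hfac : (k.factorial : ℝ)⁻¹ ≠ 0 := by positivity
    refine (mul_eq_zero.1 (Eq.trans ?_ key)).resolve_left hfac
    rw [Finset.mul_sum]
    refine Finset.sum_congr rfl fun S _ => ?_
    rw [simplexSliceVol_zero]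
    simp only [hσ]
    ring
  · intro S hS s
    refine ⟨(hslice S hS ξ (hsepS S hS) s).1, ?_⟩
    have h := (hslice S hS ξ (hsepS S hS) s).2 ∅ MeasurableSet.empty measure_empty
    simpa only [Set.sdiff_empty] using h
  · intro S hS s
    exact ⟨(hslice S hS ξ (hsepS S hS) s).1,
      (hslice S hS ξ (hsepS S hS) s).2 (D S) (hDmeas S) (hDnull S hS)⟩
  · intro t ht
    refine le_trans ?_ (hmaxξ t (ht.trans_le (min_le_left _ _)))
    rw [← measure_biUnion_finset]
    · refine measure_mono (Set.iUnion₂_subset fun S hS => ?_)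
      exact Set.inter_subset_inter_left _ (Set.sdiff_subset.trans (hfront S hS))
    · intro S hS S' hS' hne'
      refine Set.disjoint_left.2 fun x hx hx' => hx.1.2 ?_
      simp only [hD, Set.mem_iUnion]
      exact ⟨S', Finset.mem_erase.2 ⟨hne'.symm, hS'⟩, hx.1.1, hx'.1.1⟩
    · exact fun S _ => ((measurableSet_convexHull_finset S).diff (hDmeas S)).inter (hslice_meas t)
  · refine le_trans (measure_mono ?_) (measure_biUnion_finset_le _ _)
    rintro x ⟨hx, hx0⟩
    have := hfrontcover hx
    simp only [Set.mem_iUnion] at this ⊢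
    obtain ⟨S, hS, hxS⟩ := this
    exact ⟨S, hS, hxS, hx0⟩
  · intro S hS q hq
    exact eventually_mul_measure_slice_le (fun v hv => hne v ((hT S hS).1 hv)) hq
  · exact fun t ht => hder (k + 1) t (ht.trans_le (min_le_right _ _))
  · exact hder k 0 (by simpa using hε₂)

end FacetRelation

section Symmetry

open Topology

variable {E : Type*} [NormedAddCommGroup E] [InnerProductSpace ℝ E] [FiniteDimensional ℝ E]

theorem eq_neg_of_gauge_ratio_finite {P : Set E} (hE : 1 < Module.finrank ℝ E)
    (hc : Convex ℝ P) (hPc : IsCompact P) (h0 : (0 : E) ∈ interior P) {Λ : Set ℝ} (hΛ : Λ.Finite)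
    (h : ∀ x : E, x ≠ 0 → ∃ l ∈ Λ, gauge P x = l * gauge P (-x)) : P = -P := by
  have h0' : P ∈ 𝓝 (0 : E) := mem_interior_iff_mem_nhds.1 h0
  have hpos : ∀ x : E, x ≠ 0 → 0 < gauge P x := fun x hx =>
    (gauge_pos (absorbent_nhds_zero h0') (hPc.isVonNBounded ℝ)).2 hx
  have hcont := continuous_gauge hc h0'
  have hpre : IsPreconnected ({0}ᶜ : Set E) :=
    (isConnected_compl_singleton_of_one_lt_rank (by
      rw [← Module.finrank_eq_rank]; exact_mod_cast hE) 0).isPreconnected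
  have hcontρ : ContinuousOn (fun x => gauge P x / gauge P (-x)) ({0}ᶜ : Set E) :=
    hcont.continuousOn.div (hcont.comp continuous_neg).continuousOn
      fun x hx => (hpos (-x) (neg_ne_zero.2 hx)).ne'
  have heven : ∀ x : E, gauge P x = gauge P (-x) := by
    intro x
    by_cases hx : x = 0
    · simp [hx]
    have h1 := hpre.constant_of_mapsTo hΛ.isDiscrete hcontρ (fun y hy => by
      obtain ⟨l, hl, hy'⟩ := h y hy
      have := hpos (-y) (neg_ne_zero.2 hy)
      simp only [hy']
      rwa [mul_div_cancel_right₀ _ this.ne']) (x := x) (y := -x) hx (neg_ne_zero.2 hx)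
    have ha := hpos x hx
    have hb := hpos (-x) (neg_ne_zero.2 hx)
    simp only [neg_neg] at h1
    rw [div_eq_div_iff hb.ne' ha.ne'] at h1
    nlinarith
  have hmem : ∀ x : E, x ∈ P ↔ gauge P x ≤ 1 := fun x => by
    rw [gauge_le_one_iff_mem_closure hc h0', hPc.isClosed.closure_eq]
  ext x
  rw [Set.mem_neg, hmem, hmem, heven]

theorem eq_neg_of_facet_relation (hE : 3 ≤ Module.finrank ℝ E) {V : Finset E}
    (h0 : (0 : E) ∈ interior (convexHull ℝ (V : Set E)))
    (hVext : ∀ v ∈ V, v ∈ (convexHull ℝ (V : Set E)).extremePoints ℝ)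
    {T : Finset (Finset E)} {ν : Finset E → E} {κ : Finset E → ℝ} {k : ℕ}
    (hT : ∀ S ∈ T, S ⊆ V ∧ IsBasisSet S ∧ (∀ v ∈ S, ⟪v, ν S⟫ = 1) ∧ ∀ v ∈ V, ⟪v, ν S⟫ ≤ 1)
    (hcover : ∀ x : E, ∃ S ∈ T, ∃ a : E → ℝ, (∀ u ∈ S, 0 ≤ a u) ∧ ∑ u ∈ S, a u • u = x)
    (hκ : ∀ S ∈ T, 0 < κ S)
    (hrel : ∀ ξ, Separates V ξ → (∀ v ∈ V, ⟪v, ξ⟫ ≠ 0) →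
      ∑ S ∈ T, κ S * √(‖ξ‖ ^ 2 - ⟪(‖ν S‖)⁻¹ • ν S, ξ⟫ ^ 2) *
        ∑ v ∈ S with 0 < ⟪v, ξ⟫, vertexTerm k S v ξ = 0) :
    convexHull ℝ (V : Set E) = -convexHull ℝ (V : Set E) := by
  classical
  have hnt : Nontrivial E := Module.nontrivial_of_finrank_pos (R := ℝ) (by omega)
  set P := convexHull ℝ (V : Set E) with hP
  have hPc : IsCompact P := V.finite_toSet.isCompact_convexHull ℝ
  have hPconv : Convex ℝ P := convex_convexHull ℝ _
  have hVint : ∀ v ∈ V, v ∉ interior P := fun v hv hi =>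
    Set.disjoint_left.1 (disjoint_interior_extremePoints P) hi (hVext v hv)
  have hVP : ∀ v ∈ V, v ∈ P := fun v hv => subset_convexHull ℝ _ hv
  have hV0 : (0 : E) ∉ V := fun h => hVint 0 h h0
  have hray : ∀ v ∈ V, ∀ c : ℝ, 0 < c → c • v ∈ V → c = 1 := by
    intro v hv c hc hcv
    rcases lt_trichotomy c 1 with h | h | h
    · exact absurd (smul_mem_interior_of_mem hPconv h0 (hVP v hv) hc.le h) (hVint _ hcv)
    · exact h
    · refine absurd (smul_mem_interior_of_mem hPconv h0 (hVP _ hcv) (inv_nonneg.2 hc.le)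
        (inv_lt_one_of_one_lt₀ h)) ?_
      rw [inv_smul_smul₀ hc.ne']
      exact hVint v hv
  have hexp : ∀ v ∈ V, ∃ η : E, ∀ u ∈ V, u ≠ v → ⟪u, η⟫ < ⟪v, η⟫ := by
    intro v hv
    have hv' : v ∉ convexHull ℝ ((V.erase v : Finset E) : Set E) := by
      have h := (hPconv.mem_extremePoints_iff_mem_sdiff_convexHull_sdiff.1 (hVext v hv)).2
      refine fun h' => h (convexHull_mono ?_ h')
      intro u hu
      rw [Finset.mem_coe, Finset.mem_erase] at hu
      exact ⟨hVP u hu.2, hu.1⟩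
    obtain ⟨f, c, hf, hc⟩ := geometric_hahn_banach_closed_point (convex_convexHull ℝ _)
      ((V.erase v).finite_toSet.isCompact_convexHull ℝ).isClosed hv'
    refine ⟨(InnerProductSpace.toDual ℝ E).symm f, fun u hu huv => ?_⟩
    rw [real_inner_comm, InnerProductSpace.toDual_symm_apply, real_inner_comm,
      InnerProductSpace.toDual_symm_apply]
    exact (hf u (subset_convexHull ℝ _ (Finset.mem_coe.2 (Finset.mem_erase.2 ⟨huv, hu⟩)))).trans hc
  have hScard : ∀ S ∈ T, S.Nonempty := fun S hS =>
    Finset.card_pos.1 (by rw [(hT S hS).2.1.card_eq]; omega)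
  have hν0 : ∀ S ∈ T, ν S ≠ 0 := by
    intro S hS h
    obtain ⟨v, hv⟩ := hScard S hS
    simpa [h] using (hT S hS).2.2.1 v hv
  have hopp : ∀ S ∈ T, ∀ v ∈ S, ∃ c : ℝ, 0 < c ∧ -c • v ∈ V ∧ ∃ S' ∈ T, ν S' = (-c⁻¹) • ν S := by
    intro S hS v hv
    have hvV := (hT S hS).1 hv
    obtain ⟨c, hc, hcV, S', hS', hcS', hspan⟩ := exists_opposite_vertex hE
      (N := fun S => (‖ν S‖)⁻¹ • ν S) (fun S hS => (hT S hS).1)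
      (fun S hS => norm_smul_inv_norm (hν0 S hS)) hκ hrel hV0 hS hv (hray v hvV) (hexp v hvV)
    refine ⟨c, hc, hcV, S', hS', ?_⟩
    obtain ⟨a, ha⟩ := Submodule.mem_span_singleton.1 hspan
    have h1 : ν S' = (‖ν S'‖ * (a * (‖ν S‖)⁻¹)) • ν S := by
      rw [mul_smul, mul_smul, ha, smul_inv_smul₀ (norm_ne_zero_iff.2 (hν0 S' hS'))]
    set b := ‖ν S'‖ * (a * (‖ν S‖)⁻¹) with hb
    have h2 := (hT S' hS').2.2.1 _ hcS'
    rw [h1, inner_smul_left, inner_smul_right, (hT S hS).2.2.1 v hv] at h2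
    simp only [RCLike.conj_to_real, mul_one] at h2
    rw [h1]
    congr 1
    field_simp
    linarith
  have hlam : ∀ S ∈ T, ∃ l : ℝ, 0 < l ∧ (∀ v ∈ S, -l • v ∈ V) ∧
      ∃ S' ∈ T, ν S' = (-l⁻¹) • ν S := by
    intro S hS
    obtain ⟨v, hv⟩ := hScard S hS
    obtain ⟨c, hc, hcV, S', hS', hνS'⟩ := hopp S hS v hv
    have hle : ∀ w ∈ S, ∀ d, 0 < d → -d • w ∈ V → d ≤ c := by
      intro w hw d hd hdV
      have := (hT S' hS').2.2.2 _ hdV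
      rw [hνS', inner_smul_left, inner_smul_right, (hT S hS).2.2.1 w hw] at this
      simp only [RCLike.conj_to_real, mul_one, neg_mul_neg] at this
      rwa [← div_eq_mul_inv, div_le_one hc] at this
    refine ⟨c, hc, fun w hw => ?_, S', hS', hνS'⟩
    obtain ⟨d, hd, hdV, S'', hS'', hνS''⟩ := hopp S hS w hw
    have h1 := (hT S'' hS'').2.2.2 _ hcV
    rw [hνS'', inner_smul_left, inner_smul_right, (hT S hS).2.2.1 v hv] at h1
    simp only [RCLike.conj_to_real, mul_one, neg_mul_neg] at h1
    rw [← div_eq_mul_inv, div_le_one hd] at h1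
    rwa [le_antisymm h1 (hle w hw d hd hdV)]
  choose! l hl hlV S' hS'T hνS' using hlam
  have h0' : P ∈ 𝓝 (0 : E) := mem_interior_iff_mem_nhds.1 h0
  refine eq_neg_of_gauge_ratio_finite (by omega) hPconv hPc h0 (T.image l).finite_toSet
    fun x hx => ?_
  obtain ⟨S, hS, a, ha, rfl⟩ := hcover x
  refine ⟨l S, Finset.mem_coe.2 (Finset.mem_image_of_mem _ hS), ?_⟩
  set r := ∑ u ∈ S, a u with hr
  have hr0 : 0 < r := by
    refine lt_of_le_of_ne (Finset.sum_nonneg ha) fun h => hx ?_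
    have := (Finset.sum_eq_zero_iff_of_nonneg ha).1 h.symm
    exact Finset.sum_eq_zero fun u hu => by rw [this u hu, zero_smul]
  have hsupp : ∀ S ∈ T, ∀ y ∈ P, ⟪y, ν S⟫ = 1 → gauge P y = 1 := by
    intro S hS y hy hy1
    rw [gauge_eq_one_iff_mem_frontier hPconv h0', hPc.isClosed.frontier_eq]
    exact ⟨hy, fun hi => (inner_lt_one_of_mem_interior
      (inner_le_of_mem_convexHull (hT S hS).2.2.2) hi).ne hy1⟩
  have hyin : ⟪∑ u ∈ S, a u • u, ν S⟫ = r := by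
    rw [sum_inner]
    exact Finset.sum_congr rfl fun u hu => by
      rw [real_inner_smul_left, (hT S hS).2.2.1 u hu, mul_one]
  have hcomb : ∀ w : E → E, (∀ u ∈ S, w u ∈ P) → r⁻¹ • ∑ u ∈ S, a u • w u ∈ P := by
    intro w hw
    rw [Finset.smul_sum]
    simp_rw [smul_smul]
    refine hPconv.sum_mem (fun u hu => mul_nonneg (inv_nonneg.2 hr0.le) (ha u hu)) ?_ hw
    rw [← Finset.mul_sum, inv_mul_cancel₀ hr0.ne']
  have h1 : gauge P (r⁻¹ • ∑ u ∈ S, a u • u) = 1 := by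
    refine hsupp S hS _ (hcomb (fun u => u) fun u hu => hVP u ((hT S hS).1 hu)) ?_
    rw [real_inner_smul_left, hyin, inv_mul_cancel₀ hr0.ne']
  have h2 : gauge P ((r⁻¹ * l S) • -∑ u ∈ S, a u • u) = 1 := by
    have heq : (r⁻¹ * l S) • -∑ u ∈ S, a u • u = r⁻¹ • ∑ u ∈ S, a u • (-l S • u) := by
      rw [mul_smul, smul_neg, ← neg_smul, Finset.smul_sum]
      congr 1
      exact Finset.sum_congr rfl fun u _ => smul_comm _ _ _
    refine hsupp (S' S) (hS'T S hS) _ (heq ▸ hcomb _ fun u hu => hVP _ (hlV S hS u hu)) ?_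
    rw [hνS' S hS, real_inner_smul_left, real_inner_smul_right, inner_neg_left, hyin]
    have := (hl S hS).ne'
    field_simp
  rw [gauge_smul_of_nonneg (inv_nonneg.2 hr0.le), smul_eq_mul] at h1
  rw [gauge_smul_of_nonneg (mul_nonneg (inv_nonneg.2 hr0.le) (hl S hS).le), smul_eq_mul,
    mul_assoc] at h2
  exact mul_left_cancel₀ (inv_ne_zero hr0.ne') (h1.trans h2.symm)

end Symmetry

theorem intrinsicFrontier_inter_affineSubspace {E : Type*} [NormedAddCommGroup E]
    [NormedSpace ℝ E] {P : Set E} (hconv : Convex ℝ P) (hcl : IsClosed P)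
    {A : AffineSubspace ℝ E} (hA : IsClosed (A : Set E)) {p : E} (hp : p ∈ interior P)
    (hpA : p ∈ A) : intrinsicFrontier ℝ (P ∩ A) = frontier P ∩ A := by
  have hspan : affineSpan ℝ (P ∩ A) ≤ A := affineSpan_le.2 Set.inter_subset_right
  have hpspan : p ∈ affineSpan ℝ (P ∩ A) := subset_affineSpan _ _ ⟨interior_subset hp, hpA⟩
  have hclosure : intrinsicClosure ℝ (P ∩ A) = P ∩ A :=
    ((hcl.inter hA).preimage continuous_subtype_val).intrinsicClosure
  have hint : intrinsicInterior ℝ (P ∩ A) = interior P ∩ A := by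
    ext x
    constructor
    · intro hx
      have hxA : x ∈ P ∩ A := intrinsicInterior_subset hx
      refine ⟨?_, hxA.2⟩
      obtain ⟨y, hy, rfl⟩ := mem_intrinsicInterior.1 hx
      let c : ℝ → affineSpan ℝ (P ∩ A) := fun δ =>
        ⟨AffineMap.lineMap p (y : E) (1 + δ), AffineMap.lineMap_mem _ hpspan y.2⟩
      have hc : Continuous c := by
        refine Continuous.subtype_mk ?_ _
        exact AffineMap.lineMap_continuous.comp (by fun_prop)
      have hc0 : c 0 = y := Subtype.ext (by simp [c])
      have hev : ∀ᶠ δ in nhds (0 : ℝ), (c δ : E) ∈ P ∩ A := by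
        have := hc.continuousAt (x := 0)
        rw [ContinuousAt, hc0] at this
        exact this (mem_interior_iff_mem_nhds.1 hy)
      obtain ⟨δ, hδP, hδ⟩ : ∃ δ : ℝ, (c δ : E) ∈ P ∩ A ∧ 0 < δ :=
        ((hev.filter_mono nhdsWithin_le_nhds).and
          (self_mem_nhdsWithin : Set.Ioi (0 : ℝ) ∈ nhdsWithin 0 (Set.Ioi 0))).exists
      have h1 : 0 < 1 + δ := by positivity
      have := hconv.combo_interior_self_mem_interior hp hδP.1 (a := δ / (1 + δ))
        (b := 1 / (1 + δ)) (by positivity) (by positivity) (by field_simp; ring)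
      convert this using 1
      simp only [c, AffineMap.lineMap_apply_module']
      match_scalars <;> field_simp
      ring
    · intro hx
      have hsub : ((↑) ⁻¹' interior P : Set (affineSpan ℝ (P ∩ A))) ⊆ (↑) ⁻¹' (P ∩ A) :=
        fun y hy => ⟨interior_subset hy, hspan y.2⟩
      exact mem_intrinsicInterior.2 ⟨⟨x, subset_affineSpan _ _ ⟨interior_subset hx.1, hx.2⟩⟩,
        interior_maximal hsub (isOpen_interior.preimage continuous_subtype_val) hx.1, rfl⟩
  rw [← intrinsicClosure_sdiff_intrinsicInterior, hclosure, hint, hcl.frontier_eq]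
  ext x
  simp only [Set.mem_sdiff, Set.mem_inter_iff]
  tauto

theorem intrinsicFrontier_inter_hyperplane {E : Type*} [NormedAddCommGroup E]
    [InnerProductSpace ℝ E] {P : Set E} (hconv : Convex ℝ P) (hcl : IsClosed P) {ξ p : E}
    (hp : p ∈ interior P) :
    intrinsicFrontier ℝ (P ∩ {x | ⟪x, ξ⟫ = ⟪p, ξ⟫}) = frontier P ∩ {x | ⟪x, ξ⟫ = ⟪p, ξ⟫} := by
  have hA : {x | ⟪x, ξ⟫ = ⟪p, ξ⟫} = (AffineSubspace.mk' p (ℝ ∙ ξ)ᗮ : Set E) := by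
    ext x
    simp [AffineSubspace.mem_mk', Submodule.mem_orthogonal_singleton_iff_inner_left,
      inner_sub_left, sub_eq_zero]
  have hcl' : IsClosed {x : E | ⟪x, ξ⟫ = ⟪p, ξ⟫} := isClosed_eq (by fun_prop) continuous_const
  rw [hA] at hcl' ⊢
  exact intrinsicFrontier_inter_affineSubspace hconv hcl hcl' hp (AffineSubspace.self_mem_mk' _ _)

theorem euclideanHausdorffMeasure_mono_of_hausdorffMeasure {X : Type*} [EMetricSpace X]
    [MeasurableSpace X] [BorelSpace X] {d : ℕ} {s t : Set X} (h : μH[(d : ℝ)] s ≤ μH[(d : ℝ)] t) :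
    μHE[d] s ≤ μHE[d] t := by
  rw [Measure.euclideanHausdorffMeasure_def, Measure.smul_apply, Measure.smul_apply]
  gcongr

theorem exists_frontier_section_le {E : Type*} [NormedAddCommGroup E] [InnerProductSpace ℝ E]
    [MeasurableSpace E] [BorelSpace E] {P : Set E} (hconv : Convex ℝ P) (hcl : IsClosed P)
    (h0 : (0 : E) ∈ interior P) {d : ℕ}
    (hmax : ∀ ξ ∈ Metric.sphere (0 : E) 1, ∀ t : ℝ,
      μH[(d : ℝ)] (intrinsicFrontier ℝ (P ∩ {x | ⟪x, ξ⟫ = t})) ≤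
        μH[(d : ℝ)] (intrinsicFrontier ℝ (P ∩ {x | ⟪x, ξ⟫ = 0}))) {ξ : E} (hξ : ξ ≠ 0) :
    ∃ ε > 0, ∀ t : ℝ, |t| < ε →
      μHE[d] (frontier P ∩ {x | ⟪x, ξ⟫ = t}) ≤ μHE[d] (frontier P ∩ {x | ⟪x, ξ⟫ = 0}) := by
  have hn : 0 < ‖ξ‖ := norm_pos_iff.2 hξ
  have hset : ∀ t : ℝ, {x | ⟪x, ξ⟫ = t} = {x | ⟪x, ‖ξ‖⁻¹ • ξ⟫ = ‖ξ‖⁻¹ * t} := by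
    intro t
    ext x
    simp [real_inner_smul_right, hn.ne']
  have hfront : ∀ p ∈ interior P, intrinsicFrontier ℝ
      (P ∩ {x | ⟪x, ‖ξ‖⁻¹ • ξ⟫ = ‖ξ‖⁻¹ * ⟪p, ξ⟫}) = frontier P ∩ {x | ⟪x, ξ⟫ = ⟪p, ξ⟫} := by
    intro p hp
    rw [← hset]
    exact intrinsicFrontier_inter_hyperplane hconv hcl hp
  have hcont : Filter.Tendsto (fun t : ℝ => (t / ‖ξ‖ ^ 2) • ξ) (nhds 0) (nhds 0) := by
    have : Continuous fun t : ℝ => (t / ‖ξ‖ ^ 2) • ξ := by fun_prop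
    simpa using this.tendsto 0
  obtain ⟨ε, hε, hball⟩ := Metric.eventually_nhds_iff.1 (hcont (isOpen_interior.mem_nhds h0))
  refine ⟨ε, hε, fun t ht => euclideanHausdorffMeasure_mono_of_hausdorffMeasure ?_⟩
  have hp : (t / ‖ξ‖ ^ 2) • ξ ∈ interior P := hball (by simpa using ht)
  have hpt : ⟪(t / ‖ξ‖ ^ 2) • ξ, ξ⟫ = t := by
    rw [real_inner_smul_left, real_inner_self_eq_norm_sq]
    field_simp
  have h1 := hfront _ hp
  have h2 := hfront 0 h0
  rw [hpt] at h1
  rw [inner_zero_left, mul_zero] at h2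
  rw [← h1, ← h2]
  exact hmax _ (by simp [norm_smul, hn.ne.symm]) _

/-- main theorem: a convex polytope `P ⊆ ℝⁿ` (`n ≥ 3`, hull of a finite
set, with `0` in its interior) such that for every unit `ξ` the central section
`P ∩ ξ^⊥` has maximal relative-boundary `(n-2)`-volume among all parallel sections
`P ∩ {⟪x, ξ⟫ = t}` is origin-symmetric. -/
theorem stmt17 {n : ℕ} (hn : 3 ≤ n) (P V : Set (EuclideanSpace ℝ (Fin n)))
    (hVfin : V.Finite) (hP : P = convexHull ℝ V)
    (h0 : (0 : EuclideanSpace ℝ (Fin n)) ∈ interior P)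
    (hmax : ∀ ξ ∈ Metric.sphere (0 : EuclideanSpace ℝ (Fin n)) 1,
      IsGreatest
        (Set.range fun t : ℝ =>
          μH[(n : ℝ) - 2] (intrinsicFrontier ℝ (P ∩ {x | ⟪x, ξ⟫ = t})))
        (μH[(n : ℝ) - 2] (intrinsicFrontier ℝ (P ∩ {x | ⟪x, ξ⟫ = 0})))) :
    P = -P := by
  have hconv : Convex ℝ P := hP ▸ convex_convexHull ℝ V
  have hcomp : IsCompact P := hP ▸ hVfin.isCompact_convexHull ℝ
  have hextfin : (P.extremePoints ℝ).Finite :=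
    hVfin.subset (hP ▸ extremePoints_convexHull_subset)
  obtain ⟨W, hW⟩ : ∃ W : Finset (EuclideanSpace ℝ (Fin n)), (W : Set _) = P.extremePoints ℝ :=
    ⟨hextfin.toFinset, hextfin.coe_toFinset⟩
  have hWP : P = convexHull ℝ (W : Set (EuclideanSpace ℝ (Fin n))) := by
    rw [hW, ← (hextfin.isCompact_convexHull ℝ).isClosed.closure_eq,
      closure_convexHull_extremePoints hcomp hconv]
  obtain ⟨k, rfl⟩ := Nat.exists_eq_add_of_le' hn
  have hd : ((k + 3 : ℕ) : ℝ) - 2 = ((k + 1 : ℕ) : ℝ) := by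
    push_cast
    ring
  rw [hd] at hmax
  have hsec : ∀ ξ : EuclideanSpace ℝ (Fin (k + 3)), ξ ≠ 0 → _ := fun ξ hξ =>
    exists_frontier_section_le hconv hcomp.isClosed h0
      (fun ξ hξ t => (hmax ξ hξ).2 (Set.mem_range_self t)) hξ
  have hext : ∀ v ∈ W, v ∈ P.extremePoints ℝ := fun v hv => hW ▸ Finset.mem_coe.2 hv
  rw [hWP] at h0 hsec hext ⊢
  have hdim : Module.finrank ℝ (EuclideanSpace ℝ (Fin (k + 3))) = k + 3 := by simp
  obtain ⟨T, ν, hT, hcover, hoverlap⟩ := exists_boundary_triangulation h0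
  obtain ⟨κ, hκ, hrel⟩ := exists_facet_relation hdim h0 hT hcover hoverlap hsec
  exact eq_neg_of_facet_relation (by omega) h0 hext hT hcover hκ hrel
end

section
/- Let P ⊂ ℝⁿ (n ≥ 3) be a convex polytope with 0 in its interior such that for every (n−2)-dimensional face G of P, there exists t > 0 for which reflec(G, t) is also an (n−2)-dimensional face of P. Then: (a) for every vertex v of P the line ℝv contains exactly one other vertex ṽ of P, lying on the opposite side of the origin; and (b) if u and v are vertices joined by an edge of P, then ũ and ṽ are joined by an edge of P parallel to the edge from u to v. -/
open scoped RealInnerProductSpace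

/-- An extreme convex subset of a convex set contains every point of the set lying in its
affine span. -/
theorem IsExtreme.mem_of_mem_affineSpan {E : Type*} [NormedAddCommGroup E] [NormedSpace ℝ E]
    [FiniteDimensional ℝ E] {P G : Set E} (hG : Convex ℝ G) (hne : G.Nonempty)
    (hPG : IsExtreme ℝ P G) {x : E} (hxP : x ∈ P) (hx : x ∈ affineSpan ℝ G) : x ∈ G := by
  obtain ⟨p, hp⟩ := hne.intrinsicInterior hG
  obtain ⟨⟨p, hpA⟩, hpi, rfl⟩ := hp
  rw [mem_interior_iff_mem_nhds] at hpi
  have hmem (r : ℝ) : AffineMap.lineMap p x r ∈ affineSpan ℝ G :=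
    AffineMap.lineMap_mem r hpA hx
  let γ : ℝ → affineSpan ℝ G := fun r => ⟨AffineMap.lineMap p x r, hmem r⟩
  have hγ : Continuous γ := by
    refine Continuous.subtype_mk ?_ _
    exact AffineMap.lineMap_continuous
  have hev : ∀ᶠ r in nhds (0 : ℝ), AffineMap.lineMap p x r ∈ G := by
    have h0 : γ 0 = ⟨p, hpA⟩ := Subtype.ext (by simp [γ])
    rw [← h0] at hpi
    exact hγ.continuousAt.preimage_mem_nhds hpi
  obtain ⟨ε, hε, h⟩ := Metric.eventually_nhds_iff.1 hev
  have hy : AffineMap.lineMap p x (-(ε / 2)) ∈ G := h (by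
    rw [dist_zero_right, Real.norm_eq_abs, abs_neg, abs_of_pos (half_pos hε)]
    exact half_lt_self hε)
  have hpG : p ∈ G := Set.mem_preimage.1 (mem_of_mem_nhds hpi)
  refine hPG.left_mem_of_mem_openSegment hxP (hPG.subset hy) hpG ?_
  refine ⟨(ε / 2) / (1 + ε / 2), 1 / (1 + ε / 2), by positivity, by positivity,
    by field_simp; ring, ?_⟩
  rw [AffineMap.lineMap_apply_module']
  have h1 : (1 + ε / 2) ≠ 0 := by positivity
  rw [← smul_right_inj h1]
  simp only [smul_add, smul_smul, smul_sub]
  field_simp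
  module

/-- A proper face of a polytope is contained in a face whose dimension is larger by one. -/
theorem exists_face_finrank_succ {E : Type*} [NormedAddCommGroup E] [InnerProductSpace ℝ E]
    [FiniteDimensional ℝ E] {V G : Set E} (hV : V.Finite) (hne : G.Nonempty) (hG : Convex ℝ G)
    (hPG : IsExtreme ℝ (convexHull ℝ V) G) (hVG : ¬ V ⊆ G) :
    ∃ G' : Set E, G ⊆ G' ∧ IsClosed G' ∧ Convex ℝ G' ∧ IsExtreme ℝ (convexHull ℝ V) G' ∧
      Module.finrank ℝ (vectorSpan ℝ G') = Module.finrank ℝ (vectorSpan ℝ G) + 1 := by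
  obtain ⟨p, hp⟩ := hne
  have hpA : p ∈ affineSpan ℝ G := subset_affineSpan ℝ G hp
  have hmemA (x : E) : x ∈ affineSpan ℝ G ↔ x - p ∈ vectorSpan ℝ G := by
    rw [← direction_affineSpan, ← vsub_eq_sub, AffineSubspace.vsub_right_mem_direction_iff_mem hpA]
  have hKG : convexHull ℝ (V \ G) ⊆ convexHull ℝ V \ G :=
    convexHull_min (Set.sdiff_subset_sdiff_left (subset_convexHull ℝ V))
      (hPG.convex_sdiff (convex_convexHull ℝ V))
  have hdisj : Disjoint (convexHull ℝ (V \ G)) (affineSpan ℝ G : Set E) :=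
    Set.disjoint_left.2 fun x hx hxA =>
      (hKG hx).2 (hPG.mem_of_mem_affineSpan hG ⟨p, hp⟩ (hKG hx).1 hxA)
  obtain ⟨f, a, b, hfa, hab, hfb⟩ := geometric_hahn_banach_compact_closed (convex_convexHull ℝ _)
    (hV.sdiff.isCompact_convexHull ℝ) (affineSpan ℝ G).convex
    (AffineSubspace.closed_of_finiteDimensional _) hdisj
  have hfL (l : E) (hl : l ∈ vectorSpan ℝ G) : f l = 0 := by
    by_contra hne
    have := hfb (p + ((b - f p) / f l) • l) ((hmemA _).2 (by
      simpa using Submodule.smul_mem _ _ hl))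
    rw [map_add, map_smul, smul_eq_mul, div_mul_cancel₀ _ hne] at this
    linarith
  have hfV (v : E) (hv : v ∈ V) (hvG : v ∉ G) : 0 < - f (v - p) := by
    have h1 := hfa v (subset_convexHull ℝ _ ⟨hv, hvG⟩)
    have h2 := hfb p hpA
    rw [map_sub]
    linarith
  let T : E →L[ℝ] E := (vectorSpan ℝ G)ᗮ.starProjection
  have hT (y : E) : T y = 0 ↔ y ∈ vectorSpan ℝ G := by
    rw [Submodule.starProjection_apply_eq_zero_iff, Submodule.orthogonal_orthogonal]
  obtain ⟨v₀, ⟨hv₀V, hv₀G⟩, hmax⟩ := Set.exists_max_image (V \ G)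
    (fun v => ‖(-f (v - p))⁻¹ • T (v - p)‖) hV.sdiff (Set.sdiff_nonempty.2 hVG)
  set w : E := (-f (v₀ - p))⁻¹ • T (v₀ - p) with hw
  let g : E →L[ℝ] ℝ := (innerSL ℝ w).comp T + ‖w‖ ^ 2 • f
  have hg (y : E) : g y = ⟪w, T y⟫ + ‖w‖ ^ 2 * f y := by simp [g]
  have hvert (v : E) (hv : v ∈ V) :
      g (v - p) ≤ 0 ∧ (g (v - p) = 0 → ∃ r : ℝ, T (v - p) = r • w) := by
    by_cases hvG : v ∈ G
    · have hvL : v - p ∈ vectorSpan ℝ G := vsub_mem_vectorSpan ℝ hvG hp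
      have h0 := (hT _).2 hvL
      exact ⟨by simp [hg, h0, hfL _ hvL], fun _ => ⟨0, by simp [h0]⟩⟩
    · have hpos := hfV v hv hvG
      set c := -f (v - p) with hc
      have hle := hmax v ⟨hv, hvG⟩
      obtain ⟨z, hz⟩ : ∃ z, z = c⁻¹ • T (v - p) := ⟨_, rfl⟩
      have hTz : T (v - p) = c • z := by rw [hz, smul_inv_smul₀ hpos.ne']
      have hgz : g (v - p) = c * (⟪w, z⟫ - ‖w‖ ^ 2) := by
        rw [hg, hTz, inner_smul_right, show f (v - p) = -c by rw [hc, neg_neg]]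
        ring
      have hzw : ‖z‖ ≤ ‖w‖ := by rw [hz]; exact hle
      have hsq : ‖z‖ ^ 2 ≤ ‖w‖ ^ 2 := by gcongr
      have hexp := norm_sub_sq_real w z
      have hnn := sq_nonneg ‖w - z‖
      refine ⟨?_, fun h => ⟨c, ?_⟩⟩
      · rw [hgz]
        exact mul_nonpos_of_nonneg_of_nonpos hpos.le (by linarith)
      · rw [hgz] at h
        have h2 := (mul_eq_zero.1 h).resolve_left hpos.ne'
        have h3 : ‖w - z‖ ^ 2 = 0 := by linarith
        have h4 : w - z = 0 := by simpa using h3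
        rw [hTz, sub_eq_zero.1 h4]
  have hpoly (x : E) (hx : x ∈ convexHull ℝ V) :
      g (x - p) ≤ 0 ∧ (g (x - p) = 0 → ∃ r : ℝ, T (x - p) = r • w) := by
    revert x
    refine convexHull_min (t := {x | g (x - p) ≤ 0 ∧ (g (x - p) = 0 → ∃ r : ℝ, T (x - p) = r • w)})
      hvert ?_
    rw [convex_iff_forall_pos]
    rintro x ⟨hx, hx'⟩ y ⟨hy, hy'⟩ s t hs ht hst
    have hsub : s • x + t • y - p = s • (x - p) + t • (y - p) := by
      nth_rewrite 1 [← one_smul ℝ p, ← hst]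
      module
    simp only [Set.mem_ofPred_eq, hsub, map_add, map_smul, smul_eq_mul]
    have h1 := mul_nonpos_of_nonneg_of_nonpos hs.le hx
    have h2 := mul_nonpos_of_nonneg_of_nonpos ht.le hy
    refine ⟨by linarith, fun h => ?_⟩
    obtain ⟨r, hr⟩ := hx' ((mul_eq_zero.1 (by linarith : s * g (x - p) = 0)).resolve_left hs.ne')
    obtain ⟨q, hq⟩ := hy' ((mul_eq_zero.1 (by linarith : t * g (y - p) = 0)).resolve_left ht.ne')
    exact ⟨s * r + t * q, by rw [hr, hq]; module⟩
  let G' : Set E := {x | x ∈ convexHull ℝ V ∧ g (x - p) = 0}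
  have hGG' : G ⊆ G' := fun x hx => ⟨hPG.subset hx, by
    have hxL : x - p ∈ vectorSpan ℝ G := vsub_mem_vectorSpan ℝ hx hp
    simp [hg, (hT _).2 hxL, hfL _ hxL]⟩
  have hv₀L : v₀ - p ∉ vectorSpan ℝ G := fun h =>
    hv₀G (hPG.mem_of_mem_affineSpan hG ⟨p, hp⟩ (subset_convexHull ℝ V hv₀V) ((hmemA _).2 h))
  have hpos₀ := hfV v₀ hv₀V hv₀G
  have hv₀G' : v₀ ∈ G' := by
    refine ⟨subset_convexHull ℝ V hv₀V, ?_⟩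
    have hTw : T (v₀ - p) = (-f (v₀ - p)) • w := by rw [hw, smul_inv_smul₀ hpos₀.ne']
    rw [hg, hTw, inner_smul_right, real_inner_self_eq_norm_sq]
    ring
  have hspan : vectorSpan ℝ G' = vectorSpan ℝ G ⊔ Submodule.span ℝ {v₀ - p} := by
    apply le_antisymm
    · rw [vectorSpan_eq_span_vsub_set_right ℝ (hGG' hp), Submodule.span_le]
      rintro _ ⟨x, hx, rfl⟩
      obtain ⟨r, hr⟩ := (hpoly x hx.1).2 hx.2
      refine Submodule.mem_sup.2 ⟨(x - p) - (r * (-f (v₀ - p))⁻¹) • (v₀ - p), ?_,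
        (r * (-f (v₀ - p))⁻¹) • (v₀ - p),
        Submodule.smul_mem _ _ (Submodule.mem_span_singleton_self _), by simp⟩
      rw [← hT, map_sub, map_smul, hr, hw, smul_smul, sub_self]
    · refine sup_le (vectorSpan_mono ℝ hGG') ?_
      rw [Submodule.span_singleton_le_iff_mem]
      exact vsub_mem_vectorSpan ℝ hv₀G' (hGG' hp)
  refine ⟨G', hGG', ?_, ?_, ⟨fun x hx => hx.1, ?_⟩, ?_⟩
  · exact (hV.isClosed_convexHull ℝ).inter
      (isClosed_singleton.preimage (g.continuous.comp (continuous_id.sub continuous_const)))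
  · rintro x ⟨hx, hx'⟩ y ⟨hy, hy'⟩ s t hs ht hst
    refine ⟨convex_convexHull ℝ V hx hy hs ht hst, ?_⟩
    rw [map_sub] at *
    rw [map_add, map_smul, map_smul, sub_eq_zero.1 hx', sub_eq_zero.1 hy', ← add_smul, hst,
      one_smul, sub_self]
  · rintro x hx y hy z ⟨-, hz⟩ ⟨s, t, hs, ht, hst, rfl⟩
    refine ⟨hx, ?_⟩
    have hsub : s • x + t • y - p = s • (x - p) + t • (y - p) := by
      nth_rewrite 1 [← one_smul ℝ p, ← hst]
      module
    rw [hsub, map_add, map_smul, map_smul, smul_eq_mul, smul_eq_mul] at hz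
    have h1 := mul_nonpos_of_nonneg_of_nonpos hs.le (hpoly x hx).1
    have h2 := mul_nonpos_of_nonneg_of_nonpos ht.le (hpoly y hy).1
    exact (mul_eq_zero.1 (by linarith : s * g (x - p) = 0)).resolve_left hs.ne'
  · rw [hspan, Submodule.finrank_sup_span_singleton hv₀L]

/-- A face of a full-dimensional polytope is contained in a face of any prescribed larger
dimension. -/
theorem exists_face_finrank_eq {E : Type*} [NormedAddCommGroup E] [InnerProductSpace ℝ E]
    [FiniteDimensional ℝ E] {V F : Set E} (hV : V.Finite) (hne : F.Nonempty) (hF : Convex ℝ F)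
    (hFc : IsClosed F) (hPF : IsExtreme ℝ (convexHull ℝ V) F)
    (hint : (interior (convexHull ℝ V)).Nonempty) {k : ℕ}
    (hFk : Module.finrank ℝ (vectorSpan ℝ F) ≤ k) (hk : k ≤ Module.finrank ℝ E) :
    ∃ G : Set E, F ⊆ G ∧ IsClosed G ∧ Convex ℝ G ∧ IsExtreme ℝ (convexHull ℝ V) G ∧
      Module.finrank ℝ (vectorSpan ℝ G) = k := by
  induction k, hFk using Nat.le_induction with
  | base => exact ⟨F, subset_rfl, hFc, hF, hPF, rfl⟩
  | succ k _ ih =>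
    obtain ⟨G, hFG, -, hG, hPG, hGk⟩ := ih (by omega)
    have hVG : ¬ V ⊆ G := by
      intro h
      have htop : affineSpan ℝ G = ⊤ := affineSpan_eq_top_of_nonempty_interior
        (hint.mono (interior_mono (convexHull_mono h)))
      rw [← direction_affineSpan, htop, AffineSubspace.direction_top, finrank_top] at hGk
      omega
    obtain ⟨G', hGG', h1, h2, h3, h4⟩ :=
      exists_face_finrank_succ hV (hne.mono hFG) hG hPG hVG
    exact ⟨G', hFG.trans hGG', h1, h2, h3, by rw [h4, hGk]⟩

/-- Two extreme points of a set containing the origin that lie on a common open ray from the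
origin coincide. -/
theorem eq_of_mem_extremePoints_of_eq_smul {E : Type*} [AddCommGroup E] [Module ℝ E] {P : Set E}
    (h0 : (0 : E) ∈ P) {x y : E} (hx : x ∈ P.extremePoints ℝ) (hy : y ∈ P.extremePoints ℝ)
    {r : ℝ} (hr : 0 < r) (hxy : y = r • x) : y = x := by
  have key : ∀ {x y : E}, x ∈ P.extremePoints ℝ → y ∈ P → ∀ {s : ℝ}, 0 < s → s < 1 →
      x = s • y → y = x := by
    intro x y hx hy s hs hs1 hxy
    have hx0 : (0 : E) = x := hx.2 h0 hy ⟨1 - s, s, by linarith, hs, by ring, by simp [hxy]⟩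
    rw [← hx0] at hxy ⊢
    exact (smul_eq_zero.1 hxy.symm).resolve_left hs.ne'
  rcases lt_trichotomy r 1 with h | h | h
  · exact (key hy hx.1 hr h hxy).symm
  · rw [hxy, h, one_smul]
  · exact key hx hy.1 (inv_pos.2 hr) (inv_lt_one_of_one_lt₀ h) (by
      rw [hxy, inv_smul_smul₀ hr.ne'])

/-- Scaling by a nonzero factor preserves extreme subsets. -/
theorem IsExtreme.smul_set {E : Type*} [AddCommGroup E] [Module ℝ E] {A B : Set E}
    (h : IsExtreme ℝ A B) {c : ℝ} (hc : c ≠ 0) :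
    IsExtreme ℝ ((fun x => c • x) '' A) ((fun x => c • x) '' B) := by
  refine ⟨Set.image_mono h.subset, ?_⟩
  rintro _ ⟨x, hx, rfl⟩ _ ⟨y, hy, rfl⟩ _ ⟨z, hz, rfl⟩ ⟨s, t, hs, ht, hst, hz'⟩
  refine ⟨x, h.2 hx hy hz ⟨s, t, hs, ht, hst, ?_⟩, rfl⟩
  apply smul_right_injective E hc
  simp only [← hz', smul_add, smul_smul, mul_comm c]

/-- Under the ridge reflection hypothesis, every low-dimensional face of the polytope has a
negative multiple that is again a face. -/
theorem exists_isExtreme_neg_smul_image {n : ℕ} {P V : Set (EuclideanSpace ℝ (Fin n))}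
    (hVfin : V.Finite) (hP : P = convexHull ℝ V)
    (h0 : (0 : EuclideanSpace ℝ (Fin n)) ∈ interior P)
    (hface : ∀ G : Set (EuclideanSpace ℝ (Fin n)), G.Nonempty → IsClosed G → Convex ℝ G →
      IsExtreme ℝ P G → Module.finrank ℝ (affineSpan ℝ G).direction = n - 2 →
      ∀ η ∈ Metric.sphere (0 : EuclideanSpace ℝ (Fin n)) 1,
        (∀ x ∈ G, ∀ y ∈ G, ⟪x - y, η⟫ = 0) → (∃ c : ℝ, c • η ∈ affineSpan ℝ G) →
        (∀ x ∈ G, ⟪x, η⟫ ≤ 0) →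
        ∃ t > (0 : ℝ), IsExtreme ℝ P {x | ⟪x, η⟫ = t ∧ ∃ s : ℝ, s • x ∈ G})
    (hn : 0 < n) {F : Set (EuclideanSpace ℝ (Fin n))} (hne : F.Nonempty) (hFc : IsClosed F)
    (hF : Convex ℝ F) (hPF : IsExtreme ℝ P F)
    (hdim : Module.finrank ℝ (vectorSpan ℝ F) ≤ n - 2) :
    ∃ c < (0 : ℝ), IsExtreme ℝ P ((fun x => c • x) '' F) := by
  obtain ⟨G, hFG, hGc, hG, hPG, hGn⟩ := exists_face_finrank_eq hVfin hne hF hFc (hP ▸ hPF)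
    ⟨0, hP ▸ h0⟩ hdim (by simp)
  rw [← hP] at hPG
  obtain ⟨p, hp⟩ : G.Nonempty := hne.mono hFG
  have h0G : (0 : EuclideanSpace ℝ (Fin n)) ∉ affineSpan ℝ G := by
    intro h
    have h0G := hPG.mem_of_mem_affineSpan hG ⟨p, hp⟩ (interior_subset h0) h
    have hPsub : P ⊆ G := by
      intro x hx
      have hcont : Filter.Tendsto (fun r : ℝ => r • x) (nhds 0) (nhds 0) := by
        have : Continuous fun r : ℝ => r • x := by fun_prop
        simpa using this.tendsto 0
      have hev := hcont.eventually (mem_interior_iff_mem_nhds.1 h0)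
      obtain ⟨ε, hε, hball⟩ := Metric.eventually_nhds_iff.1 hev
      have hy : (-(ε / 2)) • x ∈ P := hball (by
        rw [dist_zero_right, Real.norm_eq_abs, abs_neg, abs_of_pos (half_pos hε)]
        exact half_lt_self hε)
      refine hPG.2 hx hy h0G ⟨(ε / 2) / (1 + ε / 2), 1 / (1 + ε / 2), by positivity,
        by positivity, by field_simp; ring, ?_⟩
      rw [smul_smul, ← add_smul]
      convert zero_smul ℝ x
      ring
    have htop : affineSpan ℝ G = ⊤ :=
      affineSpan_eq_top_of_nonempty_interior (s := G) (by
        rw [hG.convexHull_eq]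
        exact ⟨0, interior_mono hPsub h0⟩)
    rw [← direction_affineSpan, htop, AffineSubspace.direction_top, finrank_top,
      finrank_euclideanSpace_fin] at hGn
    omega
  set L := vectorSpan ℝ G with hL
  set q := Lᗮ.starProjection p with hq
  have hpA : p ∈ affineSpan ℝ G := subset_affineSpan ℝ G hp
  have hqA : q ∈ affineSpan ℝ G := by
    rw [← AffineSubspace.vsub_left_mem_direction_iff_mem hpA, direction_affineSpan, vsub_eq_sub,
      ← hL, ← L.orthogonal_orthogonal]
    exact Submodule.sub_starProjection_mem_orthogonal p
  have hq0 : q ≠ 0 := fun h => h0G (h ▸ hqA)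
  have hqpos : 0 < ‖q‖ := norm_pos_iff.2 hq0
  have hqL : ∀ l ∈ L, ⟪l, q⟫ = 0 := fun l hl =>
    (Submodule.mem_orthogonal L q).1 (Submodule.starProjection_apply_mem _ _) l hl
  have hGq (x) (hx : x ∈ G) : ⟪x, (-‖q‖⁻¹) • q⟫ = -‖q‖ := by
    have hxq : x - q ∈ L := by
      rw [← vsub_eq_sub, hL, ← direction_affineSpan]
      exact AffineSubspace.vsub_mem_direction (subset_affineSpan ℝ G hx) hqA
    have h1 := hqL _ hxq
    rw [inner_sub_left, real_inner_self_eq_norm_sq] at h1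
    rw [inner_smul_right, sub_eq_zero.1 h1]
    field_simp
  obtain ⟨t, ht, hR⟩ := hface G ⟨p, hp⟩ hGc hG hPG (by rw [direction_affineSpan, hGn])
    ((-‖q‖⁻¹) • q) (by simp [norm_smul, hqpos.ne'])
    (fun x hx y hy => by rw [inner_sub_left, hGq x hx, hGq y hy, sub_self])
    ⟨-‖q‖, by simpa [smul_smul, hqpos.ne'] using hqA⟩
    (fun x hx => by rw [hGq x hx]; linarith)
  have hc : -(t / ‖q‖) < 0 := neg_lt_zero.2 (by positivity)
  refine ⟨-(t / ‖q‖), hc, ?_⟩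
  have hset : {x | ⟪x, (-‖q‖⁻¹) • q⟫ = t ∧ ∃ s : ℝ, s • x ∈ G} =
      (fun x => (-(t / ‖q‖)) • x) '' G := by
    ext x
    constructor
    · rintro ⟨hx, s, hs⟩
      refine ⟨s • x, hs, ?_⟩
      have h1 := hGq _ hs
      rw [real_inner_smul_left, hx] at h1
      have h2 : -(t / ‖q‖) * s = 1 := by
        field_simp
        linarith
      simp only [smul_smul, h2, one_smul]
    · rintro ⟨y, hy, rfl⟩
      refine ⟨?_, (-(t / ‖q‖))⁻¹, ?_⟩
      · rw [real_inner_smul_left, hGq y hy]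
        field_simp
      · simpa only [inv_smul_smul₀ hc.ne] using hy
  rw [hset] at hR
  exact hR.trans ((hPF.mono hPG.subset hFG).smul_set hc.ne)

/-- if a convex polytope `P ⊆ ℝⁿ` (`n ≥ 3`, with `0` in its interior) is
such that for every `(n-2)`-dimensional face `G` (a nonempty closed convex extreme
subset of affine dimension `n-2`) there is `t > 0` with `reflec(G, t)` also an
`(n-2)`-dimensional face, then: (a) for every vertex `v`, the line `ℝ v` contains
exactly one other vertex, lying on the opposite side of the origin; (b) if vertices
`u, v` are joined by an edge, then the opposite vertices `u', v'` are joined by an edge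
parallel to it.  Here `η` characterizes `η_G` (unit, orthogonal to the directions of
`G`, with `ℝ η` meeting `aff G`, and `G ⊆ {⟪·, η⟫ ≤ 0}`), and
`reflec(G, t) = {x : ⟪x, η⟫ = t ∧ ℝ x meets G}`. -/
theorem stmt18 {n : ℕ} (hn : 3 ≤ n) (P V : Set (EuclideanSpace ℝ (Fin n)))
    (hVfin : V.Finite) (hP : P = convexHull ℝ V)
    (h0 : (0 : EuclideanSpace ℝ (Fin n)) ∈ interior P)
    (hface : ∀ G : Set (EuclideanSpace ℝ (Fin n)), G.Nonempty → IsClosed G → Convex ℝ G →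
      IsExtreme ℝ P G → Module.finrank ℝ (affineSpan ℝ G).direction = n - 2 →
      ∀ η ∈ Metric.sphere (0 : EuclideanSpace ℝ (Fin n)) 1,
        (∀ x ∈ G, ∀ y ∈ G, ⟪x - y, η⟫ = 0) → (∃ c : ℝ, c • η ∈ affineSpan ℝ G) →
        (∀ x ∈ G, ⟪x, η⟫ ≤ 0) →
        ∃ t > (0 : ℝ),
          IsExtreme ℝ P {x | ⟪x, η⟫ = t ∧ ∃ s : ℝ, s • x ∈ G} ∧
          Module.finrank ℝ
            (affineSpan ℝ {x : EuclideanSpace ℝ (Fin n) | ⟪x, η⟫ = t ∧ ∃ s : ℝ, s • x ∈ G}).direction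
            = n - 2) :
    (∀ v ∈ Set.extremePoints ℝ P, ∃ w ∈ Set.extremePoints ℝ P,
      (∃ c < (0 : ℝ), w = c • v) ∧
      ∀ w' ∈ Set.extremePoints ℝ P, w' ≠ v → (∃ c : ℝ, w' = c • v) → w' = w) ∧
    (∀ u ∈ Set.extremePoints ℝ P, ∀ v ∈ Set.extremePoints ℝ P, u ≠ v →
      IsExtreme ℝ P (segment ℝ u v) →
      ∀ u' v' : EuclideanSpace ℝ (Fin n),
        (u' ∈ Set.extremePoints ℝ P ∧ ∃ c < (0 : ℝ), u' = c • u) →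
        (v' ∈ Set.extremePoints ℝ P ∧ ∃ c < (0 : ℝ), v' = c • v) →
        IsExtreme ℝ P (segment ℝ u' v') ∧ ∃ c : ℝ, c ≠ 0 ∧ v' - u' = c • (v - u)) := by
  have hface' {F : Set (EuclideanSpace ℝ (Fin n))} := exists_isExtreme_neg_smul_image hVfin hP h0
    (fun G h1 h2 h3 h4 h5 η h6 h7 h8 h9 =>
      let ⟨t, ht, h, _⟩ := hface G h1 h2 h3 h4 h5 η h6 h7 h8 h9
      ⟨t, ht, h⟩) (by omega) (F := F)
  have h0P : (0 : EuclideanSpace ℝ (Fin n)) ∈ P := interior_subset h0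
  have huniq {x y y' : EuclideanSpace ℝ (Fin n)} (hy : y ∈ Set.extremePoints ℝ P)
      (hy' : y' ∈ Set.extremePoints ℝ P) {c c' : ℝ} (hc : c < 0) (hc' : c' < 0)
      (h : y = c • x) (h' : y' = c' • x) : y' = y :=
    eq_of_mem_extremePoints_of_eq_smul h0P hy hy' (div_pos_of_neg_of_neg hc' hc)
      (by rw [h, h', smul_smul, div_mul_cancel₀ _ hc.ne])
  refine ⟨fun v hv => ?_, fun u hu v hv _ huv u' v' ⟨hu', a, ha, hua⟩ ⟨hv', b, hb, hvb⟩ => ?_⟩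
  · obtain ⟨c, hc, h⟩ := hface' (Set.singleton_nonempty v) isClosed_singleton (convex_singleton v)
      (isExtreme_singleton.2 hv)
      (by rw [vectorSpan_singleton, finrank_bot]; exact Nat.zero_le _)
    rw [Set.image_singleton, isExtreme_singleton] at h
    refine ⟨c • v, h, ⟨c, hc, rfl⟩, ?_⟩
    rintro w' hw' hne ⟨d, rfl⟩
    rcases lt_trichotomy d 0 with hd | rfl | hd
    · exact huniq h hw' hc hd rfl rfl
    · rw [zero_smul] at hw' hne
      refine absurd (hw'.2 hv.1 h.1 ⟨-c / (1 - c), 1 / (1 - c), ?_, ?_, ?_, ?_⟩).symm hne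
      · exact div_pos (by linarith) (by linarith)
      · exact div_pos one_pos (by linarith)
      · rw [← add_div, div_eq_one_iff_eq (by linarith)]
        ring
      · rw [smul_smul, ← add_smul]
        convert zero_smul ℝ v
        ring
    · exact absurd (eq_of_mem_extremePoints_of_eq_smul h0P hv hw' hd rfl) hne
  · obtain ⟨c, hc, h⟩ := hface' ⟨u, left_mem_segment ℝ u v⟩
      (by
        rw [← convexHull_pair]
        exact (Set.toFinite {u, v}).isClosed_convexHull ℝ)
      (convex_segment u v) huv (by
        rw [← convexHull_pair, ← direction_affineSpan, affineSpan_convexHull,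
          direction_affineSpan, vectorSpan_pair]
        exact (finrank_span_le_card _).trans (by simp; omega))
    have himg : (fun x => c • x) '' segment ℝ u v = segment ℝ (c • u) (c • v) :=
      image_segment ℝ (LinearMap.lsmul ℝ (EuclideanSpace ℝ (Fin n)) c).toAffineMap u v
    have hcx {x : EuclideanSpace ℝ (Fin n)} (hx : x ∈ Set.extremePoints ℝ P)
        (hxs : x ∈ segment ℝ u v) : c • x ∈ Set.extremePoints ℝ P := by
      have h1 := ((isExtreme_singleton.2 hx).mono huv.subset
        (Set.singleton_subset_iff.2 hxs)).smul_set hc.ne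
      rw [Set.image_singleton] at h1
      exact isExtreme_singleton.1 (h.trans h1)
    have hu1 := huniq (hcx hu (left_mem_segment ℝ u v)) hu' hc ha rfl hua
    have hv1 := huniq (hcx hv (right_mem_segment ℝ u v)) hv' hc hb rfl hvb
    rw [hu1, hv1, ← himg]
    exact ⟨h, c, hc.ne, (smul_sub c v u).symm⟩
end
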